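/- Under the conditions of the main theorem (conditions (★)), as n → ∞, hit(d,X) = exp( (1−λ)X/(λn) − (1+λ)X₂/(2λn) − (1+λ)(1+2λ)X₃/(6λ²n²) + (1−λ)X²/(λn²) − L/(λ(1−λ)n²) + C_{1,1}/(λn) + (1+2λ)C_{1,2}/(2λ²n²) − C_{2,1}/(2λ²n²) + O(n^{−b}) ). -/

import Mathlib

open Filter Finset Asymptotics MeasureTheory
open scoped Classical Topology

noncomputable section

/-- The number of simple graphs on `Fin n` with degree sequence `d` having
no edge in common with the graph `X`. -/
def gCount {n : ℕ} (d : Fin n → ℕ) (X : SimpleGraph (Fin n)) : ℕ :=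
  Nat.card {H : SimpleGraph (Fin n) //
    (∀ v, Nat.card (H.neighborSet v) = d v) ∧ Disjoint H.edgeSet X.edgeSet}

/-- The degree `x_j` of vertex `j` in the graph `X`. -/
def xDeg {n : ℕ} (X : SimpleGraph (Fin n)) (j : Fin n) : ℕ :=
  Nat.card (X.neighborSet j)

/-- The number of edges of `X`. -/
def xEdges {n : ℕ} (X : SimpleGraph (Fin n)) : ℕ := Nat.card X.edgeSet

/-- The average degree `d̄ = 2E/n`. -/
def dBar {n : ℕ} (d : Fin n → ℕ) : ℝ := (∑ j, (d j : ℝ)) / n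

/-- The density `λ = d̄/(n-1)`. -/
def lamb {n : ℕ} (d : Fin n → ℕ) : ℝ := dBar d / ((n : ℝ) - 1)

/-- `A = λ(1-λ)/2`. -/
def aPar {n : ℕ} (d : Fin n → ℕ) : ℝ := lamb d * (1 - lamb d) / 2

/-- `δ_j = d_j - d̄ + λ x_j`. -/
def deltaPar {n : ℕ} (d : Fin n → ℕ) (X : SimpleGraph (Fin n)) (j : Fin n) : ℝ :=
  (d j : ℝ) - dBar d + lamb d * (xDeg X j : ℝ)

/-- The sum over unordered pairs `{j,k}` with `X.Adj j k` of `f j * f k`. -/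
def pairSum {n : ℕ} (X : SimpleGraph (Fin n)) (f : Fin n → ℝ) : ℝ :=
  (∑ j, ∑ k, if X.Adj j k then f j * f k else 0) / 2

/-- `R = Σ_j (d_j - d̄)²`. -/
def rPar {n : ℕ} (d : Fin n → ℕ) : ℝ := ∑ j, ((d j : ℝ) - dBar d)^2

/-- The naive estimate `Ĝ(d,X)`. -/
def gHat {n : ℕ} (d : Fin n → ℕ) (X : SimpleGraph (Fin n)) : ℝ :=
  (1 - lamb d) ^ (-(xEdges X : ℝ)) *
  (lamb d ^ lamb d * (1 - lamb d) ^ (1 - lamb d)) ^ n.choose 2 *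
  ∏ j, ((n - 1 - xDeg X j).choose (d j) : ℝ)

/-- `X_ℓ = Σ_j x_j^ℓ`. -/
def xPow {n : ℕ} (X : SimpleGraph (Fin n)) (ℓ : ℕ) : ℝ := ∑ j, (xDeg X j : ℝ)^ℓ

/-- `C_{ℓ,m} = Σ_j δ_j^ℓ x_j^m`. -/
def cPar {n : ℕ} (d : Fin n → ℕ) (X : SimpleGraph (Fin n)) (ℓ m : ℕ) : ℝ :=
  ∑ j, (deltaPar d X j)^ℓ * (xDeg X j : ℝ)^m

/-- `miss(d,X) = G(d,X) / ((1-λ)^X G(d))`. -/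
def missPar {n : ℕ} (d : Fin n → ℕ) (X : SimpleGraph (Fin n)) : ℝ :=
  (gCount d X : ℝ) / ((1 - lamb d) ^ xEdges X * (gCount d ⊥ : ℝ))

/-- `hit(d,X) = G(d-x,X) / (λ^X G(d))`. -/
def hitPar {n : ℕ} (d : Fin n → ℕ) (X : SimpleGraph (Fin n)) : ℝ :=
  (gCount (fun j => d j - xDeg X j) X : ℝ) / (lamb d ^ xEdges X * (gCount d ⊥ : ℝ))

namespace DegreeSeq

variable {n : ℕ}

/-- The indicator of adjacency, as a real number. -/
def ind (H : SimpleGraph (Fin n)) (a b : Fin n) : ℝ := if H.Adj a b then 1 else 0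

/-- The degree of a vertex, as a real number. -/
def deg (H : SimpleGraph (Fin n)) (v : Fin n) : ℝ := ∑ u, ind H v u

/-- The graphs with degree sequence `d` that agree with `H₀` on the pairs in `W`. -/
def cls (d : Fin n → ℝ) (W H₀ : SimpleGraph (Fin n)) : Finset (SimpleGraph (Fin n)) :=
  univ.filter fun H => (∀ v, deg H v = d v) ∧ H ⊓ W = H₀ ⊓ W

/-- The average of `φ` over a finite set of graphs. -/
def ev (S : Finset (SimpleGraph (Fin n))) (φ : SimpleGraph (Fin n) → ℝ) : ℝ :=
  (∑ H ∈ S, φ H) / (#S : ℝ)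

section Average

variable {S : Finset (SimpleGraph (Fin n))} {φ ψ : SimpleGraph (Fin n) → ℝ}

lemma ev_add : ev S (fun H => φ H + ψ H) = ev S φ + ev S ψ := by
  simp only [ev, sum_add_distrib, add_div]

lemma ev_sub : ev S (fun H => φ H - ψ H) = ev S φ - ev S ψ := by
  simp only [ev, sum_sub_distrib, sub_div]

lemma ev_neg : ev S (fun H => - φ H) = - ev S φ := by
  simp only [ev, sum_neg_distrib, neg_div]

lemma ev_const_mul (c : ℝ) : ev S (fun H => c * φ H) = c * ev S φ := by
  simp only [ev, ← mul_sum, mul_div_assoc]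

lemma ev_sum {ι : Type*} (I : Finset ι) (φ : ι → SimpleGraph (Fin n) → ℝ) :
    ev S (fun H => ∑ i ∈ I, φ i H) = ∑ i ∈ I, ev S (φ i) := by
  simp only [ev]
  rw [sum_comm, sum_div]

lemma ev_congr (h : ∀ H ∈ S, φ H = ψ H) : ev S φ = ev S ψ := by
  simp only [ev, sum_congr rfl h]

lemma ev_mono (h : ∀ H ∈ S, φ H ≤ ψ H) : ev S φ ≤ ev S ψ := by
  unfold ev
  gcongr with H hH
  exact h H hH

lemma ev_const (hS : S.Nonempty) (c : ℝ) : ev S (fun _ => c) = c := by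
  have : (#S : ℝ) ≠ 0 := by exact_mod_cast hS.card_pos.ne'
  simp [ev, this]

lemma abs_ev_le_ev_abs : |ev S φ| ≤ ev S (fun H => |φ H|) := by
  unfold ev
  rw [abs_div, Nat.abs_cast]
  gcongr
  exact abs_sum_le_sum_abs _ _

lemma abs_ev_le {B : ℝ} (hB : 0 ≤ B) (h : ∀ H ∈ S, |φ H| ≤ B) : |ev S φ| ≤ B := by
  rcases S.eq_empty_or_nonempty with rfl | hS
  · simpa [ev] using hB
  · exact abs_ev_le_ev_abs.trans ((ev_mono h).trans (ev_const hS B).le)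

end Average

lemma ind_symm (H : SimpleGraph (Fin n)) (a b : Fin n) : ind H a b = ind H b a := by
  simp only [ind, H.adj_comm]

lemma ind_nonneg (H : SimpleGraph (Fin n)) (a b : Fin n) : 0 ≤ ind H a b := by
  unfold ind; split_ifs <;> norm_num

lemma ind_le_one (H : SimpleGraph (Fin n)) (a b : Fin n) : ind H a b ≤ 1 := by
  unfold ind; split_ifs <;> norm_num

lemma ind_self (H : SimpleGraph (Fin n)) (a : Fin n) : ind H a a = 0 := by
  simp [ind]

lemma ind_eq_zero_or_one (H : SimpleGraph (Fin n)) (a b : Fin n) :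
    ind H a b = 0 ∨ ind H a b = 1 := by
  unfold ind; split_ifs <;> simp

lemma deg_nonneg (H : SimpleGraph (Fin n)) (v : Fin n) : 0 ≤ deg H v :=
  sum_nonneg fun _ _ => ind_nonneg _ _ _

lemma deg_eq_card (H : SimpleGraph (Fin n)) (v : Fin n) :
    deg H v = (#(univ.filter fun u => H.Adj v u) : ℝ) := by
  simp [deg, ind]

lemma deg_inf_le (H W : SimpleGraph (Fin n)) (v : Fin n) : deg (H ⊓ W) v ≤ deg W v := by
  unfold deg
  gcongr with u
  unfold ind
  by_cases h : W.Adj v u <;> simp [h]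
  split_ifs <;> norm_num

lemma mem_cls {d : Fin n → ℝ} {W H₀ H : SimpleGraph (Fin n)} :
    H ∈ cls d W H₀ ↔ (∀ v, deg H v = d v) ∧ H ⊓ W = H₀ ⊓ W := by
  simp [cls]

lemma self_mem_cls {d : Fin n → ℝ} {W H₀ : SimpleGraph (Fin n)} (h : ∀ v, deg H₀ v = d v) :
    H₀ ∈ cls d W H₀ := mem_cls.2 ⟨h, rfl⟩

lemma inf_eq_inf_iff {W H H' : SimpleGraph (Fin n)} :
    H ⊓ W = H' ⊓ W ↔ ∀ a b, W.Adj a b → (H.Adj a b ↔ H'.Adj a b) := by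
  constructor
  · intro h a b hW
    have := congrArg (fun G : SimpleGraph (Fin n) => G.Adj a b) h
    simpa [hW] using this
  · intro h
    ext a b
    by_cases hW : W.Adj a b
    · simp [hW, h a b hW]
    · simp [hW]

/-- Toggle the four pairs between `{j, k}` and `{l, m}`. -/
def toggle (j k l m : Fin n) (H : SimpleGraph (Fin n)) : SimpleGraph (Fin n) where
  Adj a b := a ≠ b ∧ ¬ (H.Adj a b ↔
    ((a = j ∨ a = k) ∧ (b = l ∨ b = m)) ∨ ((b = j ∨ b = k) ∧ (a = l ∨ a = m)))
  symm := ⟨fun a b h => ⟨h.1.symm, by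
    have := h.2
    rw [H.adj_comm b a, or_comm]
    exact this⟩⟩
  loopless := ⟨fun a h => h.1 rfl⟩

lemma toggle_toggle (j k l m : Fin n) (H : SimpleGraph (Fin n)) :
    toggle j k l m (toggle j k l m H) = H := by
  ext a b
  by_cases hab : a = b
  · subst hab; simp [toggle]
  · simp only [toggle, ne_eq, hab, not_false_eq_true, true_and]
    tauto

/-- `H` contains exactly the pairs `jl` and `km` among the four pairs between
`{j, k}` and `{l, m}`. -/
def Pattern (j k l m : Fin n) (H : SimpleGraph (Fin n)) : Prop :=
  H.Adj j l ∧ H.Adj k m ∧ ¬ H.Adj j m ∧ ¬ H.Adj k l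

lemma Pattern.toggle {j k l m : Fin n} {H : SimpleGraph (Fin n)}
    (h : Pattern j k l m H) (hjk : j ≠ k) (hlm : l ≠ m) (hjl : j ≠ l) (hjm : j ≠ m)
    (hkl : k ≠ l) (hkm : k ≠ m) : Pattern j k m l (toggle j k l m H) := by
  obtain ⟨h1, h2, h3, h4⟩ := h
  simp [Pattern, DegreeSeq.toggle, *]

lemma ind_toggle_left {j k l m : Fin n} {H : SimpleGraph (Fin n)}
    (h : Pattern j k l m H) (hjk : j ≠ k) (hlm : l ≠ m) (hjl : j ≠ l) (hjm : j ≠ m)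
    (hkl : k ≠ l) (hkm : k ≠ m) (x : Fin n) :
    ind (toggle j k l m H) j x = ind H j (Equiv.swap l m x) := by
  obtain ⟨h1, h2, h3, h4⟩ := h
  by_cases hxl : x = l
  · subst hxl
    simp [ind, toggle, *]
  by_cases hxm : x = m
  · subst hxm
    simp [ind, toggle, *]
  rw [Equiv.swap_apply_of_ne_of_ne hxl hxm]
  by_cases hxj : x = j
  · subst hxj; simp [ind]
  simp [ind, toggle, *, Ne.symm hxj]

lemma toggle_swap_left (j k l m : Fin n) (H : SimpleGraph (Fin n)) :
    toggle j k l m H = toggle k j m l H := by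
  ext a b
  simp only [toggle, or_comm]

lemma toggle_swap_right (j k l m : Fin n) (H : SimpleGraph (Fin n)) :
    toggle j k m l H = toggle j k l m H := by
  ext a b
  simp only [toggle]
  rw [or_comm (a := b = m), or_comm (a := a = m)]

lemma toggle_transpose (j k l m : Fin n) (H : SimpleGraph (Fin n)) :
    toggle j k l m H = toggle l m j k H := by
  ext a b
  simp only [toggle]
  rw [or_comm, and_comm (a := b = j ∨ b = k), and_comm (a := a = j ∨ a = k)]

lemma ind_toggle_other {j k l m : Fin n} {H : SimpleGraph (Fin n)} {a : Fin n}
    (h1 : a ≠ j) (h2 : a ≠ k) (h3 : a ≠ l) (h4 : a ≠ m) (x : Fin n) :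
    ind (toggle j k l m H) a x = ind H a x := by
  by_cases hxa : a = x
  · subst hxa; simp [ind]
  simp [ind, toggle, *]

lemma Pattern.symm {j k l m : Fin n} {H : SimpleGraph (Fin n)}
    (h : Pattern j k l m H) : Pattern k j m l H := ⟨h.2.1, h.1, h.2.2.2, h.2.2.1⟩

lemma Pattern.transpose {j k l m : Fin n} {H : SimpleGraph (Fin n)}
    (h : Pattern j k l m H) : Pattern l m j k H :=
  ⟨h.1.symm, h.2.1.symm, fun h' => h.2.2.2 h'.symm, fun h' => h.2.2.1 h'.symm⟩

lemma deg_toggle {j k l m : Fin n} {H : SimpleGraph (Fin n)}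
    (h : Pattern j k l m H) (hjk : j ≠ k) (hlm : l ≠ m) (hjl : j ≠ l) (hjm : j ≠ m)
    (hkl : k ≠ l) (hkm : k ≠ m) (v : Fin n) : deg (toggle j k l m H) v = deg H v := by
  have key : ∀ {j k l m : Fin n}, Pattern j k l m H → j ≠ k → l ≠ m → j ≠ l → j ≠ m →
      k ≠ l → k ≠ m → deg (toggle j k l m H) j = deg H j := by
    intro j k l m h hjk hlm hjl hjm hkl hkm
    simp only [deg, ind_toggle_left h hjk hlm hjl hjm hkl hkm]
    exact Equiv.sum_comp (Equiv.swap l m) (fun x => ind H j x)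
  by_cases h1 : v = j
  · subst h1; exact key h hjk hlm hjl hjm hkl hkm
  by_cases h2 : v = k
  · subst h2
    rw [toggle_swap_left]
    exact key h.symm hjk.symm hlm.symm hkm hkl hjm hjl
  by_cases h3 : v = l
  · subst h3
    rw [toggle_transpose]
    exact key h.transpose hlm hjk hjl.symm hkl.symm hjm.symm hkm.symm
  by_cases h4 : v = m
  · subst h4
    rw [toggle_transpose, toggle_swap_left]
    exact key h.transpose.symm hlm.symm hjk.symm hkm.symm hjm.symm hkl.symm hjl.symm
  simp only [deg, ind_toggle_other h1 h2 h3 h4]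

lemma toggle_mem_cls {d : Fin n → ℝ} {W H₀ H : SimpleGraph (Fin n)} {j k l m : Fin n}
    (hH : H ∈ cls d W H₀) (h : Pattern j k l m H) (hjk : j ≠ k) (hlm : l ≠ m)
    (hjl : ¬ W.Adj j l) (hjm : ¬ W.Adj j m) (hkl : ¬ W.Adj k l) (hkm : ¬ W.Adj k m)
    (hjm' : j ≠ m) (hkl' : k ≠ l) : toggle j k l m H ∈ cls d W H₀ := by
  rw [mem_cls] at hH ⊢
  refine ⟨fun v => ?_, ?_⟩
  · rw [deg_toggle h hjk hlm h.1.ne hjm' hkl' h.2.1.ne, hH.1]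
  · rw [← hH.2, inf_eq_inf_iff]
    intro a b hW
    have hc : ¬ (((a = j ∨ a = k) ∧ (b = l ∨ b = m)) ∨ ((b = j ∨ b = k) ∧ (a = l ∨ a = m))) := by
      rintro (⟨rfl | rfl, rfl | rfl⟩ | ⟨rfl | rfl, rfl | rfl⟩)
      exacts [hjl hW, hjm hW, hkl hW, hkm hW, hjl hW.symm, hjm hW.symm, hkl hW.symm, hkm hW.symm]
    simp [toggle, hc, hW.ne]

end DegreeSeq

namespace DegreeSeq

variable {n : ℕ}

/-- The vertices that can be joined freely (with respect to `W`) to both `j` and `k`. -/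
def common (W : SimpleGraph (Fin n)) (j k : Fin n) : Finset (Fin n) :=
  univ.filter fun m => m ≠ j ∧ m ≠ k ∧ ¬ W.Adj j m ∧ ¬ W.Adj k m

lemma mem_common {W : SimpleGraph (Fin n)} {j k m : Fin n} :
    m ∈ common W j k ↔ m ≠ j ∧ m ≠ k ∧ ¬ W.Adj j m ∧ ¬ W.Adj k m := by
  simp [common]

lemma common_comm (W : SimpleGraph (Fin n)) (j k : Fin n) : common W j k = common W k j := by
  ext m; simp only [mem_common]; tauto

/-- The indicator that `m` is a neighbour of `j` but not of `k`. -/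
def only (H : SimpleGraph (Fin n)) (j k m : Fin n) : ℝ := ind H j m * (1 - ind H k m)

/-- The number of vertices of `common W j k` adjacent to `j` but not to `k`. -/
def onlyCount (W H : SimpleGraph (Fin n)) (j k : Fin n) : ℝ :=
  ∑ m ∈ common W j k, only H j k m

/-- The number of vertices of `common W j k` adjacent to exactly one of `j` and `k`. -/
def sdCount (W H : SimpleGraph (Fin n)) (j k : Fin n) : ℝ :=
  onlyCount W H j k + onlyCount W H k j

lemma only_nonneg (H : SimpleGraph (Fin n)) (j k m : Fin n) : 0 ≤ only H j k m :=
  mul_nonneg (ind_nonneg _ _ _) (sub_nonneg.2 (ind_le_one _ _ _))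

lemma only_mul_only_self (H : SimpleGraph (Fin n)) (j k m : Fin n) :
    only H j k m * only H k j m = 0 := by
  unfold only
  rcases ind_eq_zero_or_one H j m with h | h <;> simp [h]

lemma only_mul_only (H : SimpleGraph (Fin n)) (j k l m : Fin n) :
    only H j k l * only H k j m = if Pattern j k l m H then 1 else 0 := by
  unfold only Pattern ind
  by_cases h1 : H.Adj j l <;> by_cases h2 : H.Adj k m <;> by_cases h3 : H.Adj j m <;>
    by_cases h4 : H.Adj k l <;> simp [h1, h2, h3, h4]

lemma onlyCount_nonneg (W H : SimpleGraph (Fin n)) (j k : Fin n) : 0 ≤ onlyCount W H j k :=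
  sum_nonneg fun _ _ => only_nonneg _ _ _ _

lemma sdCount_nonneg (W H : SimpleGraph (Fin n)) (j k : Fin n) : 0 ≤ sdCount W H j k :=
  add_nonneg (onlyCount_nonneg _ _ _ _) (onlyCount_nonneg _ _ _ _)

lemma onlyCount_toggle {W H : SimpleGraph (Fin n)} {j k l m : Fin n} (hjk : j ≠ k)
    (hl : l ∈ common W j k) (hm : m ∈ common W j k) (hlm : l ≠ m) (h : Pattern j k l m H) :
    onlyCount W (toggle j k l m H) j k = onlyCount W H j k := by
  rw [mem_common] at hl hm
  unfold onlyCount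
  refine sum_equiv (Equiv.swap l m) (fun x => ?_) (fun x _ => ?_)
  · by_cases hxl : x = l
    · subst hxl; simp [mem_common, hl, hm]
    by_cases hxm : x = m
    · subst hxm; simp [mem_common, hl, hm]
    rw [Equiv.swap_apply_of_ne_of_ne hxl hxm]
  · unfold only
    rw [ind_toggle_left h hjk hlm hl.1.symm hm.1.symm hl.2.1.symm hm.2.1.symm,
      toggle_swap_left,
      ind_toggle_left h.symm hjk.symm hlm.symm hm.2.1.symm hl.2.1.symm hm.1.symm hl.1.symm,
      Equiv.swap_comm m l]

lemma sum_only_mul_only_swap {d : Fin n → ℝ} {W H₀ : SimpleGraph (Fin n)} {j k l m : Fin n}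
    (hjk : j ≠ k) (hl : l ∈ common W j k) (hm : m ∈ common W j k) (ψ : ℝ → ℝ → ℝ) :
    ∑ H ∈ cls d W H₀, only H j k l * only H k j m * ψ (onlyCount W H j k) (onlyCount W H k j)
      = ∑ H ∈ cls d W H₀,
        only H k j l * only H j k m * ψ (onlyCount W H j k) (onlyCount W H k j) := by
  by_cases hlm : l = m
  · subst hlm
    simp only [only_mul_only_self, mul_comm (only _ k j l)]
  have hl' := mem_common.1 hl
  have hm' := mem_common.1 hm
  have e : ∀ H : SimpleGraph (Fin n), only H k j l * only H j k m
      = if Pattern j k m l H then 1 else 0 := fun H => by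
    rw [mul_comm, only_mul_only]
  simp only [e, only_mul_only, ite_mul, one_mul, zero_mul, ← sum_filter]
  have back : ∀ H, Pattern j k m l H → Pattern j k l m (toggle j k l m H) := fun H h => by
    have := h.toggle hjk (Ne.symm hlm) hm'.1.symm hl'.1.symm hm'.2.1.symm hl'.2.1.symm
    rwa [toggle_swap_right] at this
  refine sum_nbij' (toggle j k l m) (toggle j k l m) ?_ ?_ ?_ ?_ ?_
  · intro H hH
    rw [mem_filter] at hH ⊢
    exact ⟨toggle_mem_cls hH.1 hH.2 hjk hlm hl'.2.2.1 hm'.2.2.1 hl'.2.2.2 hm'.2.2.2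
      hm'.1.symm hl'.2.1.symm,
      hH.2.toggle hjk hlm hl'.1.symm hm'.1.symm hl'.2.1.symm hm'.2.1.symm⟩
  · intro H hH
    rw [mem_filter] at hH ⊢
    refine ⟨?_, back H hH.2⟩
    have := toggle_mem_cls hH.1 hH.2 hjk (Ne.symm hlm) hm'.2.2.1 hl'.2.2.1 hm'.2.2.2 hl'.2.2.2
      hl'.1.symm hm'.2.1.symm
    rwa [toggle_swap_right] at this
  · intro H _; exact toggle_toggle _ _ _ _ _
  · intro H _; exact toggle_toggle _ _ _ _ _
  · intro H hH
    rw [mem_filter] at hH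
    have h := onlyCount_toggle (W := W) hjk.symm (common_comm W j k ▸ hm)
      (common_comm W j k ▸ hl) (Ne.symm hlm) hH.2.symm
    rw [← toggle_swap_left] at h
    rw [onlyCount_toggle hjk hl hm hlm hH.2, h]

lemma ind_sub_ind (H : SimpleGraph (Fin n)) (j k l : Fin n) :
    ind H j l - ind H k l = only H j k l - only H k j l := by
  unfold only; ring

/-- Given the set of vertices adjacent to exactly one of `j` and `k`, all its distributions
between `j` and `k` are equally likely. -/
lemma ev_ind_sub_ind {d : Fin n → ℝ} {W H₀ : SimpleGraph (Fin n)} {j k l : Fin n}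
    (hjk : j ≠ k) (hl : l ∈ common W j k) :
    ev (cls d W H₀) (fun H => ind H j l - ind H k l) =
      ev (cls d W H₀) (fun H => (only H j k l + only H k j l) *
        (onlyCount W H j k - onlyCount W H k j) / sdCount W H j k) := by
  have key : ∑ H ∈ cls d W H₀, only H j k l * onlyCount W H k j / sdCount W H j k
      = ∑ H ∈ cls d W H₀, only H k j l * onlyCount W H j k / sdCount W H j k := by
    have h1 : ∀ H : SimpleGraph (Fin n), only H j k l * onlyCount W H k j / sdCount W H j k
        = ∑ m ∈ common W j k, only H j k l * only H k j m *
          (onlyCount W H j k + onlyCount W H k j)⁻¹ := fun H => by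
      rw [← sum_mul, ← mul_sum, div_eq_mul_inv, common_comm W j k]; rfl
    have h2 : ∀ H : SimpleGraph (Fin n), only H k j l * onlyCount W H j k / sdCount W H j k
        = ∑ m ∈ common W j k, only H k j l * only H j k m *
          (onlyCount W H j k + onlyCount W H k j)⁻¹ := fun H => by
      rw [← sum_mul, ← mul_sum, div_eq_mul_inv]; rfl
    simp only [h1, h2]
    rw [sum_comm, sum_comm (s := cls d W H₀)]
    exact sum_congr rfl fun m hm =>
      sum_only_mul_only_swap hjk hl hm (fun x y => (x + y)⁻¹)
  have point : ∀ H : SimpleGraph (Fin n), ind H j l - ind H k l -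
      (only H j k l + only H k j l) *
        (onlyCount W H j k - onlyCount W H k j) / sdCount W H j k =
      2 * (only H j k l * onlyCount W H k j / sdCount W H j k) -
      2 * (only H k j l * onlyCount W H j k / sdCount W H j k) := by
    intro H
    rw [ind_sub_ind]
    by_cases hs : sdCount W H j k = 0
    · have h1 := single_le_sum (f := only H j k) (fun i _ => only_nonneg H j k i) hl
      have h2 := single_le_sum (f := only H k j) (fun i _ => only_nonneg H k j i)
        (common_comm W j k ▸ hl)
      have h3 := onlyCount_nonneg W H j k
      have h4 := onlyCount_nonneg W H k j
      have h5 := only_nonneg H j k l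
      have h6 := only_nonneg H k j l
      change _ ≤ onlyCount W H j k at h1
      change _ ≤ onlyCount W H k j at h2
      have hs' : onlyCount W H j k + onlyCount W H k j = 0 := hs
      have a0 : only H j k l = 0 := by linarith
      have b0 : only H k j l = 0 := by linarith
      simp [a0, b0]
    · field_simp
      unfold sdCount
      ring
  rw [← sub_eq_zero, ← ev_sub, ev_congr (fun H _ => point H), ev_sub, ev_const_mul, ev_const_mul]
  simp only [ev, key, sub_self]

end DegreeSeq

namespace DegreeSeq

variable {n : ℕ}

/-- The triple `(l, m, p)` describes a switching of `H` that removes `jl`, `pm` and inserts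
`jm`, `pl`, where `l` is a common neighbour and `m` a common non-neighbour of `j` and `k`. -/
def Forward (W H : SimpleGraph (Fin n)) (j k l m p : Fin n) : Prop :=
  (l ∈ common W j k ∧ H.Adj j l ∧ H.Adj k l) ∧ (m ∈ common W j k ∧ ¬ H.Adj j m ∧ ¬ H.Adj k m) ∧
    H.Adj p m ∧ ¬ H.Adj p l ∧ p ≠ l ∧ ¬ W.Adj p m ∧ ¬ W.Adj p l

/-- The number of switchings increasing the symmetric difference of the neighbourhoods. -/
def forwardCount (W H : SimpleGraph (Fin n)) (j k : Fin n) : ℝ :=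
  ∑ l, ∑ m, ∑ p, if Forward W H j k l m p then 1 else 0

lemma Forward.ne {W H : SimpleGraph (Fin n)} {j k l m p : Fin n} (h : Forward W H j k l m p) :
    l ≠ m ∧ p ≠ j ∧ p ≠ k := by
  obtain ⟨⟨h1, h2, h3⟩, ⟨h4, h5, h6⟩, h7, -⟩ := h
  refine ⟨?_, ?_, ?_⟩
  · rintro rfl; exact h5 h2
  · rintro rfl; exact h5 h7
  · rintro rfl; exact h6 h7

lemma Forward.pattern {W H : SimpleGraph (Fin n)} {j k l m p : Fin n}
    (h : Forward W H j k l m p) : Pattern j p l m H :=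
  ⟨h.1.2.1, h.2.2.1, h.2.1.2.1, h.2.2.2.1⟩

lemma card_common_ge {W : SimpleGraph (Fin n)} {Δ : ℝ} (hW : ∀ v, deg W v ≤ Δ) (j k : Fin n) :
    (n : ℝ) - #(common W j k) ≤ 2 * Δ + 2 := by
  have h1 : (#(univ \ common W j k) : ℝ) ≤ 2 * Δ + 2 := by
    have hsub : univ \ common W j k ⊆
        ({j, k} : Finset (Fin n)) ∪ ((univ.filter fun u => W.Adj j u) ∪
          (univ.filter fun u => W.Adj k u)) := by
      intro x hx
      rw [Finset.mem_sdiff, mem_common] at hx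
      simp only [Finset.mem_union, Finset.mem_insert, Finset.mem_singleton, mem_filter, mem_univ,
        true_and]
      have := hx.2
      tauto
    have h2 := (card_le_card hsub).trans
      ((card_union_le _ _).trans (Nat.add_le_add card_le_two (card_union_le _ _)))
    have h3 : (#(univ \ common W j k) : ℝ) ≤ 2 + (deg W j + deg W k) := by
      rw [deg_eq_card, deg_eq_card]; exact_mod_cast h2
    linarith [hW j, hW k]
  rw [card_sdiff_of_subset (subset_univ _), card_univ, Fintype.card_fin,
    Nat.cast_sub (by simpa using card_le_univ (common W j k))] at h1
  exact h1

lemma forwardCount_ge {W H : SimpleGraph (Fin n)} {j k : Fin n} {Δ Δ' D z₁ z₂ η : ℝ}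
    (hn : 0 < n) (hW : ∀ v, deg W v ≤ Δ) (hH : ∀ v, |deg H v - D| ≤ Δ')
    (hη : 2 * Δ' + 2 * Δ + 2 + sdCount W H j k ≤ η) (hz₁ : 0 ≤ z₁) (hz₂ : 0 ≤ z₂)
    (h₁ : z₁ ≤ n - D - η) (h₂ : z₂ ≤ D - η) :
    z₁ ^ 2 * z₂ ^ 2 / n - n ^ 2 * (η + 2 * Δ + 1) ≤ forwardCount W H j k := by
  have hΔ : 0 ≤ Δ := (deg_nonneg W j).trans (hW j)
  have hΔ' : 0 ≤ Δ' := (abs_nonneg _).trans (hH j)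
  have hs := sdCount_nonneg W H j k
  have hs1 := onlyCount_nonneg W H j k
  have hs2 := onlyCount_nonneg W H k j
  have hη0 : 0 ≤ η := by linarith
  have hn' : (0 : ℝ) < n := by exact_mod_cast hn
  have hA := card_common_ge hW j k
  set A := common W j k with hAdef
  set L := A.filter fun l => H.Adj j l ∧ H.Adj k l with hL
  set M := A.filter fun m => ¬ H.Adj j m ∧ ¬ H.Adj k m with hM
  have hcardA : (#A : ℝ) = #L + #M + sdCount W H j k := by
    have e1 : (#A : ℝ) = ∑ x ∈ A, (1 : ℝ) := by simp
    have e2 : (#L : ℝ) = ∑ x ∈ A, if H.Adj j x ∧ H.Adj k x then (1 : ℝ) else 0 := by simp [hL]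
    have e3 : (#M : ℝ) = ∑ x ∈ A, if ¬ H.Adj j x ∧ ¬ H.Adj k x then (1 : ℝ) else 0 := by
      simp [hM]
    rw [e1, e2, e3, sdCount, onlyCount, onlyCount, common_comm W k j, ← hAdef,
      ← sum_add_distrib, ← sum_add_distrib, ← sum_add_distrib]
    refine sum_congr rfl fun x _ => ?_
    by_cases h1 : H.Adj j x <;> by_cases h2 : H.Adj k x <;> simp [only, ind, h1, h2]
  have hLle : (#L : ℝ) ≤ deg H j := by
    rw [deg_eq_card]
    exact_mod_cast card_le_card fun x hx => by
      simp only [hL, mem_filter, mem_univ, true_and] at hx ⊢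
      exact hx.2.1
  have hLge : deg H j ≤ #L + onlyCount W H j k + ((n : ℝ) - #A) := by
    have e1 : deg H j = ∑ x ∈ A, ind H j x + ∑ x ∈ univ \ A, ind H j x := by
      rw [add_comm, deg, sum_sdiff (subset_univ A)]
    have e2 : ∑ x ∈ A, ind H j x = #L + onlyCount W H j k := by
      have e2 : (#L : ℝ) = ∑ x ∈ A, if H.Adj j x ∧ H.Adj k x then (1 : ℝ) else 0 := by
        simp [hL]
      rw [e2, onlyCount, ← sum_add_distrib]
      refine sum_congr rfl fun x _ => ?_
      by_cases h1 : H.Adj j x <;> by_cases h2 : H.Adj k x <;> simp [only, ind, h1, h2]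
    have e3 : ∑ x ∈ univ \ A, ind H j x ≤ (n : ℝ) - #A := by
      calc ∑ x ∈ univ \ A, ind H j x ≤ ∑ x ∈ univ \ A, (1 : ℝ) :=
            sum_le_sum fun x _ => ind_le_one _ _ _
        _ = n - #A := by
          rw [sum_const, nsmul_eq_mul, mul_one, card_sdiff_of_subset (subset_univ _), card_univ,
            Fintype.card_fin, Nat.cast_sub (by simpa using card_le_univ A)]
    linarith
  have hdj := abs_le.1 (hH j)
  have hsd : sdCount W H j k = onlyCount W H j k + onlyCount W H k j := rfl
  have hMge : z₁ ≤ #M := by linarith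
  set X : Fin n → ℝ := fun p => ∑ m ∈ M, ind H p m with hX
  set Y : Fin n → ℝ := fun p => ∑ l ∈ L, ind H p l with hY
  have hX0 : ∀ p, 0 ≤ X p := fun p => sum_nonneg fun _ _ => ind_nonneg _ _ _
  have hXY : ∀ p, X p + Y p ≤ deg H p := fun p => by
    have hd : Disjoint M L := by
      rw [disjoint_left]; intro x hx hx'
      simp only [hL, hM, mem_filter] at hx hx'
      exact hx.2.1 hx'.2.1
    rw [hX, hY, ← sum_union hd]
    exact sum_le_sum_of_subset_of_nonneg (subset_univ _) fun _ _ _ => ind_nonneg _ _ _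
  have hXn : ∀ p, X p ≤ n := fun p => by
    calc X p ≤ ∑ m ∈ M, (1 : ℝ) := sum_le_sum fun x _ => ind_le_one _ _ _
      _ ≤ n := by simpa using card_le_univ M
  have hZ : z₁ * z₂ ≤ ∑ p, X p := by
    calc z₁ * z₂ ≤ #M * z₂ := by gcongr
      _ = ∑ m ∈ M, z₂ := by simp
      _ ≤ ∑ m ∈ M, deg H m := sum_le_sum fun m _ => by
          have := abs_le.1 (hH m); linarith
      _ = ∑ p, X p := by
          simp only [hX, deg]
          rw [sum_comm]
          exact sum_congr rfl fun p _ => sum_congr rfl fun m _ => ind_symm _ _ _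
  have hCS : z₁ ^ 2 * z₂ ^ 2 / n ≤ ∑ p, X p ^ 2 := by
    have h1 : (∑ p, X p) ^ 2 ≤ (n : ℝ) * ∑ p, X p ^ 2 := by
      simpa using sq_sum_le_card_mul_sum_sq (s := (univ : Finset (Fin n))) (f := X)
    rw [div_le_iff₀ hn', ← mul_pow, mul_comm _ (n : ℝ)]
    exact (pow_le_pow_left₀ (mul_nonneg hz₁ hz₂) hZ 2).trans h1
  have hmain : ∑ p, X p ^ 2 - n ^ 2 * η ≤ ∑ p, X p * (#L - Y p) := by
    have h1 : ∑ p : Fin n, X p * η ≤ n ^ 2 * η := by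
      calc ∑ p : Fin n, X p * η ≤ ∑ p : Fin n, (n : ℝ) * η :=
            sum_le_sum fun p _ => mul_le_mul_of_nonneg_right (hXn p) hη0
        _ = n ^ 2 * η := by simp; ring
    have h2 : ∑ p, X p ^ 2 - ∑ p, X p * η ≤ ∑ p, X p * (#L - Y p) := by
      rw [← sum_sub_distrib]
      refine sum_le_sum fun p _ => ?_
      have hp := abs_le.1 (hH p)
      have := hXY p
      rw [pow_two, ← mul_sub]
      refine mul_le_mul_of_nonneg_left ?_ (hX0 p)
      linarith
    linarith
  have hfw : ∑ l ∈ L, ∑ m ∈ M, ∑ p, (ind H p m * (1 - ind H p l) - ind W p m - ind W p l -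
      if p = l then 1 else 0) ≤ forwardCount W H j k := by
    have hpt : ∀ l m p, 0 ≤ (if Forward W H j k l m p then (1 : ℝ) else 0) := fun l m p => by
      split_ifs <;> norm_num
    calc _ ≤ ∑ l ∈ L, ∑ m ∈ M, ∑ p, (if Forward W H j k l m p then (1 : ℝ) else 0) := by
          refine sum_le_sum fun l hl => sum_le_sum fun m hm => sum_le_sum fun p _ => ?_
          simp only [hL, hM, mem_filter] at hl hm
          by_cases hpl : p = l
          · have h1 := hpt l m p
            have h2 := ind_nonneg W p m
            have h3 := ind_nonneg W p l
            have h4 := ind_le_one H p m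
            have h5 := ind_nonneg H p l
            have h6 := ind_nonneg H p m
            simp only [hpl, if_true] at *
            nlinarith
          by_cases g1 : H.Adj p m <;> by_cases g2 : H.Adj p l <;> by_cases g3 : W.Adj p m <;>
            by_cases g4 : W.Adj p l <;>
            simp [Forward, ind, ← hAdef, hl, hm, g1, g2, g3, g4, hpl]
      _ ≤ ∑ l ∈ L, ∑ m, ∑ p, (if Forward W H j k l m p then (1 : ℝ) else 0) :=
          sum_le_sum fun l _ => sum_le_sum_of_subset_of_nonneg (subset_univ _)
            fun m _ _ => sum_nonneg fun p _ => hpt l m p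
      _ ≤ forwardCount W H j k :=
          sum_le_sum_of_subset_of_nonneg (subset_univ _)
            fun l _ _ => sum_nonneg fun m _ => sum_nonneg fun p _ => hpt l m p
  have hexp : ∑ l ∈ L, ∑ m ∈ M, ∑ p, (ind H p m * (1 - ind H p l) - ind W p m - ind W p l -
      if p = l then 1 else 0) = ∑ p, X p * (#L - Y p) -
      ∑ l ∈ L, ∑ m ∈ M, (deg W m + deg W l + 1) := by
    have e1 : ∑ p, X p * (#L - Y p) = ∑ l ∈ L, ∑ m ∈ M, ∑ p, ind H p m * (1 - ind H p l) := by
      have : ∀ p, X p * (#L - Y p) = ∑ l ∈ L, ∑ m ∈ M, ind H p m * (1 - ind H p l) := by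
        intro p
        have : (#L : ℝ) - Y p = ∑ l ∈ L, (1 - ind H p l) := by simp [hY]
        rw [this, hX, mul_comm, sum_mul_sum]
        exact sum_congr rfl fun l _ => sum_congr rfl fun m _ => mul_comm _ _
      simp only [this]
      rw [sum_comm]
      exact sum_congr rfl fun l _ => sum_comm
    rw [e1, ← sum_sub_distrib]
    refine sum_congr rfl fun l _ => ?_
    rw [← sum_sub_distrib]
    refine sum_congr rfl fun m _ => ?_
    simp only [sum_sub_distrib, deg, sum_ite_eq', mem_univ, if_true,
      ind_symm W m, ind_symm W l]
    ring
  have herr : ∑ l ∈ L, ∑ m ∈ M, (deg W m + deg W l + 1) ≤ n ^ 2 * (2 * Δ + 1) := by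
    have hLn : (#L : ℝ) ≤ n := by exact_mod_cast (by simpa using card_le_univ L)
    have hMn : (#M : ℝ) ≤ n := by exact_mod_cast (by simpa using card_le_univ M)
    calc _ ≤ ∑ l ∈ L, ∑ m ∈ M, (2 * Δ + 1) :=
          sum_le_sum fun l _ => sum_le_sum fun m _ => by linarith [hW m, hW l]
      _ = #L * #M * (2 * Δ + 1) := by simp; ring
      _ ≤ n * n * (2 * Δ + 1) := by gcongr
      _ = _ := by ring
  linarith

lemma sdCount_toggle_le {W H : SimpleGraph (Fin n)} {j k l m p : Fin n} (hjk : j ≠ k)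
    (h : Forward W H j k l m p) :
    sdCount W (toggle j p l m H) j k ≤ sdCount W H j k + 2 := by
  obtain ⟨hlm, hpj, hpk⟩ := h.ne
  have hl := mem_common.1 h.1.1
  have hm := mem_common.1 h.2.1.1
  have hpm : p ≠ m := h.2.2.1.ne
  have hpl : p ≠ l := h.2.2.2.2.1
  have key : ∀ x, only (toggle j p l m H) j k x + only (toggle j p l m H) k j x ≤
      only H j k x + only H k j x + ((if x = l then 1 else 0) + (if x = m then 1 else 0)) := by
    intro x
    have hk : ind (toggle j p l m H) k x = ind H k x :=
      ind_toggle_other hjk.symm hpk.symm hl.2.1.symm hm.2.1.symm x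
    have hj := ind_toggle_left h.pattern hpj.symm hlm hl.1.symm hm.1.symm hpl hpm x
    have hle : ∀ G : SimpleGraph (Fin n), only G j k x + only G k j x ≤ 1 := fun G => by
      unfold only
      rcases ind_eq_zero_or_one G j x with e | e <;>
        rcases ind_eq_zero_or_one G k x with e' | e' <;> simp [e, e']
    have h0 := add_nonneg (only_nonneg H j k x) (only_nonneg H k j x)
    by_cases hxl : x = l
    · have := hle (toggle j p l m H)
      have : (0 : ℝ) ≤ if x = m then 1 else 0 := by split_ifs <;> norm_num
      rw [if_pos hxl]; linarith
    by_cases hxm : x = m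
    · have := hle (toggle j p l m H)
      rw [if_pos hxm, if_neg hxl]; linarith
    rw [Equiv.swap_apply_of_ne_of_ne hxl hxm] at hj
    simp [only, hk, hj, hxl, hxm]
  have e : ∀ G : SimpleGraph (Fin n), sdCount W G j k =
      ∑ x ∈ common W j k, (only G j k x + only G k j x) := fun G => by
    rw [sdCount, onlyCount, onlyCount, common_comm W k j, sum_add_distrib]
  rw [e, e]
  refine (sum_le_sum fun x _ => key x).trans ?_
  rw [sum_add_distrib, sum_add_distrib (f := fun x => if x = l then (1 : ℝ) else 0)]
  simp only [sum_ite_eq', h.1.1, h.2.1.1, if_true]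
  norm_num

lemma sum_forwardCount_le {d : Fin n → ℝ} {W H₀ : SimpleGraph (Fin n)} {j k : Fin n}
    (hjk : j ≠ k) {T : ℝ} :
    ∑ H ∈ (cls d W H₀).filter (fun H => sdCount W H j k < T), forwardCount W H j k ≤
      ∑ _H ∈ (cls d W H₀).filter (fun H => sdCount W H j k < T + 2), (T + 2) ^ 2 * n := by
  have step : ∀ l m p : Fin n,
      ∑ H ∈ (cls d W H₀).filter (fun H => sdCount W H j k < T),
        (if Forward W H j k l m p then (1 : ℝ) else 0) ≤
      ∑ H ∈ (cls d W H₀).filter (fun H => sdCount W H j k < T + 2),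
        (if l ∈ common W j k ∧ m ∈ common W j k then only H k j l * only H j k m else 0) := by
    intro l m p
    rw [← sum_filter, sum_const, nsmul_eq_mul, mul_one]
    by_cases hne : (filter (fun H => Forward W H j k l m p)
        ((cls d W H₀).filter (fun H => sdCount W H j k < T))).Nonempty
    swap
    · rw [not_nonempty_iff_eq_empty.1 hne]
      simp only [card_empty, Nat.cast_zero]
      refine sum_nonneg fun H _ => ?_
      split_ifs
      · exact mul_nonneg (only_nonneg _ _ _ _) (only_nonneg _ _ _ _)
      · rfl
    obtain ⟨H₁, hH₁⟩ := hne
    rw [mem_filter] at hH₁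
    have hA : l ∈ common W j k ∧ m ∈ common W j k := ⟨hH₁.2.1.1, hH₁.2.2.1.1⟩
    have hl := mem_common.1 hA.1
    have hm := mem_common.1 hA.2
    simp only [hA, and_self, if_true, mul_comm (only _ k j l), only_mul_only]
    rw [← sum_filter, sum_const, nsmul_eq_mul, mul_one]
    norm_cast
    refine card_le_card_of_injOn (toggle j p l m) ?_ ?_
    · intro H hH
      simp only [coe_filter, mem_filter, Set.mem_ofPred_eq] at hH ⊢
      obtain ⟨⟨hH1, hH2⟩, hF⟩ := hH
      obtain ⟨hlm, hpj, hpk⟩ := hF.ne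
      have hpm : p ≠ m := hF.2.2.1.ne
      have hpl : p ≠ l := hF.2.2.2.2.1
      refine ⟨⟨toggle_mem_cls hH1 hF.pattern hpj.symm hlm hl.2.2.1 hm.2.2.1
        hF.2.2.2.2.2.2 hF.2.2.2.2.2.1 hm.1.symm hpl, ?_⟩, ?_⟩
      · linarith [sdCount_toggle_le hjk hF]
      · have h1 := hF.pattern.toggle hpj.symm hlm hl.1.symm hm.1.symm hpl hpm
        have hk : ∀ x, ind (toggle j p l m H) k x = ind H k x := fun x =>
          ind_toggle_other hjk.symm hpk.symm hl.2.1.symm hm.2.1.symm x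
        have hk' : ∀ x, (toggle j p l m H).Adj k x ↔ H.Adj k x := fun x => by
          have := hk x
          unfold ind at this
          by_cases g1 : (toggle j p l m H).Adj k x <;> by_cases g2 : H.Adj k x <;>
            simp_all
        exact ⟨h1.1, (hk' l).2 hF.1.2.2, h1.2.2.1, fun h => hF.2.1.2.2 ((hk' m).1 h)⟩
    · intro H _ H' _ h
      rw [← toggle_toggle j p l m H, h, toggle_toggle]
  calc _ = ∑ l, ∑ m, ∑ p, ∑ H ∈ (cls d W H₀).filter (fun H => sdCount W H j k < T),
        (if Forward W H j k l m p then (1 : ℝ) else 0) := by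
        simp only [forwardCount]
        rw [sum_comm]
        refine sum_congr rfl fun l _ => ?_
        rw [sum_comm]
        exact sum_congr rfl fun m _ => sum_comm
    _ ≤ ∑ l, ∑ m, ∑ _p : Fin n,
        ∑ H ∈ (cls d W H₀).filter (fun H => sdCount W H j k < T + 2),
        (if l ∈ common W j k ∧ m ∈ common W j k then only H k j l * only H j k m else 0) :=
        sum_le_sum fun l _ => sum_le_sum fun m _ => sum_le_sum fun p _ => step l m p
    _ = ∑ H ∈ (cls d W H₀).filter (fun H => sdCount W H j k < T + 2),
        onlyCount W H k j * onlyCount W H j k * n := by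
        simp only [sum_const, card_univ, Fintype.card_fin, nsmul_eq_mul]
        rw [sum_congr rfl fun l _ => sum_congr rfl fun m _ => mul_sum _ _ _,
          sum_congr rfl fun l _ => sum_comm, sum_comm]
        refine sum_congr rfl fun H _ => ?_
        have e : ∀ f : Fin n → ℝ, ∑ l ∈ common W j k, f l =
            ∑ l, if l ∈ common W j k then f l else 0 := fun f => by
          rw [sum_ite_mem, univ_inter]
        rw [onlyCount, onlyCount, common_comm W k j, e, e, sum_mul_sum, sum_mul]
        refine sum_congr rfl fun l _ => ?_
        rw [sum_mul]
        refine sum_congr rfl fun m _ => ?_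
        by_cases h1 : l ∈ common W j k <;> by_cases h2 : m ∈ common W j k <;>
          simp [h1, h2, mul_comm]
    _ ≤ _ := by
        refine sum_le_sum fun H hH => ?_
        rw [mem_filter] at hH
        have h1 := onlyCount_nonneg W H j k
        have h2 := onlyCount_nonneg W H k j
        have h3 : onlyCount W H j k + onlyCount W H k j < T + 2 := hH.2
        refine mul_le_mul_of_nonneg_right ?_ (Nat.cast_nonneg n)
        nlinarith

end DegreeSeq

namespace DegreeSeq

variable {n : ℕ}

/-- `|x| ≤ t ^ K / r ^ i`. -/
def Bd (t r : ℝ) (i : ℤ) (K : ℕ) (x : ℝ) : Prop := |x| ≤ t ^ K * r ^ (-i)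

/-- The range of parameters: `t` is a small power of `n`, and `r` is the square root of `n`. -/
structure Scale (n : ℕ) (t r : ℝ) : Prop where
  ht : 1000 ≤ t
  htr : t ^ 1000 ≤ r
  hn : (n : ℝ) = r ^ 2
  pow : ∃ m : ℕ, r ≤ t ^ m ∧ 2 * (m : ℝ) ≤ r

section Bd

variable {t r x y : ℝ} {i i' i'' : ℤ} {K K' K'' : ℕ}

lemma Scale.t_pos (h : Scale n t r) : 0 < t := by linarith [h.ht]

lemma Scale.one_le_t (h : Scale n t r) : 1 ≤ t := by linarith [h.ht]

lemma Scale.one_le_r (h : Scale n t r) : 1 ≤ r := (one_le_pow₀ h.one_le_t).trans h.htr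

lemma Scale.r_pos (h : Scale n t r) : 0 < r := by linarith [h.one_le_r]

lemma Scale.n_pos (h : Scale n t r) : (0 : ℝ) < n := by
  rw [h.hn]; exact pow_pos h.r_pos 2

lemma Scale.pow_le_r (h : Scale n t r) (hK : K ≤ 1000) : t ^ K ≤ r :=
  (pow_le_pow_right₀ h.one_le_t hK).trans h.htr

lemma Bd.mono (h : Scale n t r) (hx : Bd t r i K x) (hi : i' ≤ i) (hK : K ≤ K') :
    Bd t r i' K' x := by
  have h1 : t ^ K ≤ t ^ K' := pow_le_pow_right₀ h.one_le_t hK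
  have h2 : r ^ (-i) ≤ r ^ (-i') := zpow_le_zpow_right₀ h.one_le_r (by omega)
  have h3 : 0 < r ^ (-i) := zpow_pos h.r_pos _
  have h4 : 0 < t ^ K' := pow_pos h.t_pos _
  exact hx.trans (by gcongr)

lemma Bd.of_le (hx : Bd t r i K x) (hy : |y| ≤ |x|) : Bd t r i K y := hy.trans hx

lemma Bd.mul (h : Scale n t r) (hx : Bd t r i K x) (hy : Bd t r i' K' y) :
    Bd t r (i + i') (K + K') (x * y) := by
  unfold Bd at *
  rw [abs_mul, pow_add, neg_add, zpow_add₀ h.r_pos.ne', mul_mul_mul_comm]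
  exact mul_le_mul hx hy (abs_nonneg _) ((abs_nonneg _).trans hx)

lemma Bd.add (h : Scale n t r) (hx : Bd t r i K x) (hy : Bd t r i K y) :
    Bd t r i (K + 1) (x + y) := by
  unfold Bd at *
  have h3 : 0 < t ^ K * r ^ (-i) := mul_pos (pow_pos h.t_pos _) (zpow_pos h.r_pos _)
  have := abs_add_le x y
  rw [pow_succ]
  nlinarith [h.ht]

lemma Bd.add' (h : Scale n t r) (hx : Bd t r i K x) (hy : Bd t r i' K' y)
    (hi : i'' ≤ i := by norm_num) (hi' : i'' ≤ i' := by norm_num)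
    (hK : K < K'' := by norm_num) (hK' : K' < K'' := by norm_num) : Bd t r i'' K'' (x + y) := by
  obtain ⟨K, rfl⟩ : ∃ L, K'' = L + 1 := ⟨K'' - 1, by omega⟩
  exact (hx.mono h hi (by omega)).add h (hy.mono h hi' (by omega))

lemma Bd.neg (hx : Bd t r i K x) : Bd t r i K (-x) := by
  unfold Bd at *; rwa [abs_neg]

lemma Bd.sub' (h : Scale n t r) (hx : Bd t r i K x) (hy : Bd t r i' K' y)
    (hi : i'' ≤ i := by norm_num) (hi' : i'' ≤ i' := by norm_num)
    (hK : K < K'' := by norm_num) (hK' : K' < K'' := by norm_num) : Bd t r i'' K'' (x - y) := by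
  rw [sub_eq_add_neg]; exact hx.add' h hy.neg hi hi' hK hK'

lemma Bd.mul' (h : Scale n t r) (hx : Bd t r i K x) (hy : Bd t r i' K' y)
    (hi : i'' ≤ i + i' := by norm_num) (hK : K + K' ≤ K'' := by norm_num) :
    Bd t r i'' K'' (x * y) := (hx.mul h hy).mono h hi hK

lemma Bd.const (h : Scale n t r) (hx : |x| ≤ 1000) : Bd t r 0 1 x := by
  unfold Bd; simpa using hx.trans h.ht

lemma Bd.one (hx : |x| ≤ 1) : Bd t r 0 0 x := by
  unfold Bd; simpa using hx

lemma Bd.cmul (h : Scale n t r) (c : ℝ) (hc : |c| ≤ 1000) (hx : Bd t r i K x) :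
    Bd t r i (K + 1) (c * x) :=
  (Bd.const h hc).mul' h hx (by omega) (by omega)

lemma Bd.sum {ι : Type*} {s : Finset ι} {f : ι → ℝ} (h : Scale n t r)
    (hf : ∀ a ∈ s, Bd t r i K (f a)) (hs : Bd t r i' K' (#s : ℝ)) :
    Bd t r (i' + i) (K' + K) (∑ a ∈ s, f a) := by
  have h1 : |∑ a ∈ s, f a| ≤ #s * (t ^ K * r ^ (-i)) := by
    refine (abs_sum_le_sum_abs _ _).trans ((sum_le_sum hf).trans ?_)
    simp
  have h2 : Bd t r i K (t ^ K * r ^ (-i)) := by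
    unfold Bd
    rw [abs_of_pos (mul_pos (pow_pos h.t_pos _) (zpow_pos h.r_pos _))]
  exact (hs.mul h h2).of_le (h1.trans (le_abs_self _))

lemma Bd.card_univ (h : Scale n t r) : Bd t r (-2) 0 (n : ℝ) := by
  unfold Bd; rw [h.hn]; simp [abs_of_nonneg (sq_nonneg r)]

lemma Bd.inv_n (h : Scale n t r) : Bd t r 2 0 (1 / (n : ℝ)) := by
  unfold Bd; rw [h.hn, abs_of_nonneg (by positivity)]; simp

lemma Bd.card (h : Scale n t r) (s : Finset (Fin n)) : Bd t r (-2) 0 (#s : ℝ) := by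
  refine (Bd.card_univ h).of_le ?_
  rw [abs_of_nonneg (Nat.cast_nonneg _), abs_of_nonneg (Nat.cast_nonneg _)]
  exact_mod_cast (by simpa using card_le_univ s)

lemma Bd.le (hx : Bd t r i K x) : x ≤ t ^ K * r ^ (-i) := (le_abs_self x).trans hx

end Bd

end DegreeSeq

namespace DegreeSeq

variable {n : ℕ} {t r lam : ℝ} {d : Fin n → ℝ} {W H₀ : SimpleGraph (Fin n)}

/-- The degree sequence `d` is close to the constant `lam (n - 1)`, which is its average. -/
structure Near (n : ℕ) (t r lam : ℝ) (d : Fin n → ℝ) : Prop extends Scale n t r where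
  lam_ge : 1 / t ≤ lam
  lam_le : 1 / t ≤ 1 - lam
  d_near : ∀ v, |d v - lam * (n - 1)| ≤ r * t ^ 2
  d_sum : ∑ v, d v = n * lam * (n - 1)

/-- The graph `W` has few edges, with room for `s` more. -/
structure Sparse (t r : ℝ) (s : ℕ) (W : SimpleGraph (Fin n)) : Prop where
  deg_le : ∀ v, deg W v + s ≤ r * t ^ 2
  sum_le : ∑ v, deg W v + s ≤ r ^ 2 * t ^ 3

lemma Near.lam_pos (h : Near n t r lam d) : 0 < lam :=
  (one_div_pos.2 h.t_pos).trans_le h.lam_ge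

lemma Near.lam_lt (h : Near n t r lam d) : 0 < 1 - lam :=
  (one_div_pos.2 h.t_pos).trans_le h.lam_le

lemma Sparse.deg_le' {s : ℕ} (h : Sparse t r s W) (v : Fin n) : deg W v ≤ r * t ^ 2 := by
  have : (0 : ℝ) ≤ s := Nat.cast_nonneg s
  linarith [h.deg_le v]

lemma Scale.n_le (h : Scale n t r) {K : ℕ} (hK : K ≤ 1000) : r * t ^ K ≤ n := by
  rw [h.hn, pow_two]
  exact mul_le_mul_of_nonneg_left (h.pow_le_r hK) h.r_pos.le

lemma forwardCount_ge_of_sdCount_lt {s : ℕ} (h : Near n t r lam d) (hW : Sparse t r s W)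
    {H : SimpleGraph (Fin n)} (hH : ∀ v, deg H v = d v) {j k : Fin n}
    (hsd : sdCount W H j k ≤ n / t ^ 5) : n ^ 3 / t ^ 5 ≤ forwardCount W H j k := by
  have ht := h.t_pos
  have ht1 := h.one_le_t
  have hr := h.r_pos
  have hn := h.n_pos
  have htn := h.n_le (K := 10) (by norm_num)
  have ht' := h.ht
  have hr1 := h.one_le_r
  set y := n / t ^ 5 with hy
  have hyn : (n : ℝ) = y * t ^ 5 := by rw [hy]; field_simp
  have hy0 : 0 < y := by positivity
  have hrt : r * t ^ 5 ≤ y := by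
    rw [hy, le_div_iff₀ (by positivity)]; calc _ = r * t ^ 10 := by ring
      _ ≤ _ := htn
  have hrt2 : 1000 * (r * t ^ 2) ≤ y := by
    have : 1000 * (r * t ^ 2) ≤ r * t ^ 5 := by
      have : 1000 * t ^ 2 ≤ t ^ 5 := by nlinarith [pow_le_pow_right₀ ht1 (show 2 ≤ 4 by norm_num)]
      nlinarith
    linarith
  have h1rt : 1 ≤ r * t ^ 2 := one_le_mul_of_one_le_of_one_le hr1 (one_le_pow₀ ht1)
  have hyt : (n : ℝ) / t = y * t ^ 4 := by rw [hyn]; field_simp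
  have ht4 : 1000 ≤ t ^ 4 := ht'.trans (le_self_pow₀ ht1 (by norm_num))
  have hyt4 : 1000 * y ≤ y * t ^ 4 := by nlinarith
  have e1 : (n : ℝ) * (1 / t) = y * t ^ 4 := by rw [← hyt]; ring
  have hl1 : y * t ^ 4 ≤ n * lam := by
    rw [← e1]; exact mul_le_mul_of_nonneg_left h.lam_ge hn.le
  have hl2 : y * t ^ 4 ≤ n * (1 - lam) := by
    rw [← e1]; exact mul_le_mul_of_nonneg_left h.lam_le hn.le
  have hlam := h.lam_pos
  have hlam' := h.lam_lt
  have key := forwardCount_ge (W := W) (H := H) (j := j) (k := k) (Δ := r * t ^ 2)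
    (Δ' := r * t ^ 2) (D := lam * (n - 1)) (z₁ := y * t ^ 4 / 2) (z₂ := y * t ^ 4 / 2)
    (η := 2 * y) (by exact_mod_cast hn) hW.deg_le' (fun v => by rw [hH]; exact h.d_near v)
    (by linarith) (by positivity) (by positivity) (by nlinarith) (by nlinarith)
  refine le_trans ?_ key
  have e2 : (y * t ^ 4 / 2) ^ 2 * (y * t ^ 4 / 2) ^ 2 / n = y ^ 3 * t ^ 11 / 16 := by
    rw [hyn]; field_simp; ring
  rw [e2]
  have e3 : (n : ℝ) ^ 3 / t ^ 5 = y ^ 3 * t ^ 10 := by rw [hyn]; field_simp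
  rw [e3]
  have e4 : (n : ℝ) ^ 2 * (2 * y + 2 * (r * t ^ 2) + 1) ≤ 3 * (y ^ 3 * t ^ 10) := by
    have : (n : ℝ) ^ 2 = y ^ 2 * t ^ 10 := by rw [hyn]; ring
    rw [this]
    calc y ^ 2 * t ^ 10 * (2 * y + 2 * (r * t ^ 2) + 1) ≤ y ^ 2 * t ^ 10 * (3 * y) := by
          gcongr; linarith
      _ = _ := by ring
  have e5 : y ^ 3 * t ^ 11 = (y ^ 3 * t ^ 10) * t := by ring
  have : 0 < y ^ 3 * t ^ 10 := by positivity
  nlinarith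

/-- The number of graphs in the class for which `sdCount` is smaller than `T`. -/
def smallCount (d : Fin n → ℝ) (W H₀ : SimpleGraph (Fin n)) (j k : Fin n) (T : ℝ) : ℝ :=
  #((cls d W H₀).filter fun H => sdCount W H j k < T)

lemma smallCount_step {s : ℕ} (h : Near n t r lam d) (hW : Sparse t r s W) {j k : Fin n}
    (hjk : j ≠ k) {T : ℝ} (hT0 : 0 ≤ T) (hT : T + 2 ≤ n / t ^ 5) :
    t ^ 5 * smallCount d W H₀ j k T ≤ smallCount d W H₀ j k (T + 2) := by
  have hn := h.n_pos
  have ht := h.t_pos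
  have h1 := sum_forwardCount_le (d := d) (W := W) (H₀ := H₀) hjk (T := T)
  have h2 : smallCount d W H₀ j k T * (n ^ 3 / t ^ 5) ≤
      ∑ H ∈ (cls d W H₀).filter (fun H => sdCount W H j k < T), forwardCount W H j k := by
    rw [smallCount, ← nsmul_eq_mul]
    refine card_nsmul_le_sum _ _ _ fun H hH => ?_
    rw [mem_filter] at hH
    exact forwardCount_ge_of_sdCount_lt h hW (mem_cls.1 hH.1).1 (by linarith [hH.2])
  rw [sum_const, nsmul_eq_mul] at h1
  have h3 : (T + 2) ^ 2 * n ≤ (n / t ^ 5) ^ 2 * n := by gcongr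
  have h4 : smallCount d W H₀ j k T * (n ^ 3 / t ^ 5) ≤
      smallCount d W H₀ j k (T + 2) * ((n / t ^ 5) ^ 2 * n) :=
    h2.trans (h1.trans (mul_le_mul_of_nonneg_left h3 (Nat.cast_nonneg _)))
  have e1 : smallCount d W H₀ j k T * ((n : ℝ) ^ 3 / t ^ 5) =
      (t ^ 5 * smallCount d W H₀ j k T) * (n ^ 3 / t ^ 10) := by field_simp
  have e2 : smallCount d W H₀ j k (T + 2) * ((n / t ^ 5) ^ 2 * (n : ℝ)) =
      smallCount d W H₀ j k (T + 2) * (n ^ 3 / t ^ 10) := by field_simp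
  rw [e1, e2] at h4
  exact le_of_mul_le_mul_right h4 (by positivity)

lemma smallCount_iterate {s : ℕ} (h : Near n t r lam d) (hW : Sparse t r s W) {j k : Fin n}
    (hjk : j ≠ k) {T : ℝ} (hT0 : 0 ≤ T) (i : ℕ) (hT : T + 2 * i ≤ n / t ^ 5) :
    (t ^ 5) ^ i * smallCount d W H₀ j k T ≤ smallCount d W H₀ j k (T + 2 * i) := by
  induction i with
  | zero => simp
  | succ i ih =>
    push_cast at hT ⊢
    have h1 := ih (by linarith)
    have h2 := smallCount_step (H₀ := H₀) h hW hjk (T := T + 2 * i) (by positivity) (by linarith)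
    have ht := h.t_pos
    calc _ = t ^ 5 * ((t ^ 5) ^ i * smallCount d W H₀ j k T) := by ring
      _ ≤ t ^ 5 * smallCount d W H₀ j k (T + 2 * i) := by gcongr
      _ ≤ _ := by rwa [mul_add, ← add_assoc, mul_one]

/-- The symmetric difference of two neighbourhoods is rarely small. -/
lemma ev_sdCount_lt {s : ℕ} (h : Near n t r lam d) (hW : Sparse t r s W) {j k : Fin n}
    (hjk : j ≠ k) :
    Bd t r 5 0 (ev (cls d W H₀) fun H => if sdCount W H j k < n / t ^ 6 then 1 else 0) := by
  have hn := h.n_pos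
  have ht := h.t_pos
  have hr := h.r_pos
  obtain ⟨m, hm, hm'⟩ := h.pow
  have hT : (n : ℝ) / t ^ 6 + 2 * m ≤ n / t ^ 5 := by
    have h1 : r * t ^ 6 ≤ n := h.n_le (by norm_num)
    have h2 : r ≤ n / t ^ 6 := (le_div_iff₀ (by positivity)).2 h1
    have h3 : (n : ℝ) / t ^ 5 = n / t ^ 6 * t := by field_simp
    rw [h3]
    nlinarith [h.ht]
  have h1 := smallCount_iterate (H₀ := H₀) h hW hjk (T := n / t ^ 6) (by positivity) m hT
  have h2 : smallCount d W H₀ j k (n / t ^ 6 + 2 * m) ≤ #(cls d W H₀) := by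
    unfold smallCount; exact_mod_cast card_filter_le _ _
  have h3 : r ^ 5 ≤ (t ^ 5) ^ m := by
    calc r ^ 5 ≤ (t ^ m) ^ 5 := by gcongr
      _ = _ := by ring
  have h4 : r ^ 5 * smallCount d W H₀ j k (n / t ^ 6) ≤ #(cls d W H₀) :=
    (mul_le_mul_of_nonneg_right h3 (Nat.cast_nonneg _)).trans (h1.trans h2)
  have e : (ev (cls d W H₀) fun H => if sdCount W H j k < n / t ^ 6 then 1 else 0) =
      smallCount d W H₀ j k (n / t ^ 6) / #(cls d W H₀) := by
    rw [ev, smallCount, ← sum_filter, sum_const, nsmul_eq_mul, mul_one]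
  rw [e, Bd, abs_of_nonneg (div_nonneg (Nat.cast_nonneg _) (Nat.cast_nonneg _)), pow_zero, one_mul]
  refine div_le_of_le_mul₀ (Nat.cast_nonneg _) (by positivity) ?_
  rw [zpow_neg, inv_mul_eq_div, le_div_iff₀ (by positivity), mul_comm]
  exact_mod_cast h4

end DegreeSeq

namespace DegreeSeq

variable {n : ℕ} {t r lam : ℝ} {d : Fin n → ℝ} {W H₀ : SimpleGraph (Fin n)}

/-- The vertices that are adjacent in `W` to one of `j`, `k`. -/
def bad (W : SimpleGraph (Fin n)) (j k : Fin n) : Finset (Fin n) :=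
  univ.filter fun m => m ≠ j ∧ m ≠ k ∧ (W.Adj j m ∨ W.Adj k m)

lemma mem_bad {j k m : Fin n} : m ∈ bad W j k ↔ m ≠ j ∧ m ≠ k ∧ (W.Adj j m ∨ W.Adj k m) := by
  simp [bad]

lemma sum_common_add_sum_bad (f : Fin n → ℝ) {j k : Fin n} (hjk : j ≠ k) :
    ∑ m, f m = ∑ m ∈ common W j k, f m + ∑ m ∈ bad W j k, f m + (f j + f k) := by
  have h1 : ∑ m ∈ {j, k}, f m = f j + f k := sum_pair hjk
  have h2 : common W j k ∪ bad W j k ∪ {j, k} = univ := by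
    ext m
    simp only [Finset.mem_union, mem_common, mem_bad, Finset.mem_insert, Finset.mem_singleton,
      mem_univ, iff_true]
    tauto
  rw [← h1, ← h2, sum_union, sum_union]
  · rw [Finset.disjoint_left]; intro m; rw [mem_common, mem_bad]; tauto
  · rw [Finset.disjoint_left]; intro m
    simp only [Finset.mem_union, mem_common, mem_bad, Finset.mem_insert, Finset.mem_singleton]
    tauto

lemma card_bad_le (j k : Fin n) : (#(bad W j k) : ℝ) ≤ deg W j + deg W k := by
  rw [deg_eq_card, deg_eq_card]
  have : bad W j k ⊆ (univ.filter fun u => W.Adj j u) ∪ (univ.filter fun u => W.Adj k u) := by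
    intro m
    simp only [Finset.mem_union, mem_bad, mem_filter, mem_univ, true_and]
    tauto
  exact_mod_cast (card_le_card this).trans (card_union_le _ _)

lemma card_common_add_card_bad {j k : Fin n} (hjk : j ≠ k) :
    (#(common W j k) : ℝ) + #(bad W j k) + 2 = n := by
  have := sum_common_add_sum_bad (W := W) (fun _ => 1) hjk
  simp at this
  linarith

lemma onlyCount_sub_onlyCount (H : SimpleGraph (Fin n)) {j k : Fin n} (hjk : j ≠ k) :
    onlyCount W H j k - onlyCount W H k j =
      deg H j - deg H k - ∑ m ∈ bad W j k, (ind H j m - ind H k m) := by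
  have h := sum_common_add_sum_bad (W := W) (fun m => ind H j m - ind H k m) hjk
  rw [sum_sub_distrib] at h
  have h2 : onlyCount W H j k - onlyCount W H k j =
      ∑ m ∈ common W j k, (ind H j m - ind H k m) := by
    rw [onlyCount, onlyCount, common_comm W k j, ← sum_sub_distrib]
    exact sum_congr rfl fun m _ => (ind_sub_ind H j k m).symm
  rw [h2, deg, deg, h]
  simp only [ind_self, ind_symm H k j]
  ring

/-- A class of graphs with degree sequence `d` and prescribed adjacencies on `W`. -/
structure Model (n : ℕ) (t r lam : ℝ) (d : Fin n → ℝ) (s : ℕ) (W H₀ : SimpleGraph (Fin n)) :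
    Prop extends Near n t r lam d where
  sparse : Sparse t r s W
  deg_eq : ∀ v, deg H₀ v = d v

variable {s : ℕ}

lemma Model.mem (h : Model n t r lam d s W H₀) : H₀ ∈ cls d W H₀ := self_mem_cls h.deg_eq

lemma Model.nonempty (h : Model n t r lam d s W H₀) : (cls d W H₀).Nonempty := ⟨H₀, h.mem⟩

lemma Model.card_bad (h : Model n t r lam d s W H₀) (j k : Fin n) :
    Bd t r (-1) 3 (#(bad W j k) : ℝ) := by
  have h1 := card_bad_le (W := W) j k
  have h2 := h.sparse.deg_le' j
  have h3 := h.sparse.deg_le' k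
  have ht := h.t_pos
  have hr := h.r_pos
  rw [Bd, abs_of_nonneg (Nat.cast_nonneg _), neg_neg, zpow_one]
  have : 0 < r * t ^ 2 := by positivity
  nlinarith [h.ht]

lemma Model.onlyCount_sub (h : Model n t r lam d s W H₀) {H : SimpleGraph (Fin n)}
    (hH : H ∈ cls d W H₀) {j k : Fin n} (hjk : j ≠ k) :
    Bd t r (-1) 5 (onlyCount W H j k - onlyCount W H k j) := by
  rw [onlyCount_sub_onlyCount H hjk, (mem_cls.1 hH).1, (mem_cls.1 hH).1]
  have h1 : Bd t r (-1) 3 (d j - d k) := by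
    have h2 := h.d_near j
    have h3 := h.d_near k
    have ht := h.t_pos
    have hr := h.r_pos
    have : 0 < r * t ^ 2 := by positivity
    rw [Bd, neg_neg, zpow_one]
    rw [abs_le] at *
    constructor <;> nlinarith [h.ht]
  have h2 : Bd t r (-1 + 0) (3 + 0) (∑ m ∈ bad W j k, (ind H j m - ind H k m)) := by
    refine Bd.sum h.toScale (fun m _ => Bd.one ?_) (h.card_bad j k)
    have := ind_nonneg H j m
    have := ind_nonneg H k m
    have := ind_le_one H j m
    have := ind_le_one H k m
    rw [abs_le]; constructor <;> linarith
  exact h1.sub' h.toScale h2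

/-- The probability that `ab` is an edge. -/
def pr (d : Fin n → ℝ) (W H₀ : SimpleGraph (Fin n)) (a b : Fin n) : ℝ :=
  ev (cls d W H₀) fun H => ind H a b

lemma pr_symm (a b : Fin n) : pr d W H₀ a b = pr d W H₀ b a := by
  simp only [pr, ind_symm]

/-- The vertices `j` such that `l` and `j` form a pair outside `W`. -/
def allowed (W : SimpleGraph (Fin n)) (l : Fin n) : Finset (Fin n) :=
  univ.filter fun j => j ≠ l ∧ ¬ W.Adj l j

lemma mem_allowed {l j : Fin n} : j ∈ allowed W l ↔ j ≠ l ∧ ¬ W.Adj l j := by simp [allowed]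

lemma mem_common_of_allowed {l j k : Fin n} (hj : j ∈ allowed W l) (hk : k ∈ allowed W l) :
    l ∈ common W j k := by
  rw [mem_allowed] at hj hk
  exact mem_common.2 ⟨hj.1.symm, hk.1.symm, fun h => hj.2 h.symm, fun h => hk.2 h.symm⟩

lemma sum_allowed (l : Fin n) (f : Fin n → ℝ) (hf : f l = 0) :
    ∑ j ∈ allowed W l, f j = ∑ j, f j - ∑ j, ind W l j * f j := by
  rw [allowed, sum_filter, ← sum_sub_distrib]
  refine sum_congr rfl fun j _ => ?_
  by_cases h : j = l
  · subst h; simp [hf]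
  · by_cases h' : W.Adj l j <;> simp [ind, h, h']

lemma ind_mul_ind (H W : SimpleGraph (Fin n)) (a b : Fin n) :
    ind W a b * ind H a b = ind (H ⊓ W) a b := by
  by_cases h : W.Adj a b <;> by_cases h' : H.Adj a b <;> simp [ind, h, h']

lemma sum_allowed_ind {H : SimpleGraph (Fin n)} (hH : H ∈ cls d W H₀) (l : Fin n) :
    ∑ j ∈ allowed W l, ind H l j = d l - deg (H₀ ⊓ W) l := by
  rw [sum_allowed l _ (ind_self H l), ← (mem_cls.1 hH).1 l, ← (mem_cls.1 hH).2]
  simp only [ind_mul_ind, deg]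

lemma card_allowed (l : Fin n) : (#(allowed W l) : ℝ) = n - 1 - deg W l := by
  have h : (#(allowed W l) : ℝ) = ∑ j ∈ allowed W l, (if j = l then 0 else 1) := by
    rw [card_eq_sum_ones, Nat.cast_sum]
    refine sum_congr rfl fun j hj => ?_
    rw [if_neg (mem_allowed.1 hj).1, Nat.cast_one]
  have h2 : ∀ j, (if j = l then (0 : ℝ) else 1) = 1 - if j = l then 1 else 0 := fun j => by
    split_ifs <;> norm_num
  rw [h, sum_allowed l _ (if_pos rfl)]
  simp only [h2, mul_sub, sum_sub_distrib, mul_ite, mul_zero, mul_one, sum_ite_eq', mem_univ,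
    if_true, ind_self, deg]
  simp

lemma Model.two_mul_card_allowed (h : Model n t r lam d s W H₀) (l : Fin n) :
    (n : ℝ) ≤ 2 * #(allowed W l) := by
  rw [card_allowed]
  have h1 := h.sparse.deg_le' l
  have h2 := h.n_le (K := 3) (by norm_num)
  have ht := h.ht
  have hr := h.one_le_r
  have : 1 ≤ r * t ^ 2 := one_le_mul_of_one_le_of_one_le hr (one_le_pow₀ h.one_le_t)
  nlinarith

/-- If the errors at a vertex are nearly equal and have a small sum then they are small. -/
lemma Model.uniformize (h : Model n t r lam d s W H₀) {l : Fin n} {η : Fin n → ℝ} {i : ℤ} {K : ℕ}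
    (h1 : ∀ j ∈ allowed W l, ∀ k ∈ allowed W l, j ≠ k → Bd t r i K (η j - η k))
    (h2 : Bd t r (i - 2) K (∑ j ∈ allowed W l, η j)) {j : Fin n} (hj : j ∈ allowed W l) :
    Bd t r i (K + 1) (η j) := by
  have hc := h.two_mul_card_allowed l
  have hn := h.n_pos
  have hr := h.r_pos
  set e := t ^ K * r ^ (-i) with he
  have he0 : 0 < e := mul_pos (pow_pos h.t_pos _) (zpow_pos hr _)
  have hc0 : (0 : ℝ) < #(allowed W l) := by linarith
  have h3 : |#(allowed W l) * η j - ∑ k ∈ allowed W l, η k| ≤ #(allowed W l) * e := by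
    rw [← nsmul_eq_mul, ← sum_const, ← sum_sub_distrib]
    refine (abs_sum_le_sum_abs _ _).trans ?_
    rw [← nsmul_eq_mul]
    refine sum_le_card_nsmul _ _ _ fun k hk => ?_
    by_cases hjk : j = k
    · subst hjk; simpa using he0.le
    · exact h1 j hj k hk hjk
  have h4 : |∑ k ∈ allowed W l, η k| ≤ n * e := by
    refine h2.trans (le_of_eq ?_)
    rw [h.hn, he, neg_sub, sub_eq_add_neg, zpow_add₀ hr.ne']
    have : r ^ (2 : ℤ) = r ^ 2 := by norm_cast
    rw [this]; ring
  have h5 : #(allowed W l) * |η j| ≤ #(allowed W l) * (3 * e) := by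
    have : |#(allowed W l) * η j| ≤ #(allowed W l) * e + n * e := by
      have := abs_sub_abs_le_abs_sub (#(allowed W l) * η j) (∑ k ∈ allowed W l, η k)
      linarith
    rw [abs_mul, abs_of_pos hc0] at this
    nlinarith
  have h6 := le_of_mul_le_mul_left h5 hc0
  rw [Bd, pow_succ, mul_right_comm, ← he]
  nlinarith [h.ht]

/-- The deviation of a degree outside `W`. -/
def qv (lam : ℝ) (d : Fin n → ℝ) (W H₀ : SimpleGraph (Fin n)) (j : Fin n) : ℝ :=
  d j - lam * (n - 1) - deg (H₀ ⊓ W) j + lam * deg W j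

lemma Model.qv_bd (h : Model n t r lam d s W H₀) (j : Fin n) :
    Bd t r (-1) 3 (qv lam d W H₀ j) := by
  have h1 := h.d_near j
  have h2 := h.sparse.deg_le' j
  have h3 := deg_inf_le H₀ W j
  have h4 := deg_nonneg (H₀ ⊓ W) j
  have h5 := deg_nonneg W j
  have h6 := h.lam_pos
  have h7 := h.lam_lt
  have : 0 < r * t ^ 2 := mul_pos h.r_pos (pow_pos h.t_pos _)
  rw [Bd, neg_neg, zpow_one, qv]
  rw [abs_le] at *
  constructor <;> nlinarith [h.ht]

lemma Model.pr_sub_pr (h : Model n t r lam d s W H₀) {j k l : Fin n} (hjk : j ≠ k)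
    (hl : l ∈ common W j k) : Bd t r 1 12 (pr d W H₀ j l - pr d W H₀ k l) := by
  have hn := h.n_pos
  have ht := h.t_pos
  have hr := h.r_pos
  rw [pr, pr, ← ev_sub, ev_ind_sub_ind hjk hl]
  have h1 : Bd t r 1 11 (ev (cls d W H₀) fun _ => t ^ 5 * r / (n / t ^ 6)) := by
    rw [ev_const h.nonempty, Bd, abs_of_pos (by positivity), h.hn]
    refine le_of_eq ?_
    rw [zpow_neg, zpow_one]; field_simp
  have h2 := h1.add' (i'' := 1) (K'' := 12) h.toScale
    (ev_sdCount_lt (H₀ := H₀) h.toNear h.sparse hjk)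
  rw [← ev_add] at h2
  refine h2.of_le ((abs_ev_le_ev_abs.trans (ev_mono fun H hH => ?_)).trans (le_abs_self _))
  have hD := h.onlyCount_sub hH hjk
  rw [Bd, neg_neg, zpow_one] at hD
  have hs : ∑ x ∈ common W j k, (only H j k x + only H k j x) = sdCount W H j k := by
    rw [sdCount, onlyCount, onlyCount, common_comm W k j, sum_add_distrib]
  have h0 : ∀ x, 0 ≤ only H j k x + only H k j x := fun x =>
    add_nonneg (only_nonneg _ _ _ _) (only_nonneg _ _ _ _)
  have hle : only H j k l + only H k j l ≤ 1 := by
    unfold only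
    rcases ind_eq_zero_or_one H j l with e | e <;>
      rcases ind_eq_zero_or_one H k l with e' | e' <;> simp [e, e']
  have hs0 := sdCount_nonneg W H j k
  have hDs : |onlyCount W H j k - onlyCount W H k j| ≤ sdCount W H j k := by
    have h1 := onlyCount_nonneg W H j k
    have h2 := onlyCount_nonneg W H k j
    rw [sdCount, abs_le]; constructor <;> linarith
  rw [abs_div, abs_mul, abs_of_nonneg (h0 l), abs_of_nonneg hs0]
  have hpos : 0 < t ^ 5 * r / (n / t ^ 6) := by positivity
  split_ifs with hlt
  · have : (only H j k l + only H k j l) * |onlyCount W H j k - onlyCount W H k j| /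
        sdCount W H j k ≤ 1 := by
      refine div_le_one_of_le₀ ?_ hs0
      nlinarith [h0 l, abs_nonneg (onlyCount W H j k - onlyCount W H k j)]
    linarith
  · rw [add_zero]
    push Not at hlt
    refine div_le_div₀ (by positivity) ?_ (by positivity) hlt
    nlinarith [h0 l, abs_nonneg (onlyCount W H j k - onlyCount W H k j)]

lemma sum_allowed_pr (h : Model n t r lam d s W H₀) (l : Fin n) :
    ∑ j ∈ allowed W l, pr d W H₀ l j = d l - deg (H₀ ⊓ W) l := by
  simp only [pr]
  rw [← ev_sum, ev_congr (ψ := fun _ => d l - deg (H₀ ⊓ W) l)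
    fun H hH => sum_allowed_ind hH l, ev_const h.nonempty]

lemma Model.pr_sub_lam (h : Model n t r lam d s W H₀) {j l : Fin n} (hjl : j ≠ l)
    (hW : ¬ W.Adj j l) : Bd t r 1 13 (pr d W H₀ j l - lam) := by
  rw [pr_symm]
  refine h.uniformize (l := l) (η := fun j => pr d W H₀ l j - lam) (fun j hj k hk hjk => ?_) ?_
    (mem_allowed.2 ⟨hjl, fun h => hW h.symm⟩)
  · have := h.pr_sub_pr hjk (mem_common_of_allowed hj hk)
    rw [pr_symm, pr_symm k] at this
    simpa using this
  · rw [sum_sub_distrib, sum_allowed_pr h, sum_const, nsmul_eq_mul, card_allowed]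
    have e : d l - deg (H₀ ⊓ W) l - (n - 1 - deg W l) * lam = qv lam d W H₀ l := by
      rw [qv]; ring
    rw [e]
    exact (h.qv_bd l).mono h.toScale (by norm_num) (by norm_num)

end DegreeSeq

namespace DegreeSeq

variable {n : ℕ} {t r lam : ℝ} {d : Fin n → ℝ} {W H₀ : SimpleGraph (Fin n)} {s : ℕ}

lemma cls_eq_of_mem {H : SimpleGraph (Fin n)} (h : H ∈ cls d W H₀) : cls d W H = cls d W H₀ := by
  ext G
  rw [mem_cls, mem_cls, (mem_cls.1 h).2]

/-- Conditioning on the adjacencies in `T`. -/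
lemma ev_tower (T : SimpleGraph (Fin n)) (g : SimpleGraph (Fin n) → ℝ) :
    ev (cls d W H₀) g = ev (cls d W H₀) fun H => ev (cls d (W ⊔ T) H) g := by
  have hmem : ∀ H H', H ∈ cls d W H₀ ∧ H' ∈ cls d (W ⊔ T) H ↔
      H ∈ cls d (W ⊔ T) H' ∧ H' ∈ cls d W H₀ := by
    intro H H'
    have key : ∀ A B : SimpleGraph (Fin n), A ⊓ (W ⊔ T) = B ⊓ (W ⊔ T) → A ⊓ W = B ⊓ W := by
      intro A B h
      have := congrArg (· ⊓ W) h
      simpa [inf_assoc] using this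
    simp only [mem_cls]
    constructor
    · rintro ⟨⟨h1, h2⟩, h3, h4⟩
      exact ⟨⟨h1, h4.symm⟩, h3, (key _ _ h4).trans h2⟩
    · rintro ⟨⟨h1, h2⟩, h3, h4⟩
      exact ⟨⟨h1, (key _ _ h2).trans h4⟩, h3, h2.symm⟩
  unfold ev
  congr 1
  simp only [sum_div]
  rw [sum_comm' hmem]
  refine sum_congr rfl fun H hH => ?_
  have h1 : ∀ H' ∈ cls d (W ⊔ T) H, g H / (#(cls d (W ⊔ T) H') : ℝ) =
      g H / #(cls d (W ⊔ T) H) := fun H' hH' => by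
    rw [cls_eq_of_mem hH']
  rw [sum_congr rfl h1, sum_const, nsmul_eq_mul]
  have : (#(cls d (W ⊔ T) H) : ℝ) ≠ 0 := by
    rw [Nat.cast_ne_zero]
    exact (card_pos.2 ⟨H, self_mem_cls (mem_cls.1 hH).1⟩).ne'
  field_simp

/-- The function `ψ` depends only on the adjacencies in `T`. -/
def Det (T : SimpleGraph (Fin n)) (ψ : SimpleGraph (Fin n) → ℝ) : Prop :=
  ∀ H H', H ⊓ T = H' ⊓ T → ψ H = ψ H'

lemma Det.ind {T : SimpleGraph (Fin n)} {a b : Fin n} (h : T.Adj a b) :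
    Det T fun H => ind H a b := by
  intro H H' e
  have := inf_eq_inf_iff.1 e a b h
  simp [DegreeSeq.ind, this]

lemma Det.const {T : SimpleGraph (Fin n)} (c : ℝ) : Det T fun _ => c := fun _ _ _ => rfl

lemma Det.comp₂ {T : SimpleGraph (Fin n)} {ψ φ : SimpleGraph (Fin n) → ℝ} (F : ℝ → ℝ → ℝ)
    (h : Det T ψ) (h' : Det T φ) : Det T fun H => F (ψ H) (φ H) := fun H H' e => by
  simp only [h H H' e, h' H H' e]

/-- The graph whose edges are the given pairs. -/
def pairs (L : List (Fin n × Fin n)) : SimpleGraph (Fin n) :=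
  SimpleGraph.fromRel fun a b => (a, b) ∈ L

lemma pairs_adj {L : List (Fin n × Fin n)} {a b : Fin n} :
    (pairs L).Adj a b ↔ a ≠ b ∧ ((a, b) ∈ L ∨ (b, a) ∈ L) := by
  simp [pairs]

lemma ind_sup_le (H T : SimpleGraph (Fin n)) (a b : Fin n) :
    ind (H ⊔ T) a b ≤ ind H a b + ind T a b := by
  by_cases h : H.Adj a b <;> by_cases h' : T.Adj a b <;> simp [ind, h, h']

lemma deg_sup_le (H T : SimpleGraph (Fin n)) (v : Fin n) :
    deg (H ⊔ T) v ≤ deg H v + deg T v := by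
  rw [deg, deg, deg, ← sum_add_distrib]
  exact sum_le_sum fun u _ => ind_sup_le H T v u

lemma ind_pairs_cons_le (p : Fin n × Fin n) (L : List (Fin n × Fin n)) (v u : Fin n) :
    ind (pairs (p :: L)) v u ≤ (if v = p.1 then if u = p.2 then 1 else 0 else 0) +
      (if v = p.2 then if u = p.1 then 1 else 0 else 0) + ind (pairs L) v u := by
  have h := ind_nonneg (pairs L) v u
  by_cases hp : (pairs (p :: L)).Adj v u
  · rw [pairs_adj, List.mem_cons, List.mem_cons] at hp
    obtain ⟨hne, (h1 | h1) | (h1 | h1)⟩ := hp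
    · subst h1; unfold DegreeSeq.ind at *; simp only [if_true]; split_ifs <;> norm_num
    · have : (pairs L).Adj v u := pairs_adj.2 ⟨hne, Or.inl h1⟩
      simp only [DegreeSeq.ind, this, if_true]; split_ifs <;> norm_num
    · subst h1; unfold DegreeSeq.ind at *; simp only [if_true]; split_ifs <;> norm_num
    · have : (pairs L).Adj v u := pairs_adj.2 ⟨hne, Or.inr h1⟩
      simp only [DegreeSeq.ind, this, if_true]; split_ifs <;> norm_num
  · have : ind (pairs (p :: L)) v u = 0 := by simp [DegreeSeq.ind, hp]
    rw [this]
    have h1 : (0 : ℝ) ≤ (if v = p.1 then if u = p.2 then 1 else 0 else 0) := by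
      split_ifs <;> norm_num
    have h2 : (0 : ℝ) ≤ (if v = p.2 then if u = p.1 then 1 else 0 else 0) := by
      split_ifs <;> norm_num
    linarith

lemma deg_pairs_cons_le (p : Fin n × Fin n) (L : List (Fin n × Fin n)) (v : Fin n) :
    deg (pairs (p :: L)) v ≤
      (if v = p.1 then 1 else 0) + (if v = p.2 then 1 else 0) + deg (pairs L) v := by
  refine (sum_le_sum fun u _ => ind_pairs_cons_le p L v u).trans (le_of_eq ?_)
  rw [sum_add_distrib, sum_add_distrib]
  congr 2
  · by_cases h : v = p.1 <;> simp [h]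
  · by_cases h : v = p.2 <;> simp [h]

lemma deg_pairs_le (L : List (Fin n × Fin n)) (v : Fin n) : deg (pairs L) v ≤ 2 * L.length := by
  induction L with
  | nil => simp [deg, DegreeSeq.ind, pairs_adj]
  | cons p L ih =>
    refine (deg_pairs_cons_le p L v).trans ?_
    push_cast [List.length_cons]
    have h1 : (if v = p.1 then (1 : ℝ) else 0) ≤ 1 := by split_ifs <;> norm_num
    have h2 : (if v = p.2 then (1 : ℝ) else 0) ≤ 1 := by split_ifs <;> norm_num
    linarith

lemma sum_deg_pairs_le (L : List (Fin n × Fin n)) : ∑ v, deg (pairs L) v ≤ 2 * L.length := by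
  induction L with
  | nil => simp [deg, DegreeSeq.ind, pairs_adj]
  | cons p L ih =>
    refine (sum_le_sum fun v _ => deg_pairs_cons_le p L v).trans ?_
    rw [sum_add_distrib, sum_add_distrib]
    push_cast [List.length_cons]
    simp only [sum_ite_eq', mem_univ, if_true]
    linarith

lemma Sparse.sup_pairs (h : Sparse t r (s + 8) W) {L : List (Fin n × Fin n)} (hL : L.length ≤ 4) :
    Sparse t r s (W ⊔ pairs L) := by
  have hL' : (L.length : ℝ) ≤ 4 := by exact_mod_cast hL
  constructor
  · intro v
    have h1 := h.deg_le v
    have h2 := deg_sup_le W (pairs L) v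
    have h3 := deg_pairs_le L v
    push_cast at h1
    linarith
  · have h1 := h.sum_le
    have h2 := sum_le_sum fun v (_ : v ∈ univ) => deg_sup_le W (pairs L) v
    rw [sum_add_distrib] at h2
    have h3 := sum_deg_pairs_le L
    push_cast at h1
    linarith

lemma Model.sup_pairs (h : Model n t r lam d (s + 8) W H₀) {H : SimpleGraph (Fin n)}
    (hH : H ∈ cls d W H₀) {L : List (Fin n × Fin n)} (hL : L.length ≤ 4) :
    Model n t r lam d s (W ⊔ pairs L) H :=
  ⟨h.toNear, h.sparse.sup_pairs hL, (mem_cls.1 hH).1⟩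

/-- The function `f` approximates the edge probabilities, even after conditioning on a bounded
number of other adjacencies. -/
def Approx (d : Fin n → ℝ) (W H₀ : SimpleGraph (Fin n)) (f : Fin n → Fin n → ℝ) (ξ : ℝ) : Prop :=
  ∀ a b, a ≠ b → ∀ L : List (Fin n × Fin n), L.length ≤ 4 → (a, b) ∉ L → (b, a) ∉ L →
    ∀ ψ, Det (pairs L) ψ → (∀ H ∈ cls d W H₀, |ψ H| ≤ 1) →
    |ev (cls d W H₀) fun H => (ind H a b - f a b) * ψ H| ≤ ξ

lemma approx_of_pr {f : Fin n → Fin n → ℝ} {ξ : ℝ} (hξ : 0 ≤ ξ)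
    (hfix : ∀ a b, W.Adj a b → f a b = ind H₀ a b)
    (h : ∀ a b, a ≠ b → ¬ W.Adj a b → ∀ L : List (Fin n × Fin n), L.length ≤ 4 →
      ¬ (W ⊔ pairs L).Adj a b → ∀ H ∈ cls d W H₀, |pr d (W ⊔ pairs L) H a b - f a b| ≤ ξ) :
    Approx d W H₀ f ξ := by
  intro a b hab L hL h1 h2 ψ hψ hψ1
  by_cases hW : W.Adj a b
  · rw [ev_congr (ψ := fun _ => 0), abs_le]
    · simp [ev, hξ]
    · intro H hH
      have := inf_eq_inf_iff.1 (mem_cls.1 hH).2 a b hW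
      simp [hfix a b hW, DegreeSeq.ind, this]
  rw [ev_tower (pairs L)]
  refine abs_ev_le hξ fun H hH => ?_
  have hne : (cls d (W ⊔ pairs L) H).Nonempty := ⟨H, self_mem_cls (mem_cls.1 hH).1⟩
  have hnot : ¬ (W ⊔ pairs L).Adj a b := by
    rw [SimpleGraph.sup_adj, pairs_adj]; tauto
  have key : (ev (cls d (W ⊔ pairs L) H) fun H => (DegreeSeq.ind H a b - f a b) * ψ H) =
      ψ H * (pr d (W ⊔ pairs L) H a b - f a b) := by
    rw [ev_congr (ψ := fun H' => ψ H * (DegreeSeq.ind H' a b - f a b)), ev_const_mul, ev_sub,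
      ev_const hne, pr]
    intro H' hH'
    have e := (mem_cls.1 hH').2
    have e' : H' ⊓ pairs L = H ⊓ pairs L := by
      have := congrArg (· ⊓ pairs L) e
      simpa [inf_assoc] using this
    rw [hψ H' H e', mul_comm]
  rw [key, abs_mul]
  have h3 := hψ1 H hH
  have h4 := h a b hab hW L hL hnot H hH
  nlinarith [abs_nonneg (ψ H), abs_nonneg (pr d (W ⊔ pairs L) H a b - f a b)]

end DegreeSeq

namespace DegreeSeq

variable {n : ℕ} {t r lam : ℝ} {d : Fin n → ℝ} {W H₀ : SimpleGraph (Fin n)} {s : ℕ}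
  {f : Fin n → Fin n → ℝ}

/-- The indicator that exactly one of `jm`, `km` is an edge. -/
def differ (H : SimpleGraph (Fin n)) (j k m : Fin n) : ℝ := only H j k m + only H k j m

/-- The approximate probability that exactly one of `jm`, `km` is an edge. -/
def sg (f : Fin n → Fin n → ℝ) (j k m : Fin n) : ℝ := f j m + f k m - 2 * f j m * f k m

/-- The approximate value of `sdCount`. -/
def sz (f : Fin n → Fin n → ℝ) (W : SimpleGraph (Fin n)) (j k : Fin n) : ℝ :=
  ∑ m ∈ common W j k, sg f j k m

/-- The approximate difference between the degrees of `j` and `k` outside `W`. -/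
def dz (f : Fin n → Fin n → ℝ) (d : Fin n → ℝ) (W : SimpleGraph (Fin n)) (j k : Fin n) : ℝ :=
  d j - d k - ∑ m ∈ bad W j k, (f j m - f k m)

lemma differ_nonneg (H : SimpleGraph (Fin n)) (j k m : Fin n) : 0 ≤ differ H j k m :=
  add_nonneg (only_nonneg _ _ _ _) (only_nonneg _ _ _ _)

lemma differ_le_one (H : SimpleGraph (Fin n)) (j k m : Fin n) : differ H j k m ≤ 1 := by
  unfold differ only
  rcases ind_eq_zero_or_one H j m with e | e <;>
    rcases ind_eq_zero_or_one H k m with e' | e' <;> simp [e, e']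

lemma abs_differ_le_one (H : SimpleGraph (Fin n)) (j k m : Fin n) : |differ H j k m| ≤ 1 := by
  rw [abs_of_nonneg (differ_nonneg H j k m)]; exact differ_le_one H j k m

lemma sdCount_eq_sum (H : SimpleGraph (Fin n)) (j k : Fin n) :
    sdCount W H j k = ∑ m ∈ common W j k, differ H j k m := by
  rw [sdCount, onlyCount, onlyCount, common_comm W k j, ← sum_add_distrib]; rfl

lemma differ_le_sdCount (H : SimpleGraph (Fin n)) {j k l : Fin n} (hl : l ∈ common W j k) :
    differ H j k l ≤ sdCount W H j k := by
  rw [sdCount_eq_sum]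
  exact single_le_sum (f := fun m => differ H j k m) (fun m _ => differ_nonneg H j k m) hl

lemma sdCount_le (H : SimpleGraph (Fin n)) (j k : Fin n) : sdCount W H j k ≤ n := by
  rw [sdCount_eq_sum]
  refine (sum_le_card_nsmul _ _ 1 fun m _ => differ_le_one H j k m).trans ?_
  rw [nsmul_eq_mul, mul_one]
  exact_mod_cast (by simpa using card_le_univ (common W j k))

lemma sg_nonneg (hf0 : ∀ a b, 0 ≤ f a b) (hf1 : ∀ a b, f a b ≤ 1)
    (j k m : Fin n) : 0 ≤ sg f j k m := by
  unfold sg; nlinarith [hf0 j m, hf0 k m, hf1 j m, hf1 k m]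

lemma sg_le_one (hf0 : ∀ a b, 0 ≤ f a b) (hf1 : ∀ a b, f a b ≤ 1)
    (j k m : Fin n) : sg f j k m ≤ 1 := by
  unfold sg; nlinarith [hf0 j m, hf0 k m, hf1 j m, hf1 k m]

lemma abs_differ_sub_sg (hf0 : ∀ a b, 0 ≤ f a b) (hf1 : ∀ a b, f a b ≤ 1)
    (H : SimpleGraph (Fin n)) (j k m : Fin n) :
    |differ H j k m - sg f j k m| ≤ 1 := by
  have := sg_nonneg hf0 hf1 j k m
  have := sg_le_one hf0 hf1 j k m
  have := differ_nonneg H j k m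
  have := differ_le_one H j k m
  rw [abs_le]; constructor <;> linarith

lemma sz_nonneg (hf0 : ∀ a b, 0 ≤ f a b) (hf1 : ∀ a b, f a b ≤ 1)
    (j k : Fin n) : 0 ≤ sz f W j k := sum_nonneg fun m _ => sg_nonneg hf0 hf1 j k m

lemma sz_le (hf0 : ∀ a b, 0 ≤ f a b) (hf1 : ∀ a b, f a b ≤ 1)
    (j k : Fin n) : sz f W j k ≤ n := by
  refine (sum_le_card_nsmul _ _ 1 fun m _ => sg_le_one hf0 hf1 j k m).trans ?_
  rw [nsmul_eq_mul, mul_one]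
  exact_mod_cast (by simpa using card_le_univ (common W j k))

lemma det_differ {L : List (Fin n × Fin n)} {j k m : Fin n} (hj : j ≠ m) (hk : k ≠ m)
    (h1 : (j, m) ∈ L) (h2 : (k, m) ∈ L) : Det (pairs L) fun H => differ H j k m := by
  have e1 : Det (pairs L) fun H => ind H j m := Det.ind (pairs_adj.2 ⟨hj, Or.inl h1⟩)
  have e2 : Det (pairs L) fun H => ind H k m := Det.ind (pairs_adj.2 ⟨hk, Or.inl h2⟩)
  exact e1.comp₂ (fun x y => x * (1 - y) + y * (1 - x)) e2

lemma Det.mono {T T' : SimpleGraph (Fin n)} (hT : T ≤ T') {ψ : SimpleGraph (Fin n) → ℝ}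
    (h : Det T ψ) : Det T' ψ := fun H H' e => h H H' (by
  rw [inf_eq_inf_iff] at *
  exact fun a b hab => e a b (hT hab))

lemma pairs_le_cons (p : Fin n × Fin n) (L : List (Fin n × Fin n)) :
    pairs L ≤ pairs (p :: L) := by
  intro a b h
  rw [pairs_adj] at *
  simp only [List.mem_cons]
  tauto

variable {i : ℤ} {K : ℕ}

lemma Approx.ind_sub (h : Scale n t r) (hA : Approx d W H₀ f (t ^ K * r ^ (-i))) {j k m : Fin n}
    (hj : j ≠ m) (hk : k ≠ m) {L : List (Fin n × Fin n)} (hL : L.length ≤ 4)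
    (h1 : (j, m) ∉ L) (h2 : (m, j) ∉ L) (h3 : (k, m) ∉ L) (h4 : (m, k) ∉ L)
    {ψ : SimpleGraph (Fin n) → ℝ} (hψ : Det (pairs L) ψ) (hψ1 : ∀ H ∈ cls d W H₀, |ψ H| ≤ 1) :
    Bd t r i (K + 1)
      (ev (cls d W H₀) fun H => ((ind H j m - f j m) - (ind H k m - f k m)) * ψ H) := by
  have e1 := hA j m hj L hL h1 h2 ψ hψ hψ1
  have e2 := hA k m hk L hL h3 h4 ψ hψ hψ1
  have := Bd.add h (i := i) (K := K) e1 (Bd.neg e2)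
  rw [← ev_neg, ← ev_add] at this
  convert this using 3
  ring

lemma Approx.differ_sub (h : Scale n t r) (hf0 : ∀ a b, 0 ≤ f a b) (hf1 : ∀ a b, f a b ≤ 1)
    (hA : Approx d W H₀ f (t ^ K * r ^ (-i))) {j k m : Fin n} (hjk : j ≠ k)
    (hj : j ≠ m) (hk : k ≠ m) {L : List (Fin n × Fin n)} (hL : L.length ≤ 3)
    (h1 : (j, m) ∉ L) (h2 : (m, j) ∉ L) (h3 : (k, m) ∉ L) (h4 : (m, k) ∉ L)
    {ψ : SimpleGraph (Fin n) → ℝ} (hψ : Det (pairs L) ψ) (hψ1 : ∀ H ∈ cls d W H₀, |ψ H| ≤ 1) :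
    Bd t r i (K + 1)
      (ev (cls d W H₀) fun H => (differ H j k m - sg f j k m) * ψ H) := by
  have e1 := hA j m hj ((k, m) :: L) (by simp; omega)
    (by simp only [List.mem_cons, Prod.mk.injEq]; tauto)
    (by simp only [List.mem_cons, Prod.mk.injEq]; tauto)
    (fun H => (1 - 2 * ind H k m) * ψ H)
    (Det.comp₂ (fun x y => (1 - 2 * x) * y) (Det.ind (pairs_adj.2 ⟨hk, Or.inl (by simp)⟩))
      (hψ.mono (pairs_le_cons _ _)))
    (fun H hH => by
      rw [abs_mul]
      have : |1 - 2 * ind H k m| ≤ 1 := by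
        rcases ind_eq_zero_or_one H k m with e | e <;> norm_num [e]
      exact mul_le_one₀ this (abs_nonneg _) (hψ1 H hH))
  have e2 := hA k m hk L (by omega) h3 h4 (fun H => (1 - 2 * f j m) * ψ H)
    (Det.comp₂ (ψ := fun _ => 1 - 2 * f j m) (fun x y => x * y) (Det.const _) hψ)
    (fun H hH => by
      rw [abs_mul]
      have : |1 - 2 * f j m| ≤ 1 := by
        rw [abs_le]; constructor <;> linarith [hf0 j m, hf1 j m]
      exact mul_le_one₀ this (abs_nonneg _) (hψ1 H hH))
  have := Bd.add h (i := i) (K := K) e1 e2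
  rw [← ev_add] at this
  convert this using 3
  simp only [differ, only, sg]
  ring

end DegreeSeq

namespace DegreeSeq

variable {n : ℕ} {t r lam : ℝ} {d : Fin n → ℝ} {W H₀ : SimpleGraph (Fin n)} {s : ℕ}
  {f : Fin n → Fin n → ℝ} {i : ℤ} {K : ℕ}

/-- The sum over `bad W j k` of the errors of `f`. -/
def badError (f : Fin n → Fin n → ℝ) (W : SimpleGraph (Fin n)) (j k : Fin n)
    (H : SimpleGraph (Fin n)) : ℝ :=
  ∑ m ∈ bad W j k, ((ind H j m - f j m) - (ind H k m - f k m))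

lemma onlyCount_sub_eq {H : SimpleGraph (Fin n)} (hH : H ∈ cls d W H₀) {j k : Fin n}
    (hjk : j ≠ k) :
    onlyCount W H j k - onlyCount W H k j = dz f d W j k - badError f W j k H := by
  rw [onlyCount_sub_onlyCount H hjk, (mem_cls.1 hH).1, (mem_cls.1 hH).1, dz, badError]
  simp only [sum_sub_distrib]
  ring

lemma ev_mul_sum {ι : Type*} (C : Finset (SimpleGraph (Fin n))) (I : Finset ι)
    (g : SimpleGraph (Fin n) → ℝ) (φ : ι → SimpleGraph (Fin n) → ℝ) :
    (ev C fun H => (∑ m ∈ I, φ m H) * g H) = ∑ m ∈ I, ev C fun H => φ m H * g H := by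
  rw [← ev_sum]
  exact ev_congr fun H _ => sum_mul _ _ _

lemma Model.dz_bd (h : Model n t r lam d s W H₀) (hf0 : ∀ a b, 0 ≤ f a b)
    (hf1 : ∀ a b, f a b ≤ 1) (j k : Fin n) : Bd t r (-1) 5 (dz f d W j k) := by
  have h1 : Bd t r (-1) 3 (d j - d k) := by
    have h2 := h.d_near j
    have h3 := h.d_near k
    have : 0 < r * t ^ 2 := mul_pos h.r_pos (pow_pos h.t_pos _)
    rw [Bd, neg_neg, zpow_one]
    rw [abs_le] at *
    constructor <;> nlinarith [h.ht]
  have h2 : Bd t r (-1 + 0) (3 + 0) (∑ m ∈ bad W j k, (f j m - f k m)) := by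
    refine Bd.sum h.toScale (fun m _ => Bd.one ?_) (h.card_bad j k)
    rw [abs_le]; constructor <;> linarith [hf0 j m, hf0 k m, hf1 j m, hf1 k m]
  exact h1.sub' h.toScale h2

section Estimates

variable {j k l : Fin n}

lemma Approx.ev_badError_mul (h : Model n t r lam d s W H₀)
    (hA : Approx d W H₀ f (t ^ K * r ^ (-i))) {L : List (Fin n × Fin n)}
    (hL : L.length ≤ 4) (hbad : ∀ m ∈ bad W j k, ∀ a, (a, m) ∉ L ∧ (m, a) ∉ L)
    {ψ : SimpleGraph (Fin n) → ℝ} (hψ : Det (pairs L) ψ) (hψ1 : ∀ H ∈ cls d W H₀, |ψ H| ≤ 1) :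
    Bd t r (i - 1) (K + 4) (ev (cls d W H₀) fun H => badError f W j k H * ψ H) := by
  unfold badError
  rw [ev_mul_sum]
  refine (Bd.sum h.toScale (i := i) (K := K + 1) (fun m hm => ?_) (h.card_bad j k)).mono h.toScale
    (by omega) (by omega)
  have h1 := hbad m hm
  have hm := mem_bad.1 hm
  exact hA.ind_sub h.toScale hm.1.symm hm.2.1.symm hL (h1 _).1 (h1 _).2 (h1 _).1 (h1 _).2 hψ hψ1

lemma Approx.ev_differ (h : Model n t r lam d s W H₀) (hf0 : ∀ a b, 0 ≤ f a b)
    (hf1 : ∀ a b, f a b ≤ 1) (hA : Approx d W H₀ f (t ^ K * r ^ (-i))) (hjk : j ≠ k)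
    (hl : l ∈ common W j k) :
    Bd t r i (K + 1) ((ev (cls d W H₀) fun H => differ H j k l) - sg f j k l) := by
  have hl' := mem_common.1 hl
  have := hA.differ_sub h.toScale hf0 hf1 hjk hl'.1.symm hl'.2.1.symm (L := []) (by simp) (by simp)
    (by simp) (by simp) (by simp) (ψ := fun _ => 1) (Det.const _) (fun _ _ => by simp)
  simp only [mul_one] at this
  rwa [ev_sub, ev_const h.nonempty] at this

lemma notMem_bad_of_common {m x : Fin n} (hm : m ∈ bad W j k) (hx : x ∈ common W j k) :
    x ≠ m := by
  rintro rfl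
  have h1 := mem_bad.1 hm
  have h2 := mem_common.1 hx
  tauto

lemma Approx.ev_badError_differ (h : Model n t r lam d s W H₀)
    (hA : Approx d W H₀ f (t ^ K * r ^ (-i)))
    (hl : l ∈ common W j k) :
    Bd t r (i - 1) (K + 4) (ev (cls d W H₀) fun H => badError f W j k H * differ H j k l) := by
  have hl' := mem_common.1 hl
  refine hA.ev_badError_mul h (L := [(j, l), (k, l)]) (by simp) (fun m hm a => ?_)
    (det_differ hl'.1.symm hl'.2.1.symm (by simp) (by simp))
    (fun H _ => abs_differ_le_one H j k l)
  have h1 := notMem_bad_of_common hm hl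
  have h2 := mem_bad.1 hm
  simp only [List.mem_cons, Prod.mk.injEq, List.not_mem_nil, or_false]
  constructor <;> rintro (⟨e1, e2⟩ | ⟨e1, e2⟩) <;> subst_vars <;> tauto

lemma det_differ_sub {L : List (Fin n × Fin n)} {m : Fin n} (hj : j ≠ m) (hk : k ≠ m)
    (h1 : (j, m) ∈ L) (h2 : (k, m) ∈ L) :
    Det (pairs L) fun H => differ H j k m - sg f j k m :=
  (det_differ hj hk h1 h2).comp₂ (φ := fun _ => sg f j k m) (fun x y => x - y) (Det.const _)

lemma Approx.ev_badError_differ_differ (h : Model n t r lam d s W H₀) (hf0 : ∀ a b, 0 ≤ f a b)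
    (hf1 : ∀ a b, f a b ≤ 1) (hA : Approx d W H₀ f (t ^ K * r ^ (-i)))
    (hl : l ∈ common W j k) :
    Bd t r (i - 3) (K + 4) (ev (cls d W H₀) fun H =>
      (∑ m ∈ common W j k, (differ H j k m - sg f j k m)) *
        (badError f W j k H * differ H j k l)) := by
  have hl' := mem_common.1 hl
  rw [ev_mul_sum]
  refine (Bd.sum h.toScale (i := i - 1) (K := K + 4) (fun x hx => ?_) (Bd.card h.toScale _)).mono
    h.toScale (by omega) (by omega)
  have hx' := mem_common.1 hx
  have := hA.ev_badError_mul h (j := j) (k := k) (L := [(j, l), (k, l), (j, x), (k, x)]) (by simp)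
    (fun m hm a => by
      have h0 := notMem_bad_of_common hm hx
      have h1 := notMem_bad_of_common hm hl
      have h2 := mem_bad.1 hm
      simp only [List.mem_cons, Prod.mk.injEq, List.not_mem_nil, or_false]
      constructor <;> rintro (⟨e1, e2⟩ | ⟨e1, e2⟩ | ⟨e1, e2⟩ | ⟨e1, e2⟩) <;> subst_vars <;> tauto)
    (ψ := fun H => (differ H j k x - sg f j k x) * differ H j k l)
    (Det.comp₂ (fun x y => x * y)
      (det_differ_sub (j := j) (k := k) hx'.1.symm hx'.2.1.symm (by simp) (by simp))
      (det_differ hl'.1.symm hl'.2.1.symm (by simp) (by simp)))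
    (fun H _ => by
      rw [abs_mul]
      exact mul_le_one₀ (abs_differ_sub_sg hf0 hf1 H j k x) (abs_nonneg _)
        (abs_differ_le_one H j k l))
  convert this using 3
  ring

lemma Approx.ev_differ_mul_sum (h : Model n t r lam d s W H₀) (hi : i ≤ 2)
    (hf0 : ∀ a b, 0 ≤ f a b) (hf1 : ∀ a b, f a b ≤ 1)
    (hA : Approx d W H₀ f (t ^ K * r ^ (-i))) (hjk : j ≠ k) {y : Fin n} (hy : y ∈ common W j k)
    {φ : SimpleGraph (Fin n) → ℝ} (hφ : ∀ L : List (Fin n × Fin n), (j, y) ∈ L → (k, y) ∈ L →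
      Det (pairs L) φ) (hφ1 : ∀ H, |φ H| ≤ 1) :
    Bd t r (i - 2) (K + 2) (ev (cls d W H₀) fun H =>
      (∑ m ∈ common W j k, (differ H j k m - sg f j k m)) * φ H) := by
  have hy' := mem_common.1 hy
  rw [ev_mul_sum, ← sum_erase_add _ _ hy]
  refine Bd.add' h.toScale (Bd.sum h.toScale (i := i) (K := K + 1) (fun x hx => ?_)
    (Bd.card h.toScale _)) (i' := 0) (K' := 0) (Bd.one (abs_ev_le zero_le_one fun H _ => ?_))
    (by omega) (by omega) (by omega) (by omega)
  · have hx1 := (Finset.mem_erase.1 hx).1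
    have hx' := mem_common.1 (Finset.mem_erase.1 hx).2
    refine hA.differ_sub h.toScale hf0 hf1 hjk hx'.1.symm hx'.2.1.symm (L := [(j, y), (k, y)])
      (by simp) ?_ ?_ ?_ ?_ (hφ _ (by simp) (by simp)) (fun H _ => hφ1 H) <;>
    · simp only [List.mem_cons, Prod.mk.injEq, List.not_mem_nil, or_false]
      rintro (⟨e1, e2⟩ | ⟨e1, e2⟩) <;> subst_vars <;> tauto
  · rw [abs_mul]
    exact mul_le_one₀ (abs_differ_sub_sg hf0 hf1 H j k y) (abs_nonneg _) (hφ1 H)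

lemma Approx.ev_sum_mul_differ (h : Model n t r lam d s W H₀) (hi : i ≤ 2)
    (hf0 : ∀ a b, 0 ≤ f a b) (hf1 : ∀ a b, f a b ≤ 1)
    (hA : Approx d W H₀ f (t ^ K * r ^ (-i))) (hjk : j ≠ k) (hl : l ∈ common W j k) :
    Bd t r (i - 2) (K + 2) (ev (cls d W H₀) fun H =>
      (∑ m ∈ common W j k, (differ H j k m - sg f j k m)) * differ H j k l) := by
  have hl' := mem_common.1 hl
  exact hA.ev_differ_mul_sum h hi hf0 hf1 hjk hl
    (fun L h1 h2 => det_differ hl'.1.symm hl'.2.1.symm h1 h2) (fun H => abs_differ_le_one H j k l)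

lemma Approx.ev_sum_sq (h : Model n t r lam d s W H₀) (hi : i ≤ 2)
    (hf0 : ∀ a b, 0 ≤ f a b) (hf1 : ∀ a b, f a b ≤ 1)
    (hA : Approx d W H₀ f (t ^ K * r ^ (-i))) (hjk : j ≠ k) :
    Bd t r (i - 4) (K + 2) (ev (cls d W H₀) fun H =>
      (∑ m ∈ common W j k, (differ H j k m - sg f j k m)) *
        ∑ m ∈ common W j k, (differ H j k m - sg f j k m)) := by
  rw [ev_mul_sum]
  refine (Bd.sum h.toScale (i := i - 2) (K := K + 2) (fun x hx => ?_) (Bd.card h.toScale _)).mono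
    h.toScale (by omega) (by omega)
  have hx' := mem_common.1 hx
  have := hA.ev_differ_mul_sum h hi hf0 hf1 hjk hx
    (φ := fun H => differ H j k x - sg f j k x)
    (fun L h1 h2 => det_differ_sub hx'.1.symm hx'.2.1.symm h1 h2)
    (fun H => abs_differ_sub_sg hf0 hf1 H j k x)
  convert this using 3
  ring

end Estimates

end DegreeSeq

namespace DegreeSeq

variable {n : ℕ} {t r lam : ℝ} {d : Fin n → ℝ} {W H₀ : SimpleGraph (Fin n)} {s : ℕ}
  {f : Fin n → Fin n → ℝ} {i : ℤ} {K : ℕ} {j k l : Fin n}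

lemma sdCount_sub_sz (H : SimpleGraph (Fin n)) (j k : Fin n) :
    ∑ m ∈ common W j k, (differ H j k m - sg f j k m) = sdCount W H j k - sz f W j k := by
  rw [sum_sub_distrib, sdCount_eq_sum, sz]

lemma ratio_expansion {o D F s z v : ℝ} (hz : z * v = 1) (hs : s = 0 → o = 0) :
    o * (D - F) / s = D * v * o - v * (F * o) - D * v ^ 2 * ((s - z) * o) +
      v ^ 2 * ((s - z) * (F * o)) + o * (D - F) * ((s - z) * (s - z)) * v ^ 2 / s := by
  have hz0 : z ≠ 0 := left_ne_zero_of_mul_eq_one hz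
  have hv : v = 1 / z := by field_simp; linarith
  by_cases h0 : s = 0
  · simp [hs h0]
  · subst hv; field_simp; ring

/-- The remainder in the second order expansion of the quotient. -/
def remainder (f : Fin n → Fin n → ℝ) (W H : SimpleGraph (Fin n)) (j k l : Fin n) : ℝ :=
  differ H j k l * (onlyCount W H j k - onlyCount W H k j) *
    ((∑ m ∈ common W j k, (differ H j k m - sg f j k m)) *
      ∑ m ∈ common W j k, (differ H j k m - sg f j k m)) * (1 / sz f W j k) ^ 2 / sdCount W H j k

lemma Model.ev_remainder (h : Model n t r lam d s W H₀) (hi : i ≤ 2)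
    (hf0 : ∀ a b, 0 ≤ f a b) (hf1 : ∀ a b, f a b ≤ 1)
    (hA : Approx d W H₀ f (t ^ K * r ^ (-i))) (hjk : j ≠ k)
    (hz : Bd t r 2 3 (1 / sz f W j k)) :
    Bd t r (i + 1) (K + 20) (ev (cls d W H₀) fun H => remainder f W H j k l) := by
  have hn := h.n_pos
  have ht := h.t_pos
  have hr := h.r_pos
  set v := 1 / sz f W j k with hv
  have hv2 : Bd t r 4 6 (v ^ 2) := by rw [pow_two]; exact hz.mul h.toScale hz
  have h1 : Bd t r 1 11 (t ^ 5 * r / (n / t ^ 6)) := by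
    rw [Bd, abs_of_pos (by positivity), h.hn]
    refine le_of_eq ?_
    rw [zpow_neg, zpow_one]; field_simp
  have h2 := (h1.mul h.toScale hv2).mul h.toScale
    (hA.ev_sum_sq h hi hf0 hf1 hjk)
  have h3 := ((Bd.card_univ h.toScale).mul h.toScale (Bd.card_univ h.toScale)).mul h.toScale hv2
    |>.mul h.toScale (ev_sdCount_lt (H₀ := H₀) h.toNear h.sparse hjk)
  have h4 := h2.add' (i'' := i + 1) (K'' := K + 20) h.toScale h3 (by omega) (by omega) (by omega)
    (by omega)
  rw [← ev_const_mul, ← ev_const_mul, ← ev_add] at h4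
  refine h4.of_le ((abs_ev_le_ev_abs.trans (ev_mono fun H hH => ?_)).trans (le_abs_self _))
  unfold remainder
  rw [sdCount_sub_sz]
  have hD := h.onlyCount_sub hH hjk
  rw [Bd, neg_neg, zpow_one] at hD
  have hs0 := sdCount_nonneg W H j k
  have hsn := sdCount_le (W := W) H j k
  have hz0 := sz_nonneg hf0 hf1 (W := W) j k
  have hzn := sz_le hf0 hf1 (W := W) j k
  have ho := differ_nonneg H j k l
  have ho1 := differ_le_one H j k l
  have hDs : |onlyCount W H j k - onlyCount W H k j| ≤ sdCount W H j k := by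
    have h1 := onlyCount_nonneg W H j k
    have h2 := onlyCount_nonneg W H k j
    rw [sdCount, abs_le]; constructor <;> linarith
  set x := sdCount W H j k - sz f W j k with hx
  have hxx : 0 ≤ x * x := mul_self_nonneg x
  have hxn : x * x ≤ n * n := by
    rw [← abs_mul_abs_self x]
    have : |x| ≤ n := by rw [abs_le]; constructor <;> linarith
    exact mul_le_mul this this (abs_nonneg _) hn.le
  have hvv : 0 ≤ v ^ 2 := sq_nonneg v
  set D := |onlyCount W H j k - onlyCount W H k j| with hDd
  have hD0 : 0 ≤ D := abs_nonneg _
  have hoD : differ H j k l * D ≤ D := by nlinarith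
  rw [abs_div, abs_mul, abs_mul, abs_mul, abs_of_nonneg ho, abs_of_nonneg hs0, abs_of_nonneg hvv,
    abs_of_nonneg hxx, ← hDd]
  have hpos : 0 ≤ t ^ 5 * r / (n / t ^ 6) * v ^ 2 * (x * x) := by positivity
  split_ifs with hlt
  · have h5 : differ H j k l * D * (x * x) * v ^ 2 / sdCount W H j k ≤ (n * n) * v ^ 2 := by
      refine div_le_of_le_mul₀ hs0 (by positivity) ?_
      calc differ H j k l * D * (x * x) * v ^ 2 ≤ sdCount W H j k * (n * n) * v ^ 2 := by
            gcongr; exact hoD.trans hDs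
        _ = _ := by ring
    linarith
  · push Not at hlt
    rw [mul_zero, add_zero]
    have hT : 0 < (n : ℝ) / t ^ 6 := by positivity
    calc differ H j k l * D * (x * x) * v ^ 2 / sdCount W H j k
        ≤ t ^ 5 * r * (x * x) * v ^ 2 / (n / t ^ 6) := by
          refine div_le_div₀ (by positivity) ?_ hT hlt
          exact mul_le_mul_of_nonneg_right (mul_le_mul_of_nonneg_right (hoD.trans hD) hxx) hvv
      _ = _ := by ring

/-- One step of the bootstrap: an approximation of the edge probabilities yields a better
approximation of their differences. -/
lemma Model.step (h : Model n t r lam d s W H₀) (hi : i ≤ 2)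
    (hf0 : ∀ a b, 0 ≤ f a b) (hf1 : ∀ a b, f a b ≤ 1)
    (hA : Approx d W H₀ f (t ^ K * r ^ (-i))) (hjk : j ≠ k) (hl : l ∈ common W j k)
    (hz0 : sz f W j k ≠ 0) (hz : Bd t r 2 3 (1 / sz f W j k)) :
    Bd t r (i + 1) (K + 24)
      (pr d W H₀ j l - pr d W H₀ k l - sg f j k l * dz f d W j k * (1 / sz f W j k)) := by
  set v := 1 / sz f W j k with hv
  have hzv : sz f W j k * v = 1 := by rw [hv]; field_simp
  have hv2 : Bd t r 4 6 (v ^ 2) := by rw [pow_two]; exact hz.mul h.toScale hz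
  have hd := h.dz_bd hf0 hf1 j k
  have e : pr d W H₀ j l - pr d W H₀ k l =
      dz f d W j k * v * (ev (cls d W H₀) fun H => differ H j k l) -
      v * (ev (cls d W H₀) fun H => badError f W j k H * differ H j k l) -
      dz f d W j k * v ^ 2 * (ev (cls d W H₀) fun H =>
        (∑ m ∈ common W j k, (differ H j k m - sg f j k m)) * differ H j k l) +
      v ^ 2 * (ev (cls d W H₀) fun H =>
        (∑ m ∈ common W j k, (differ H j k m - sg f j k m)) *
          (badError f W j k H * differ H j k l)) +
      (ev (cls d W H₀) fun H => remainder f W H j k l) := by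
    rw [pr, pr, ← ev_sub, ev_ind_sub_ind hjk hl]
    simp only [← ev_const_mul]
    rw [← ev_sub, ← ev_sub, ← ev_add, ← ev_add]
    refine ev_congr fun H hH => ?_
    rw [remainder, sdCount_sub_sz, onlyCount_sub_eq hH hjk, ← hv]
    refine ratio_expansion hzv fun hs => ?_
    exact le_antisymm ((differ_le_sdCount H hl).trans hs.le) (differ_nonneg _ _ _ _)
  rw [e]
  have e1 := (hd.mul h.toScale hz).mul h.toScale (hA.ev_differ h hf0 hf1 hjk hl)
  have e2 := hz.mul h.toScale (hA.ev_badError_differ h hl)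
  have e3 := (hd.mul h.toScale hv2).mul h.toScale (hA.ev_sum_mul_differ h hi hf0 hf1 hjk hl)
  have e4 := hv2.mul h.toScale (hA.ev_badError_differ_differ h hf0 hf1 hl)
  have e5 := h.ev_remainder (l := l) hi hf0 hf1 hA hjk hz
  have e6 := e1.sub' (i'' := i + 1) (K'' := K + 21) h.toScale e2 (by omega) (by omega) (by omega)
    (by omega)
  have e7 := e6.sub' (i'' := i + 1) (K'' := K + 22) h.toScale e3 (by omega) (by omega) (by omega)
    (by omega)
  have e8 := e7.add' (i'' := i + 1) (K'' := K + 23) h.toScale e4 (by omega) (by omega) (by omega)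
    (by omega)
  have e9 := e8.add' (i'' := i + 1) (K'' := K + 24) h.toScale e5 (by omega) (by omega) (by omega)
    (by omega)
  convert e9 using 1
  ring

end DegreeSeq

namespace DegreeSeq

variable {n : ℕ} {t r lam : ℝ} {d : Fin n → ℝ} {W H₀ : SimpleGraph (Fin n)} {s : ℕ}

/-- The sum of the deviations over the `W`-neighbours of `j`. -/
def Sv (lam : ℝ) (d : Fin n → ℝ) (W H₀ : SimpleGraph (Fin n)) (j : Fin n) : ℝ :=
  ∑ v, ind W j v * qv lam d W H₀ v

/-- The effect of `W` on the deviation at `j`. -/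
def Uv (lam : ℝ) (d : Fin n → ℝ) (W H₀ : SimpleGraph (Fin n)) (j : Fin n) : ℝ :=
  qv lam d W H₀ j * deg W j + Sv lam d W H₀ j

/-- The sum of the deviations. -/
def Qv (lam : ℝ) (d : Fin n → ℝ) (W H₀ : SimpleGraph (Fin n)) : ℝ := ∑ j, qv lam d W H₀ j

/-- The adjacencies of `H₀` on `W`, and `g` elsewhere. -/
def fixOn (W H₀ : SimpleGraph (Fin n)) (g : Fin n → Fin n → ℝ) (a b : Fin n) : ℝ :=
  if W.Adj a b then ind H₀ a b else g a b

lemma fixOn_of_not {g : Fin n → Fin n → ℝ} {a b : Fin n} (h : ¬ W.Adj a b) :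
    fixOn W H₀ g a b = g a b := if_neg h

lemma sum_fixOn (g : Fin n → Fin n → ℝ) (j : Fin n) :
    ∑ m, fixOn W H₀ g j m = deg (H₀ ⊓ W) j + ∑ m, g j m - ∑ m, ind W j m * g j m := by
  rw [deg, ← sum_add_distrib, ← sum_sub_distrib]
  refine sum_congr rfl fun m _ => ?_
  by_cases h : W.Adj j m <;> by_cases h' : H₀.Adj j m <;> simp [fixOn, ind, h, h']

lemma fixOn_mem {g : Fin n → Fin n → ℝ} (hg0 : ∀ a b, 0 ≤ g a b) (hg1 : ∀ a b, g a b ≤ 1) :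
    (∀ a b, 0 ≤ fixOn W H₀ g a b) ∧ ∀ a b, fixOn W H₀ g a b ≤ 1 := by
  constructor <;> intro a b <;> unfold fixOn <;> split_ifs
  exacts [ind_nonneg _ _ _, hg0 a b, ind_le_one _ _ _, hg1 a b]

lemma fixOn_symm {g : Fin n → Fin n → ℝ} (hg : ∀ a b, g a b = g b a) (a b : Fin n) :
    fixOn W H₀ g a b = fixOn W H₀ g b a := by
  simp only [fixOn, W.adj_comm a b, ind_symm H₀ a b, hg a b]

lemma dz_fixOn {g : Fin n → Fin n → ℝ} (hg : ∀ a b, g a b = g b a) {j k : Fin n} (hjk : j ≠ k) :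
    dz (fixOn W H₀ g) d W j k = (d j - deg (H₀ ⊓ W) j - ∑ m, g j m + ∑ m, ind W j m * g j m) -
      (d k - deg (H₀ ⊓ W) k - ∑ m, g k m + ∑ m, ind W k m * g k m) +
      ∑ m ∈ common W j k, (g j m - g k m) + (g j j - g k k) := by
  have h := sum_common_add_sum_bad (W := W)
    (fun m => fixOn W H₀ g j m - fixOn W H₀ g k m) hjk
  rw [sum_sub_distrib, sum_fixOn, sum_fixOn, fixOn_symm hg k j, fixOn_of_not (W.irrefl (v := j)),
    fixOn_of_not (W.irrefl (v := k))] at h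
  have h2 : ∑ m ∈ common W j k, (fixOn W H₀ g j m - fixOn W H₀ g k m) =
      ∑ m ∈ common W j k, (g j m - g k m) := sum_congr rfl fun m hm => by
    have := mem_common.1 hm
    rw [fixOn_of_not this.2.2.1, fixOn_of_not this.2.2.2]
  rw [h2] at h
  rw [dz]
  linarith

lemma sz_fixOn (g : Fin n → Fin n → ℝ) (j k : Fin n) :
    sz (fixOn W H₀ g) W j k = ∑ m ∈ common W j k, sg g j k m :=
  sum_congr rfl fun m hm => by
    have := mem_common.1 hm
    rw [sg, sg, fixOn_of_not this.2.2.1, fixOn_of_not this.2.2.2]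

lemma sum_allowed' (l : Fin n) (f : Fin n → ℝ) :
    ∑ j ∈ allowed W l, f j = ∑ j, f j - f l - ∑ j, ind W l j * f j := by
  have h := sum_allowed (W := W) l (fun j => f j - if j = l then f l else 0) (by simp)
  have h1 : ∑ j ∈ allowed W l, (f j - if j = l then f l else 0) = ∑ j ∈ allowed W l, f j :=
    sum_congr rfl fun j hj => by rw [if_neg (mem_allowed.1 hj).1, sub_zero]
  rw [h1] at h
  rw [h, sum_sub_distrib]
  simp only [sum_ite_eq', mem_univ, if_true, mul_sub, mul_ite, mul_zero, sum_sub_distrib,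
    ind_self, zero_mul, sub_zero]

section Bounds

lemma Near.lam_bd (h : Near n t r lam d) : Bd t r 0 0 lam :=
  Bd.one (by rw [abs_of_pos h.lam_pos]; linarith [h.lam_lt])

lemma Near.lam_mul_ge (h : Near n t r lam d) : 1 / (2 * t) ≤ lam * (1 - lam) := by
  have h1 := h.lam_ge
  have h2 := h.lam_le
  have ht := h.t_pos
  have e : 1 / (2 * t) = 1 / t / 2 := by field_simp
  have h3 := h.lam_pos
  have h4 := h.lam_lt
  rw [e]
  rcases le_total lam (1 / 2) with h5 | h5 <;> nlinarith

lemma Bd.inv_of_ge {x y : ℝ} {K : ℕ} (hy : 0 < y) (hxy : y ≤ x)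
    {i : ℤ} (h : y⁻¹ ≤ t ^ K * r ^ (-i)) : Bd t r i K (1 / x) := by
  rw [Bd, abs_of_pos (one_div_pos.2 (hy.trans_le hxy)), one_div]
  exact (inv_anti₀ hy hxy).trans h

lemma Near.inv_lam_bd (h : Near n t r lam d) : Bd t r 0 1 (1 / lam) := by
  have := h.t_pos
  exact Bd.inv_of_ge (one_div_pos.2 h.t_pos) h.lam_ge (by simp)

lemma Near.inv_lam_mul_bd (h : Near n t r lam d) : Bd t r 0 2 (1 / (lam * (1 - lam))) := by
  have := h.t_pos
  refine Bd.inv_of_ge (by positivity) h.lam_mul_ge ?_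
  simp only [one_div, inv_inv, neg_zero, zpow_zero, mul_one]
  nlinarith [h.ht]

lemma Model.deg_bd (h : Model n t r lam d s W H₀) (j : Fin n) : Bd t r (-1) 2 (deg W j) := by
  rw [Bd, abs_of_nonneg (deg_nonneg W j), neg_neg, zpow_one, mul_comm]
  exact h.sparse.deg_le' j

lemma sum_ind_mul_bd (h : Model n t r lam d s W H₀) {i : ℤ} {K : ℕ} {f : Fin n → ℝ}
    (hf : ∀ v, Bd t r i K (f v)) (j : Fin n) : Bd t r (i - 1) (K + 2) (∑ v, ind W j v * f v) := by
  have h1 : |∑ v, ind W j v * f v| ≤ deg W j * (t ^ K * r ^ (-i)) := by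
    rw [deg, sum_mul]
    refine (abs_sum_le_sum_abs _ _).trans (sum_le_sum fun v _ => ?_)
    rw [abs_mul, abs_of_nonneg (ind_nonneg _ _ _)]
    exact mul_le_mul_of_nonneg_left (hf v) (ind_nonneg _ _ _)
  have h2 : Bd t r i K (t ^ K * r ^ (-i)) := by
    unfold Bd
    rw [abs_of_pos (mul_pos (pow_pos h.t_pos _) (zpow_pos h.r_pos _))]
  exact (((h.deg_bd j).mul h.toScale h2).of_le (h1.trans (le_abs_self _))).mono h.toScale
    (by omega) (by omega)

lemma Model.Sv_bd (h : Model n t r lam d s W H₀) (j : Fin n) :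
    Bd t r (-2) 5 (Sv lam d W H₀ j) := sum_ind_mul_bd h h.qv_bd j

lemma Model.Uv_bd (h : Model n t r lam d s W H₀) (j : Fin n) :
    Bd t r (-2) 6 (Uv lam d W H₀ j) :=
  ((h.qv_bd j).mul h.toScale (h.deg_bd j)).add' h.toScale (h.Sv_bd j)

lemma Model.Qv_eq (h : Model n t r lam d s W H₀) :
    Qv lam d W H₀ = lam * ∑ j, deg W j - ∑ j, deg (H₀ ⊓ W) j := by
  simp only [Qv, qv, sum_add_distrib, sum_sub_distrib, h.d_sum, ← mul_sum]
  simp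
  ring

lemma Model.Qv_bd (h : Model n t r lam d s W H₀) : Bd t r (-2) 3 (Qv lam d W H₀) := by
  have h1 := h.sparse.sum_le
  have h2 : ∑ j, deg (H₀ ⊓ W) j ≤ ∑ j, deg W j := sum_le_sum fun j _ => deg_inf_le H₀ W j
  have h3 : 0 ≤ ∑ j, deg (H₀ ⊓ W) j := sum_nonneg fun j _ => deg_nonneg _ j
  have h4 : (0 : ℝ) ≤ s := Nat.cast_nonneg s
  have h5 := h.lam_pos
  have h6 := h.lam_lt
  rw [h.Qv_eq, Bd, neg_neg]
  have : r ^ (2 : ℤ) = r ^ 2 := by norm_cast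
  rw [this, abs_le]
  constructor <;> nlinarith

lemma Model.card_common_ge (h : Model n t r lam d s W H₀) {j k : Fin n} (hjk : j ≠ k) :
    (n : ℝ) ≤ 2 * #(common W j k) := by
  have h1 := card_common_add_card_bad (W := W) hjk
  have h2 := (h.card_bad j k).le
  rw [neg_neg, zpow_one] at h2
  have h3 := h.n_le (K := 4) (by norm_num)
  have ht := h.ht
  have hr := h.one_le_r
  have : 1 ≤ r * t ^ 3 := one_le_mul_of_one_le_of_one_le hr (one_le_pow₀ h.one_le_t)
  nlinarith

lemma Model.inv_card_common (h : Model n t r lam d s W H₀) {j k : Fin n} (hjk : j ≠ k) :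
    Bd t r 2 1 (1 / (#(common W j k) : ℝ)) := by
  have hn := h.n_pos
  have hr := h.r_pos
  refine Bd.inv_of_ge (half_pos hn) (by linarith [h.card_common_ge hjk]) ?_
  rw [h.hn, pow_one, zpow_neg, inv_div, div_eq_mul_inv]
  have : r ^ (2 : ℤ) = r ^ 2 := by norm_cast
  rw [this]
  gcongr
  linarith [h.ht]

lemma Model.n_sub_card_common (h : Model n t r lam d s W H₀) {j k : Fin n} (hjk : j ≠ k) :
    Bd t r (-1) 4 ((n : ℝ) - #(common W j k)) := by
  have e : (n : ℝ) - #(common W j k) = #(bad W j k) + 2 := by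
    linarith [card_common_add_card_bad (W := W) hjk]
  rw [e]
  exact (h.card_bad j k).add' h.toScale (Bd.const h.toScale (by norm_num : |(2 : ℝ)| ≤ 1000))

end Bounds

lemma Model.approx_lam (h : Model n t r lam d (s + 8) W H₀) :
    Approx d W H₀ (fixOn W H₀ fun _ _ => lam) (t ^ 13 * r ^ (-1 : ℤ)) := by
  refine approx_of_pr (mul_pos (pow_pos h.t_pos _) (zpow_pos h.r_pos _)).le
    (fun a b hab => if_pos hab) fun a b hab hW L hL hn H hH => ?_
  rw [fixOn_of_not hW]
  exact (h.sup_pairs hH hL).pr_sub_lam hab hn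

lemma Model.pr_sub_pr_first (h : Model n t r lam d (s + 8) W H₀) {j k l : Fin n} (hjk : j ≠ k)
    (hl : l ∈ common W j k) :
    Bd t r 2 38 (pr d W H₀ j l - pr d W H₀ k l -
      (qv lam d W H₀ j - qv lam d W H₀ k) * (1 / n)) := by
  have hl' := mem_common.1 hl
  have hn := h.n_pos
  have ha := h.card_common_ge hjk
  have hm : 0 < lam * (1 - lam) := mul_pos h.lam_pos h.lam_lt
  obtain ⟨hf0, hf1⟩ := fixOn_mem (W := W) (H₀ := H₀) (g := fun _ _ => lam)
    (fun _ _ => h.lam_pos.le) (fun _ _ => by linarith [h.lam_lt])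
  have hsz : sz (fixOn W H₀ fun _ _ => lam) W j k =
      #(common W j k) * (2 * (lam * (1 - lam))) := by
    rw [sz_fixOn]
    simp only [sg, sum_const, nsmul_eq_mul]
    ring
  have hsg : sg (fixOn W H₀ fun _ _ => lam) j k l = 2 * (lam * (1 - lam)) := by
    rw [sg, fixOn_of_not hl'.2.2.1, fixOn_of_not hl'.2.2.2]; ring
  have hdz : dz (fixOn W H₀ fun _ _ => lam) d W j k = qv lam d W H₀ j - qv lam d W H₀ k := by
    rw [dz_fixOn (fun _ _ => rfl) hjk]
    simp only [← sum_mul, qv, deg]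
    simp
    ring
  have hc : (0 : ℝ) < #(common W j k) := by linarith
  have hz : Bd t r 2 3 (1 / sz (fixOn W H₀ fun _ _ => lam) W j k) := by
    have e : 1 / sz (fixOn W H₀ fun _ _ => lam) W j k =
        (1 / 2) * (1 / (#(common W j k) : ℝ) * (1 / (lam * (1 - lam)))) := by
      rw [hsz]; field_simp
    rw [e]
    exact (Bd.one (by norm_num [abs_le]) : Bd t r 0 0 ((1 : ℝ) / 2)).mul' h.toScale
      ((h.inv_card_common hjk).mul h.toScale h.inv_lam_mul_bd)
  have key := h.step (i := 1) (K := 13) (by norm_num) hf0 hf1 h.approx_lam hjk hl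
    (by rw [hsz]; positivity) hz
  have h2 : Bd t r 2 20 ((qv lam d W H₀ j - qv lam d W H₀ k) * (((n : ℝ) - #(common W j k)) *
      (1 / (#(common W j k) : ℝ) * (1 / n)))) :=
    ((h.qv_bd j).sub' (i'' := -1) (K'' := 4) h.toScale (h.qv_bd k)).mul' h.toScale
      ((h.n_sub_card_common hjk).mul h.toScale ((h.inv_card_common hjk).mul h.toScale
        (Bd.inv_n h.toScale)))
  have h3 := key.add' (i'' := 2) (K'' := 38) h.toScale h2
  convert h3 using 1
  have hl0 := h.lam_pos.ne'
  have hl1 := h.lam_lt.ne'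
  rw [hsz, hsg, hdz]
  field_simp
  ring

/-- The first order approximation of the edge probabilities. -/
def first (lam : ℝ) (d : Fin n → ℝ) (W H₀ : SimpleGraph (Fin n)) (a b : Fin n) : ℝ :=
  lam + (qv lam d W H₀ a + qv lam d W H₀ b) * (1 / n)

lemma Model.pr_sub_first (h : Model n t r lam d (s + 8) W H₀) {j l : Fin n} (hjl : j ≠ l)
    (hW : ¬ W.Adj j l) : Bd t r 2 39 (pr d W H₀ j l - first lam d W H₀ j l) := by
  have hn := h.n_pos
  have e0 : first lam d W H₀ j l = first lam d W H₀ l j := by unfold first; ring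
  rw [pr_symm, e0]
  refine h.uniformize (l := l) (η := fun j => pr d W H₀ l j - first lam d W H₀ l j)
    (fun j hj k hk hjk => ?_) ?_ (mem_allowed.2 ⟨hjl, fun h => hW h.symm⟩)
  · have := h.pr_sub_pr_first hjk (mem_common_of_allowed hj hk)
    rw [pr_symm, pr_symm k] at this
    convert this using 1
    unfold first
    ring
  · have e : ∑ j ∈ allowed W l, (pr d W H₀ l j - first lam d W H₀ l j) =
        qv lam d W H₀ l * (2 + deg W l) * (1 / n) + (Sv lam d W H₀ l - Qv lam d W H₀) * (1 / n) := by
      rw [sum_sub_distrib, sum_allowed_pr h]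
      simp only [first, sum_add_distrib, sum_const, nsmul_eq_mul, ← sum_mul]
      rw [sum_allowed', card_allowed]
      have e1 : d l - deg (H₀ ⊓ W) l = qv lam d W H₀ l + lam * (n - 1 - deg W l) := by
        unfold qv; ring
      rw [e1, Sv, Qv]
      field_simp
      ring
    rw [e]
    have h1 : Bd t r (-1) 3 (2 + deg W l) :=
      (Bd.const h.toScale (by norm_num : |(2 : ℝ)| ≤ 1000)).add' h.toScale (h.deg_bd l)
    exact (((h.qv_bd l).mul h.toScale h1).mul h.toScale (Bd.inv_n h.toScale)).add' h.toScale
      (((h.Sv_bd l).sub' (i'' := -2) (K'' := 6) h.toScale h.Qv_bd).mul h.toScale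
        (Bd.inv_n h.toScale))

end DegreeSeq

namespace DegreeSeq

variable {n : ℕ} {t r lam : ℝ} {d : Fin n → ℝ} {W H₀ : SimpleGraph (Fin n)} {s : ℕ}

lemma deg_mono {H T : SimpleGraph (Fin n)} (h : H ≤ T) (v : Fin n) : deg H v ≤ deg T v := by
  rw [deg_eq_card, deg_eq_card]
  exact_mod_cast card_le_card fun u hu => by
    simp only [mem_filter, mem_univ, true_and] at hu ⊢
    exact h hu

lemma abs_qv_sup_pairs_sub (h0 : 0 ≤ lam) (h1 : lam ≤ 1) {H : SimpleGraph (Fin n)}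
    (hH : H ⊓ W = H₀ ⊓ W) {L : List (Fin n × Fin n)} (hL : L.length ≤ 4) (v : Fin n) :
    |qv lam d (W ⊔ pairs L) H v - qv lam d W H₀ v| ≤ 16 := by
  have hL' : (L.length : ℝ) ≤ 4 := by exact_mod_cast hL
  have a1 := deg_pairs_le L v
  have a2 := deg_sup_le W (pairs L) v
  have a3 : deg W v ≤ deg (W ⊔ pairs L) v := deg_mono le_sup_left v
  have a4 : deg (H ⊓ W) v ≤ deg (H ⊓ (W ⊔ pairs L)) v :=
    deg_mono (inf_le_inf_left _ le_sup_left) v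
  have a5 : deg (H ⊓ (W ⊔ pairs L)) v ≤ deg (H ⊓ W) v + deg (pairs L) v := by
    rw [inf_sup_left]
    exact (deg_sup_le _ _ v).trans (by linarith [deg_inf_le H (pairs L) v])
  rw [hH] at a4 a5
  unfold qv
  rw [abs_le]
  constructor <;> nlinarith

lemma Model.first_mem (h : Model n t r lam d s W H₀) (a b : Fin n) :
    0 ≤ first lam d W H₀ a b ∧ first lam d W H₀ a b ≤ 1 := by
  have hn := h.n_pos
  have ht := h.t_pos
  have key : |(qv lam d W H₀ a + qv lam d W H₀ b) * (1 / n)| ≤ 1 / t := by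
    have h1 := ((h.qv_bd a).add' (i'' := -1) (K'' := 4) h.toScale (h.qv_bd b))
    unfold Bd at h1
    rw [neg_neg, zpow_one] at h1
    have h2 := h.n_le (K := 5) (by norm_num)
    rw [abs_mul, abs_of_pos (one_div_pos.2 hn), mul_one_div, div_le_div_iff₀ hn ht, one_mul]
    calc _ ≤ t ^ 4 * r * t := by gcongr
      _ = r * t ^ 5 := by ring
      _ ≤ n := h2
  have := abs_le.1 key
  have h1 := h.lam_ge
  have h2 := h.lam_le
  unfold first
  constructor <;> linarith

lemma Model.approx_first (h : Model n t r lam d (s + 16) W H₀) :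
    Approx d W H₀ (fixOn W H₀ (first lam d W H₀)) (t ^ 40 * r ^ (-2 : ℤ)) := by
  refine approx_of_pr (mul_pos (pow_pos h.t_pos _) (zpow_pos h.r_pos _)).le
    (fun a b hab => if_pos hab) fun a b hab hW L hL hn H hH => ?_
  rw [fixOn_of_not hW]
  have h1 := (h.sup_pairs (s := s + 8) hH hL).pr_sub_first hab hn
  have hc : ∀ v, Bd t r 0 1 (qv lam d (W ⊔ pairs L) H v - qv lam d W H₀ v) := fun v =>
    Bd.const h.toScale ((abs_qv_sup_pairs_sub h.lam_pos.le (by linarith [h.lam_lt])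
      (mem_cls.1 hH).2 hL v).trans (by norm_num))
  have h2 := ((hc a).add' (i'' := 0) (K'' := 2) h.toScale (hc b)).mul h.toScale
    (Bd.inv_n h.toScale)
  have h3 := h1.add' (i'' := 2) (K'' := 40) h.toScale h2
  unfold Bd at h3
  convert h3 using 2
  unfold first
  ring

lemma dz_first {j k : Fin n} (hjk : j ≠ k) (hn : (n : ℝ) ≠ 0) :
    dz (fixOn W H₀ (first lam d W H₀)) d W j k =
      (qv lam d W H₀ j - qv lam d W H₀ k) * ((#(common W j k) + 2) * (1 / n)) +
      (Uv lam d W H₀ j - Uv lam d W H₀ k) * (1 / n) := by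
  have e0 : ∀ a b, first lam d W H₀ a b = first lam d W H₀ b a := fun a b => by
    unfold first; ring
  have e1 : ∀ v, d v - deg (H₀ ⊓ W) v = qv lam d W H₀ v + lam * (n - 1 - deg W v) := fun v => by
    unfold qv; ring
  have e2 : ∀ v, ∑ m, first lam d W H₀ v m = lam * n + qv lam d W H₀ v +
      Qv lam d W H₀ * (1 / n) := fun v => by
    simp only [first, sum_add_distrib, ← sum_mul, sum_const, nsmul_eq_mul, card_univ,
      Fintype.card_fin, Qv]
    field_simp
    ring
  have e3 : ∀ v, ∑ m, ind W v m * first lam d W H₀ v m = lam * deg W v +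
      Uv lam d W H₀ v * (1 / n) := fun v => by
    have : ∀ m, ind W v m * first lam d W H₀ v m = lam * ind W v m +
        (qv lam d W H₀ v * ind W v m + ind W v m * qv lam d W H₀ m) * (1 / n) := fun m => by
      unfold first; ring
    simp only [this, sum_add_distrib, ← sum_mul, ← mul_sum, Uv, Sv, deg]
  have e4 : ∑ m ∈ common W j k, (first lam d W H₀ j m - first lam d W H₀ k m) =
      #(common W j k) * ((qv lam d W H₀ j - qv lam d W H₀ k) * (1 / n)) := by
    rw [← nsmul_eq_mul, ← sum_const]
    refine sum_congr rfl fun m _ => ?_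
    unfold first; ring
  rw [dz_fixOn e0 hjk, e1, e1, e2, e2, e3, e3, e4]
  unfold first
  ring

lemma sg_first (j k l : Fin n) :
    sg (first lam d W H₀) j k l = 2 * (lam * (1 - lam)) +
      (1 - 2 * lam) * (qv lam d W H₀ j + qv lam d W H₀ k + 2 * qv lam d W H₀ l) * (1 / n) +
      -2 * ((qv lam d W H₀ j + qv lam d W H₀ l) * (1 / n) *
        ((qv lam d W H₀ k + qv lam d W H₀ l) * (1 / n))) := by
  unfold sg first; ring

lemma Model.sg_first_error (h : Model n t r lam d s W H₀) (j k l : Fin n) :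
    Bd t r 2 9 (-2 * ((qv lam d W H₀ j + qv lam d W H₀ l) * (1 / n) *
        ((qv lam d W H₀ k + qv lam d W H₀ l) * (1 / n)))) := by
  have hs := h.toScale
  have hq : ∀ a b, Bd t r (-1) 4 (qv lam d W H₀ a + qv lam d W H₀ b) := fun a b =>
    (h.qv_bd a).add' hs (h.qv_bd b)
  exact (Bd.const hs (by norm_num : |(-2 : ℝ)| ≤ 1000)).mul' hs
    (((hq j l).mul hs (Bd.inv_n hs)).mul hs ((hq k l).mul hs (Bd.inv_n hs)))

lemma Model.sum_common_qv (h : Model n t r lam d s W H₀) {j k : Fin n} (hjk : j ≠ k) :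
    Bd t r (-2) 9 (∑ m ∈ common W j k, qv lam d W H₀ m) := by
  have hs := h.toScale
  have e := sum_common_add_sum_bad (W := W) (fun m => qv lam d W H₀ m) hjk
  have h1 : Bd t r (-2) 6 (∑ m ∈ bad W j k, qv lam d W H₀ m) :=
    Bd.sum hs (fun m _ => h.qv_bd m) (h.card_bad j k)
  have h2 : ∑ m ∈ common W j k, qv lam d W H₀ m = Qv lam d W H₀ -
      (qv lam d W H₀ j + qv lam d W H₀ k) - ∑ m ∈ bad W j k, qv lam d W H₀ m := by
    unfold Qv; linarith
  rw [h2]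
  exact (h.Qv_bd.sub' (i'' := -2) (K'' := 7) hs
    ((h.qv_bd j).add' (i'' := -2) (K'' := 4) hs (h.qv_bd k))).sub' hs h1

lemma Near.kappa_bd (h : Near n t r lam d) : Bd t r 0 0 (1 - 2 * lam) :=
  Bd.one (by rw [abs_le]; constructor <;> linarith [h.lam_pos, h.lam_lt])

lemma Near.lam_mul_bd (h : Near n t r lam d) : Bd t r 0 1 (2 * (lam * (1 - lam))) :=
  Bd.const h.toScale (by
    have := h.lam_pos
    have := h.lam_lt
    rw [abs_le]; constructor <;> nlinarith)

lemma Model.sz_first (h : Model n t r lam d s W H₀) {j k : Fin n} (hjk : j ≠ k) :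
    Bd t r 0 15 (sz (fixOn W H₀ (first lam d W H₀)) W j k -
      (2 * (lam * (1 - lam)) * #(common W j k) +
        (1 - 2 * lam) * (qv lam d W H₀ j + qv lam d W H₀ k))) := by
  have hs := h.toScale
  have hn := h.n_pos
  have e : sz (fixOn W H₀ (first lam d W H₀)) W j k -
      (2 * (lam * (1 - lam)) * #(common W j k) +
        (1 - 2 * lam) * (qv lam d W H₀ j + qv lam d W H₀ k)) =
      (1 - 2 * lam) * (2 * (∑ m ∈ common W j k, qv lam d W H₀ m) * (1 / n) -
        (qv lam d W H₀ j + qv lam d W H₀ k) * (((n : ℝ) - #(common W j k)) * (1 / n))) +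
      ∑ m ∈ common W j k, (-2 * ((qv lam d W H₀ j + qv lam d W H₀ m) * (1 / n) *
        ((qv lam d W H₀ k + qv lam d W H₀ m) * (1 / n)))) := by
    rw [sz_fixOn]
    simp only [sg_first, sum_add_distrib, sum_const, nsmul_eq_mul, ← sum_mul, ← mul_sum]
    field_simp
    ring
  rw [e]
  have h1 : Bd t r (-2) 10 (2 * ∑ m ∈ common W j k, qv lam d W H₀ m) :=
    (h.sum_common_qv hjk).cmul hs 2 (by norm_num)
  have h2 : Bd t r 0 10 (2 * (∑ m ∈ common W j k, qv lam d W H₀ m) * (1 / n)) :=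
    h1.mul' hs (Bd.inv_n hs)
  have h3 : Bd t r 0 10 ((qv lam d W H₀ j + qv lam d W H₀ k) *
      (((n : ℝ) - #(common W j k)) * (1 / n))) :=
    ((h.qv_bd j).add' (i'' := -1) (K'' := 4) hs (h.qv_bd k)).mul' hs
      ((h.n_sub_card_common hjk).mul hs (Bd.inv_n hs))
  exact (h.kappa_bd.mul hs (h2.sub' (i'' := 0) (K'' := 11) hs h3)).add' hs
    (Bd.sum hs (fun m _ => h.sg_first_error j k m) (Bd.card hs _))

lemma Model.sz_first_ge (h : Model n t r lam d s W H₀) {j k : Fin n} (hjk : j ≠ k) :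
    n / (4 * t) ≤ sz (fixOn W H₀ (first lam d W H₀)) W j k := by
  have hs := h.toScale
  have hn := h.n_pos
  have ht := h.t_pos
  have h1 := (h.sz_first hjk).mono hs (show (-1 : ℤ) ≤ 0 by norm_num) le_rfl
  have h2 := h.kappa_bd.mul hs ((h.qv_bd j).add' (i'' := -1) (K'' := 4) hs (h.qv_bd k))
  have h3 := h1.add' (i'' := -1) (K'' := 16) hs h2
  rw [sub_add_eq_sub_sub, sub_add_cancel] at h3
  have h4 := (abs_le.1 h3).1
  rw [neg_neg, zpow_one] at h4
  have h5 := h.n_le (K := 18) (by norm_num)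
  have h6 := h.lam_mul_ge
  have h7 := h.card_common_ge hjk
  have h8 : t ^ 16 * r ≤ n / (4 * t) := by
    rw [le_div_iff₀ (by positivity)]
    have : t ^ 16 * r * (4 * t) = r * t ^ 17 * 4 := by ring
    have h9 : r * t ^ 18 = r * t ^ 17 * t := by ring
    have : 0 < r * t ^ 17 := mul_pos h.r_pos (pow_pos ht _)
    nlinarith [h.ht]
  have h9 : n / (2 * t) ≤ 2 * (lam * (1 - lam)) * #(common W j k) := by
    calc n / (2 * t) = 1 / (2 * t) * n := by ring
      _ ≤ (lam * (1 - lam)) * (2 * #(common W j k)) := by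
        gcongr
        exact (one_div_pos.2 (by positivity)).le.trans h6
      _ = _ := by ring
  have h10 : n / (2 * t) = n / (4 * t) + n / (4 * t) := by field_simp; norm_num
  linarith

lemma second_order_identity {lam a x b qj qk ql u e₁ e₂ c : ℝ} (hx : a * x = 1 - b * x)
    (hc : lam * (1 - lam) * c = 1 - 2 * lam) :
    (2 * (lam * (1 - lam)) + (1 - 2 * lam) * (qj + qk + 2 * ql) * x + e₁) *
      ((qj - qk) * ((a + 2) * x) + u * x) -
    ((qj - qk) * x + c * (qj - qk) * ql * x ^ 2 + u * x ^ 2) *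
      (2 * (lam * (1 - lam)) * a + (1 - 2 * lam) * (qj + qk) + e₂) =
    2 * (2 * (lam * (1 - lam))) * ((qj - qk) * x) + 2 * (lam * (1 - lam)) * (u * b * x ^ 2) +
      (1 - 2 * lam) * ((qj + qk + 2 * ql) * (qj - qk) * x ^ 2) * (2 - b) +
      (1 - 2 * lam) * ((qj + qk + 2 * ql) * u * x ^ 2) +
      e₁ * ((qj - qk) * ((a + 2) * x) + u * x) +
      2 * (1 - 2 * lam) * ((qj - qk) * ql * x ^ 2 * b) -
      (1 - 2 * lam) * (qj + qk) * (c * (qj - qk) * ql * x ^ 2 + u * x ^ 2) -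
      e₂ * ((qj - qk) * x + c * (qj - qk) * ql * x ^ 2 + u * x ^ 2) := by
  linear_combination
    ((1 - 2 * lam) * (qj + qk + 2 * ql) * x * (qj - qk) + 2 * (lam * (1 - lam)) * (qj - qk) -
      2 * (lam * (1 - lam)) * ((qj - qk) + c * (qj - qk) * ql * x + u * x)) * hx -
    2 * (qj - qk) * ql * x * (1 - b * x) * hc

/-- The coefficient of the product of two deviations. -/
def cq (lam : ℝ) : ℝ := (1 - 2 * lam) * (1 / (lam * (1 - lam)))

lemma Near.cq_bd (h : Near n t r lam d) : Bd t r 0 2 (cq lam) :=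
  h.kappa_bd.mul' h.toScale h.inv_lam_mul_bd

lemma Model.pr_sub_pr_second (h : Model n t r lam d (s + 16) W H₀) {j k l : Fin n} (hjk : j ≠ k)
    (hl : l ∈ common W j k) :
    Bd t r 3 65 (pr d W H₀ j l - pr d W H₀ k l -
      ((qv lam d W H₀ j - qv lam d W H₀ k) * (1 / n) +
        cq lam * (qv lam d W H₀ j - qv lam d W H₀ k) * qv lam d W H₀ l * (1 / n) ^ 2 +
        (Uv lam d W H₀ j - Uv lam d W H₀ k) * (1 / n) ^ 2)) := by
  have hs := h.toScale
  have hl' := mem_common.1 hl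
  have hn := h.n_pos
  have hm : 0 < lam * (1 - lam) := mul_pos h.lam_pos h.lam_lt
  obtain ⟨hf0, hf1⟩ := fixOn_mem (W := W) (H₀ := H₀) (g := first lam d W H₀)
    (fun a b => (h.first_mem a b).1) (fun a b => (h.first_mem a b).2)
  have hszge := h.sz_first_ge hjk
  have hsz0 : 0 < sz (fixOn W H₀ (first lam d W H₀)) W j k :=
    lt_of_lt_of_le (div_pos hn (by linarith [h.t_pos])) hszge
  have hz : Bd t r 2 3 (1 / sz (fixOn W H₀ (first lam d W H₀)) W j k) := by
    refine Bd.inv_of_ge (div_pos hn (by linarith [h.t_pos])) hszge ?_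
    have ht := h.t_pos
    have hr := h.r_pos
    have e : r ^ (-2 : ℤ) = 1 / r ^ 2 := by
      rw [zpow_neg, one_div]; norm_cast
    rw [inv_div, h.hn, e, mul_one_div]
    gcongr
    have ht1 := h.one_le_t
    have ht2 := h.ht
    have : 4 ≤ t ^ 2 := by nlinarith
    calc 4 * t ≤ t ^ 2 * t := by gcongr
      _ = t ^ 3 := by ring
  have key := h.step (i := 2) (K := 40) (by norm_num) hf0 hf1 h.approx_first hjk hl hsz0.ne' hz
  have hsg : sg (fixOn W H₀ (first lam d W H₀)) j k l = sg (first lam d W H₀) j k l := by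
    rw [sg, sg, fixOn_of_not hl'.2.2.1, fixOn_of_not hl'.2.2.2]
  set z := sz (fixOn W H₀ (first lam d W H₀)) W j k with hz_def
  set e₂ := z - (2 * (lam * (1 - lam)) * #(common W j k) +
        (1 - 2 * lam) * (qv lam d W H₀ j + qv lam d W H₀ k)) with he₂
  have hb2 : Bd t r 0 15 e₂ := h.sz_first hjk
  set e₁ := -2 * ((qv lam d W H₀ j + qv lam d W H₀ l) * (1 / n) *
        ((qv lam d W H₀ k + qv lam d W H₀ l) * (1 / n))) with he₁
  have hb1 : Bd t r 2 9 e₁ := h.sg_first_error j k l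
  have hx : (#(common W j k) : ℝ) * (1 / n) = 1 - ((n : ℝ) - #(common W j k)) * (1 / n) := by
    field_simp; ring
  have hid := second_order_identity (e₁ := e₁) (e₂ := e₂) (qj := qv lam d W H₀ j)
    (qk := qv lam d W H₀ k) (ql := qv lam d W H₀ l)
    (u := Uv lam d W H₀ j - Uv lam d W H₀ k) hx
    (show lam * (1 - lam) * cq lam = 1 - 2 * lam by
      rw [cq, mul_left_comm, mul_one_div_cancel hm.ne', mul_one])
  have hze : 2 * (lam * (1 - lam)) * #(common W j k) +
        (1 - 2 * lam) * (qv lam d W H₀ j + qv lam d W H₀ k) + e₂ = z := by rw [he₂]; ring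
  rw [hze] at hid
  rw [hsg, sg_first, ← he₁, dz_first hjk hn.ne'] at key
  set A := (2 * (lam * (1 - lam)) + (1 - 2 * lam) * (qv lam d W H₀ j + qv lam d W H₀ k +
    2 * qv lam d W H₀ l) * (1 / n) + e₁) *
      ((qv lam d W H₀ j - qv lam d W H₀ k) * ((#(common W j k) + 2) * (1 / n)) +
      (Uv lam d W H₀ j - Uv lam d W H₀ k) * (1 / n)) with hA
  have hκ := h.kappa_bd
  have hx1 : Bd t r 2 0 (1 / (n : ℝ)) := Bd.inv_n hs
  have hx2 : Bd t r 4 0 ((1 / (n : ℝ)) ^ 2) := by rw [pow_two]; exact hx1.mul hs hx1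
  have hq := h.qv_bd
  have hb := h.n_sub_card_common hjk
  have hcq := h.cq_bd
  have hΔ : Bd t r (-1) 4 (qv lam d W H₀ j - qv lam d W H₀ k) := (hq j).sub' hs (hq k)
  have hσ : Bd t r (-1) 5 (qv lam d W H₀ j + qv lam d W H₀ k) := (hq j).add' hs (hq k)
  have hσ2 : Bd t r (-1) 6 (qv lam d W H₀ j + qv lam d W H₀ k + 2 * qv lam d W H₀ l) :=
    hσ.add' hs ((hq l).cmul hs 2 (by norm_num))
  have hu : Bd t r (-2) 7 (Uv lam d W H₀ j - Uv lam d W H₀ k) :=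
    (h.Uv_bd j).sub' hs (h.Uv_bd k)
  have h2b : Bd t r (-1) 5 (2 - ((n : ℝ) - #(common W j k))) :=
    (Bd.const hs (by norm_num : |(2 : ℝ)| ≤ 1000)).sub' hs hb
  have hlam : Bd t r 0 2 (2 * (2 * (lam * (1 - lam)))) := h.lam_mul_bd.cmul hs 2 (by norm_num)
  have ha2 : Bd t r 0 2 (((#(common W j k) : ℝ) + 2) * (1 / n)) :=
    ((Bd.card hs (common W j k)).add' (i'' := -2) (K'' := 2) hs
      (Bd.const hs (by norm_num : |(2 : ℝ)| ≤ 1000))).mul' hs hx1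
  set x := (1 : ℝ) / n with hxdef
  set b := (n : ℝ) - #(common W j k) with hbdef
  set qj := qv lam d W H₀ j
  set qk := qv lam d W H₀ k
  set ql := qv lam d W H₀ l
  set u := Uv lam d W H₀ j - Uv lam d W H₀ k
  set c := cq lam
  have hcx : Bd t r 2 9 (c * (qj - qk) * ql * x ^ 2) :=
    (((hcq.mul hs hΔ).mul hs (hq l)).mul' hs hx2)
  have hux : Bd t r 2 7 (u * x ^ 2) := hu.mul' hs hx2
  have hcu : Bd t r 2 10 (c * (qj - qk) * ql * x ^ 2 + u * x ^ 2) := hcx.add' hs hux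
  have hT : Bd t r 1 11 ((qj - qk) * x + c * (qj - qk) * ql * x ^ 2 + u * x ^ 2) := by
    rw [add_assoc]
    exact (hΔ.mul hs hx1).add' hs hcu
  have t1 : Bd t r 1 6 (2 * (2 * (lam * (1 - lam))) * ((qj - qk) * x)) :=
    hlam.mul' hs (hΔ.mul hs hx1)
  have t2 : Bd t r 1 12 (2 * (lam * (1 - lam)) * (u * b * x ^ 2)) :=
    h.lam_mul_bd.mul' hs ((hu.mul hs hb).mul hs hx2)
  have t3 : Bd t r 1 15 ((1 - 2 * lam) * ((qj + qk + 2 * ql) * (qj - qk) * x ^ 2) * (2 - b)) :=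
    (hκ.mul hs ((hσ2.mul hs hΔ).mul hs hx2)).mul' hs h2b
  have t4 : Bd t r 1 13 ((1 - 2 * lam) * ((qj + qk + 2 * ql) * u * x ^ 2)) :=
    hκ.mul' hs ((hσ2.mul hs hu).mul hs hx2)
  have hdz : Bd t r (-1) 10 ((qj - qk) * ((#(common W j k) + 2) * x) + u * x) :=
    (hΔ.mul hs ha2).add' hs (hu.mul hs hx1)
  have t5 := hb1.mul' (i'' := 1) (K'' := 19) hs hdz
  have t6 : Bd t r 1 12 (2 * (1 - 2 * lam) * ((qj - qk) * ql * x ^ 2 * b)) :=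
    (hκ.cmul hs 2 (by norm_num)).mul' hs (((hΔ.mul hs (hq l)).mul hs hx2).mul hs hb)
  have t7 : Bd t r 1 15 ((1 - 2 * lam) * (qj + qk) *
      (c * (qj - qk) * ql * x ^ 2 + u * x ^ 2)) := (hκ.mul hs hσ).mul' hs hcu
  have t8 := hb2.mul' (i'' := 1) (K'' := 26) hs hT
  have tot := (((((((t1.add' (i'' := 1) (K'' := 13) hs t2).add' (i'' := 1) (K'' := 16) hs
    t3).add' (i'' := 1) (K'' := 17) hs t4).add' (i'' := 1) (K'' := 20) hs t5).add'
    (i'' := 1) (K'' := 21) hs t6).sub' (i'' := 1) (K'' := 22) hs t7).sub'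
    (i'' := 1) (K'' := 27) hs t8)
  rw [← hid] at tot
  have h3 := key.add' (i'' := 3) (K'' := 65) hs (tot.mul hs hz)
  convert h3 using 1
  field_simp
  ring

/-- The second order approximation of the edge probabilities. -/
def second (lam : ℝ) (d : Fin n → ℝ) (W H₀ : SimpleGraph (Fin n)) (a b : Fin n) : ℝ :=
  lam + (qv lam d W H₀ a + qv lam d W H₀ b) * (1 / n) +
    cq lam * qv lam d W H₀ a * qv lam d W H₀ b * (1 / n) ^ 2 +
    (Uv lam d W H₀ a + Uv lam d W H₀ b - Qv lam d W H₀) * (1 / n) ^ 2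

lemma sum_Sv : ∑ j, Sv lam d W H₀ j = ∑ j, qv lam d W H₀ j * deg W j := by
  simp only [Sv, deg, mul_sum]
  rw [sum_comm]
  exact sum_congr rfl fun j _ => sum_congr rfl fun k _ => by rw [ind_symm]; ring

lemma Model.sum_Uv_bd (h : Model n t r lam d s W H₀) : Bd t r (-3) 7 (∑ j, Uv lam d W H₀ j) := by
  have hs := h.toScale
  have e : ∑ j, Uv lam d W H₀ j = 2 * ∑ j, qv lam d W H₀ j * deg W j := by
    simp only [Uv, sum_add_distrib, sum_Sv]; ring
  rw [e]
  refine Bd.cmul hs 2 (by norm_num) ?_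
  refine (abs_sum_le_sum_abs _ _).trans ?_
  have h0 := h.t_pos
  have h1 := h.r_pos
  calc ∑ j, |qv lam d W H₀ j * deg W j| ≤ ∑ j, t ^ 3 * r * deg W j := by
        refine sum_le_sum fun j _ => ?_
        rw [abs_mul, abs_of_nonneg (deg_nonneg W j)]
        refine mul_le_mul_of_nonneg_right ?_ (deg_nonneg W j)
        have := h.qv_bd j
        rwa [Bd, neg_neg, zpow_one] at this
    _ = t ^ 3 * r * ∑ j, deg W j := by rw [mul_sum]
    _ ≤ t ^ 3 * r * (r ^ 2 * t ^ 3) := by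
        have := h.sparse.sum_le
        have : (0 : ℝ) ≤ s := Nat.cast_nonneg s
        gcongr
        linarith
    _ = t ^ 6 * r ^ (-(-3) : ℤ) := by
        have : r ^ (-(-3) : ℤ) = r ^ 3 := by norm_cast
        rw [this]; ring

theorem Model.pr_sub_second (h : Model n t r lam d (s + 16) W H₀) {j l : Fin n} (hjl : j ≠ l)
    (hW : ¬ W.Adj j l) : Bd t r 3 66 (pr d W H₀ j l - second lam d W H₀ j l) := by
  have hn := h.n_pos
  have hs := h.toScale
  have e0 : second lam d W H₀ j l = second lam d W H₀ l j := by unfold second; ring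
  rw [pr_symm, e0]
  refine h.uniformize (l := l) (η := fun j => pr d W H₀ l j - second lam d W H₀ l j)
    (fun j hj k hk hjk => ?_) ?_ (mem_allowed.2 ⟨hjl, fun h => hW h.symm⟩)
  · have := h.pr_sub_pr_second hjk (mem_common_of_allowed hj hk)
    rw [pr_symm, pr_symm k] at this
    convert this using 1
    unfold second
    ring
  · have e : ∑ j ∈ allowed W l, (pr d W H₀ l j - second lam d W H₀ l j) =
        2 * (qv lam d W H₀ l * (1 / n)) +
        (1 + deg W l) * (Uv lam d W H₀ l - Qv lam d W H₀) * (1 / n) ^ 2 -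
        cq lam * qv lam d W H₀ l * (1 / n) ^ 2 *
          (Qv lam d W H₀ - qv lam d W H₀ l - Sv lam d W H₀ l) -
        (∑ j, Uv lam d W H₀ j - Uv lam d W H₀ l - ∑ j, ind W l j * Uv lam d W H₀ j) *
          (1 / n) ^ 2 := by
      rw [sum_sub_distrib, sum_allowed_pr h]
      simp only [second, sum_add_distrib, sum_sub_distrib, sum_const, nsmul_eq_mul, ← sum_mul,
        ← mul_sum]
      rw [sum_allowed', sum_allowed', card_allowed]
      have e1 : d l - deg (H₀ ⊓ W) l = qv lam d W H₀ l + lam * (n - 1 - deg W l) := by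
        unfold qv; ring
      have e2 : Uv lam d W H₀ l = qv lam d W H₀ l * deg W l + Sv lam d W H₀ l := rfl
      have e3 : ∑ v, ind W l v * qv lam d W H₀ v = Sv lam d W H₀ l := rfl
      have e4 : ∑ v, qv lam d W H₀ v = Qv lam d W H₀ := rfl
      rw [e1, e3, e4]
      generalize ∑ v, ind W l v * Uv lam d W H₀ v = y
      generalize ∑ v, Uv lam d W H₀ v = y'
      rw [e2]
      field_simp
      ring
    rw [e]
    have hx1 : Bd t r 2 0 (1 / (n : ℝ)) := Bd.inv_n hs
    have hx2 : Bd t r 4 0 ((1 / (n : ℝ)) ^ 2) := by rw [pow_two]; exact hx1.mul hs hx1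
    have h1 : Bd t r (-1) 3 (1 + deg W l) :=
      (Bd.const hs (by norm_num : |(1 : ℝ)| ≤ 1000)).add' hs (h.deg_bd l)
    have h2 : Bd t r (-2) 7 (Uv lam d W H₀ l - Qv lam d W H₀) := (h.Uv_bd l).sub' hs h.Qv_bd
    have h3 : Bd t r (-2) 6 (Qv lam d W H₀ - qv lam d W H₀ l - Sv lam d W H₀ l) :=
      (h.Qv_bd.sub' (i'' := -2) (K'' := 5) hs (h.qv_bd l)).sub' hs (h.Sv_bd l)
    have h4 : Bd t r (-3) 9 (∑ j, Uv lam d W H₀ j - Uv lam d W H₀ l -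
        ∑ j, ind W l j * Uv lam d W H₀ j) :=
      (h.sum_Uv_bd.sub' (i'' := -3) (K'' := 8) hs (h.Uv_bd l)).sub' hs
        (sum_ind_mul_bd h h.Uv_bd l)
    have s1 : Bd t r 1 4 (2 * (qv lam d W H₀ l * (1 / n))) :=
      ((h.qv_bd l).mul hs hx1).cmul hs 2 (by norm_num)
    have s2 := (h1.mul hs h2).mul hs hx2
    have s3 := ((h.cq_bd.mul hs (h.qv_bd l)).mul hs hx2).mul hs h3
    have s4 := h4.mul hs hx2
    exact ((s1.add' (i'' := 1) (K'' := 11) hs s2).sub' (i'' := 1) (K'' := 13) hs s3).sub' hs s4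

end DegreeSeq

namespace DegreeSeq

variable {n : ℕ} {t r lam : ℝ} {d : Fin n → ℝ}

/-- Replace the edge `av` by the edge `bv`. -/
def moveEdge (a b v : Fin n) (H : SimpleGraph (Fin n)) : SimpleGraph (Fin n) :=
  (H \ SimpleGraph.edge a v) ⊔ SimpleGraph.edge b v

lemma ind_edge {a b : Fin n} (h : a ≠ b) (x y : Fin n) : ind (SimpleGraph.edge a b) x y =
    (if x = a then if y = b then 1 else 0 else 0) +
      if x = b then if y = a then 1 else 0 else 0 := by
  simp only [ind, SimpleGraph.edge_adj]
  by_cases h1 : x = a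
  · subst h1; by_cases h2 : y = b <;> simp_all [eq_comm]
  · by_cases h2 : x = b
    · subst h2; by_cases h3 : y = a <;> simp_all [eq_comm]
    · simp [h1, h2]

lemma deg_edge {a b : Fin n} (h : a ≠ b) (x : Fin n) : deg (SimpleGraph.edge a b) x =
    (if x = a then 1 else 0) + if x = b then 1 else 0 := by
  simp only [deg, ind_edge h, sum_add_distrib]
  by_cases h1 : x = a <;> by_cases h2 : x = b <;> simp [h1, h2]

lemma deg_moveEdge {a b v : Fin n} {H : SimpleGraph (Fin n)} (hab : a ≠ b) (hav : H.Adj a v)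
    (hbv : ¬ H.Adj b v) (hne : b ≠ v) (x : Fin n) :
    deg (moveEdge a b v H) x = deg H x - (if x = a then 1 else 0) + if x = b then 1 else 0 := by
  have key : ∀ y, ind (moveEdge a b v H) x y = ind H x y - ind (SimpleGraph.edge a v) x y +
      ind (SimpleGraph.edge b v) x y := by
    intro y
    have h1 : (SimpleGraph.edge a v).Adj x y → H.Adj x y := by
      rw [SimpleGraph.edge_adj]
      rintro ⟨⟨rfl, rfl⟩ | ⟨rfl, rfl⟩, -⟩
      exacts [hav, hav.symm]
    have h2 : (SimpleGraph.edge b v).Adj x y → ¬ H.Adj x y := by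
      rw [SimpleGraph.edge_adj]
      rintro ⟨⟨rfl, rfl⟩ | ⟨rfl, rfl⟩, -⟩
      exacts [hbv, fun h => hbv h.symm]
    simp only [ind, moveEdge, SimpleGraph.sup_adj, SimpleGraph.sdiff_adj]
    by_cases e1 : (SimpleGraph.edge a v).Adj x y <;>
      by_cases e2 : (SimpleGraph.edge b v).Adj x y <;>
      by_cases e3 : H.Adj x y <;> simp_all
  have h1 := deg_edge hav.ne x
  have h2 := deg_edge hne x
  rw [deg] at h1 h2 ⊢
  simp only [key, sum_add_distrib, sum_sub_distrib]
  rw [h1, h2, deg]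
  ring

/-- The squared distance of the degrees of `H` from `d`. -/
def defect (d : Fin n → ℝ) (H : SimpleGraph (Fin n)) : ℝ := ∑ v, (deg H v - d v) ^ 2

lemma defect_moveEdge {a b v : Fin n} {H : SimpleGraph (Fin n)} (hab : a ≠ b) (hav : H.Adj a v)
    (hbv : ¬ H.Adj b v) (hne : b ≠ v) : defect d (moveEdge a b v H) =
      defect d H - 2 * (deg H a - d a) + 2 * (deg H b - d b) + 2 := by
  have key : ∀ x, (deg (moveEdge a b v H) x - d x) ^ 2 = (deg H x - d x) ^ 2 -
      (if x = a then 2 * (deg H x - d x) - 1 else 0) +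
      if x = b then 2 * (deg H x - d x) + 1 else 0 := by
    intro x
    rw [deg_moveEdge hab hav hbv hne]
    by_cases h1 : x = a
    · subst h1; simp [hab]; ring
    · by_cases h2 : x = b
      · subst h2; simp [h1]; ring
      · simp [h1, h2]
  simp only [defect, key, sum_add_distrib, sum_sub_distrib, sum_ite_eq', mem_univ, if_true]
  ring

lemma sum_deg_eq (H : SimpleGraph (Fin n)) : ∑ v, deg H v = 2 * #H.edgeFinset := by
  have := H.sum_degrees_eq_twice_card_edges
  have e : ∀ v, deg H v = H.degree v := fun v => by
    rw [deg_eq_card, ← SimpleGraph.card_neighborFinset_eq_degree, SimpleGraph.neighborFinset_eq_filter]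
  simp only [e]
  exact_mod_cast this

lemma exists_sum_deg_eq {e : ℕ} (he : 2 * e ≤ n * (n - 1)) :
    ∃ H : SimpleGraph (Fin n), ∑ v, deg H v = 2 * e := by
  have h1 : e ≤ #(⊤ : SimpleGraph (Fin n)).edgeFinset := by
    rw [SimpleGraph.card_edgeFinset_top_eq_card_choose_two, Fintype.card_fin, Nat.choose_two_right]
    omega
  obtain ⟨s, hs, hc⟩ := exists_subset_card_eq h1
  refine ⟨SimpleGraph.fromEdgeSet s, ?_⟩
  have h2 : (SimpleGraph.fromEdgeSet (s : Set (Sym2 (Fin n)))).edgeFinset = s := by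
    ext x
    rw [SimpleGraph.mem_edgeFinset, SimpleGraph.edgeSet_fromEdgeSet, Set.mem_sdiff, mem_coe]
    refine ⟨fun h => h.1, fun h => ⟨h, ?_⟩⟩
    have := SimpleGraph.mem_edgeFinset.1 (hs h)
    exact fun hd => SimpleGraph.not_isDiag_of_mem_edgeSet _ this hd
  rw [sum_deg_eq, ← hc]
  congr 3
  convert h2

lemma Scale.sparse_bot (h : Scale n t r) : Sparse t r 0 (⊥ : SimpleGraph (Fin n)) := by
  have h1 := h.t_pos
  have h2 := h.r_pos
  constructor
  · intro v; simp [deg, ind]; positivity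
  · simp [deg, ind]; positivity

theorem Near.exists_graph (h : Near n t r lam d) {D : Fin n → ℕ} (hD : ∀ v, d v = D v)
    (hE : Even (∑ v, D v)) : ∃ H : SimpleGraph (Fin n), ∀ v, deg H v = d v := by
  have hn := h.n_pos
  obtain ⟨e, he⟩ := hE
  have hsum : ∑ v, d v = 2 * e := by
    simp only [hD]
    rw [← Nat.cast_sum, he]; push_cast; ring
  have hn1 : 1 ≤ n := by exact_mod_cast hn
  have hle : 2 * e ≤ n * (n - 1) := by
    have h1 : (2 * e : ℝ) ≤ n * (n - 1 : ℝ) := by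
      rw [← hsum, h.d_sum]
      have h2 : (0 : ℝ) ≤ n - 1 := by
        have : (1 : ℝ) ≤ n := by exact_mod_cast hn1
        linarith
      have : (n : ℝ) * lam ≤ n := by nlinarith [h.lam_lt]
      exact mul_le_mul_of_nonneg_right this h2
    have h3 : ((n - 1 : ℕ) : ℝ) = n - 1 := by push_cast [Nat.cast_sub hn1]; ring
    rw [← h3] at h1
    exact_mod_cast h1
  obtain ⟨G, hG⟩ := exists_sum_deg_eq hle
  obtain ⟨H, hH, hmin⟩ := (univ.filter fun H : SimpleGraph (Fin n) =>
    ∑ v, deg H v = 2 * e).exists_min_image (defect d) ⟨G, by simpa using hG⟩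
  simp only [mem_filter, mem_univ, true_and] at hH hmin
  have hint : ∀ (H : SimpleGraph (Fin n)) v, d v < deg H v → d v + 1 ≤ deg H v := fun H v hv => by
    rw [hD, deg_eq_card] at *; exact_mod_cast hv
  have hint' : ∀ (H : SimpleGraph (Fin n)) v, deg H v < d v → deg H v + 1 ≤ d v := fun H v hv => by
    rw [hD, deg_eq_card] at *; exact_mod_cast hv
  have nomove : ∀ H' : SimpleGraph (Fin n), (∀ v, deg H' v = deg H v) → ∀ a b, d a < deg H a →
      deg H b < d b → ∀ v, H'.Adj a v → b ≠ v → H'.Adj b v := by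
    intro H' hH' a b ha hb v hav hbv
    by_contra hcon
    have hab : a ≠ b := by rintro rfl; linarith
    have h1 := defect_moveEdge (d := d) hab hav hcon hbv
    have h2 := hmin (moveEdge a b v H') (by
      simp only [deg_moveEdge hab hav hcon hbv, sum_add_distrib, sum_sub_distrib, hH', hH]
      simp)
    have h3 : defect d H' = defect d H := by simp only [defect, hH']
    rw [h1, h3, hH', hH'] at h2
    linarith [hint H a ha, hint' H b hb]
  by_contra hcon
  have hexc : ∃ a, d a < deg H a := by
    by_contra hc
    push Not at hc
    refine hcon ⟨H, fun v => ?_⟩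
    have := (sum_eq_sum_iff_of_le fun v _ => hc v).1 (by rw [hH, hsum])
    exact this v (mem_univ v)
  have hdef : ∃ b, deg H b < d b := by
    by_contra hc
    push Not at hc
    refine hcon ⟨H, fun v => ?_⟩
    have := (sum_eq_sum_iff_of_le fun v _ => hc v).1 (by rw [hH, hsum])
    exact (this v (mem_univ v)).symm
  obtain ⟨a, ha⟩ := hexc
  obtain ⟨b, hb⟩ := hdef
  have hdeg : ∀ a b, d a < deg H a → deg H b < d b → deg H a ≤ deg H b := by
    intro a b ha hb
    have hN := nomove H (fun _ => rfl) a b ha hb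
    have h1 : deg H a = ∑ u, ind H a (Equiv.swap a b u) :=
      (Equiv.sum_comp (Equiv.swap a b) fun u => ind H a u).symm
    rw [h1, deg]
    refine sum_le_sum fun u _ => ?_
    by_cases h2 : u = a
    · subst h2; rw [Equiv.swap_apply_left, ind_symm]
    · by_cases h3 : u = b
      · subst h3; rw [Equiv.swap_apply_right, ind_self]; exact ind_nonneg _ _ _
      · rw [Equiv.swap_apply_of_ne_of_ne h2 h3]
        by_cases h4 : H.Adj a u
        · simp [ind, h4, hN u h4 (Ne.symm h3)]
        · simp only [ind, h4, if_false]; split_ifs <;> norm_num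
  have hnear : Near n t r lam (deg H) := by
    refine ⟨h.toScale, h.lam_ge, h.lam_le, fun v => ?_, by rw [hH, ← hsum, h.d_sum]⟩
    have h1 := abs_le.1 (h.d_near v)
    have h2 := abs_le.1 (h.d_near a)
    have h3 := abs_le.1 (h.d_near b)
    rw [abs_le]
    rcases lt_trichotomy (deg H v) (d v) with h4 | h4 | h4
    · constructor <;> linarith [hdeg a v ha h4]
    · rw [h4]; exact h1
    · constructor <;> linarith [hdeg v b h4 hb]
  have hab : a ≠ b := by rintro rfl; linarith
  have hmod : Model n t r lam (deg H) 0 ⊥ H := ⟨hnear, h.sparse_bot, fun _ => rfl⟩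
  have hon : onlyCount ⊥ H a b = 0 := by
    refine sum_eq_zero fun m hm => ?_
    have hm' := mem_common.1 hm
    unfold only
    by_cases h4 : H.Adj a m
    · simp [ind, nomove H (fun _ => rfl) a b ha hb m h4 hm'.2.1.symm]
    · simp [ind, h4]
  have hsd : sdCount ⊥ H a b ≤ n / t ^ 5 := by
    have h1 := (abs_le.1 (hmod.onlyCount_sub hmod.mem hab)).1
    rw [neg_neg, zpow_one, hon] at h1
    have h2 := h.n_le (K := 10) (by norm_num)
    rw [sdCount, hon, le_div_iff₀ (pow_pos h.t_pos 5)]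
    have := pow_pos h.t_pos 5
    nlinarith
  have hfw := forwardCount_ge_of_sdCount_lt hnear hmod.sparse (fun _ => rfl) hsd
  have hpos : 0 < forwardCount ⊥ H a b := lt_of_lt_of_le (by have := h.t_pos; positivity) hfw
  obtain ⟨l, m, p, hF⟩ : ∃ l m p, Forward ⊥ H a b l m p := by
    by_contra hc
    push Not at hc
    rw [forwardCount] at hpos
    simp [hc] at hpos
  obtain ⟨hlm, hpa, hpb⟩ := hF.ne
  have hl := mem_common.1 hF.1.1
  have hm := mem_common.1 hF.2.1.1
  have hpm : p ≠ m := hF.2.2.1.ne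
  have hT := deg_toggle hF.pattern hpa.symm hlm hl.1.symm hm.1.symm hF.2.2.2.2.1 hpm
  have hadj : (toggle a p l m H).Adj a m := by
    simp [toggle, hF.2.1.2.1, hm.1.symm]
  have := nomove _ hT a b ha hb m hadj hm.2.1.symm
  simp [toggle, hF.2.1.2.2, hab.symm, hpb.symm, hl.2.1.symm, hm.2.1.symm] at this

end DegreeSeq

namespace DegreeSeq

variable {n : ℕ} {t r lam : ℝ} {d D : Fin n → ℝ} {W H₀ Y : SimpleGraph (Fin n)} {s : ℕ}

lemma deg_sup_edge {j l : Fin n} (hjl : j ≠ l) (hY : ¬ Y.Adj j l) (v : Fin n) :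
    deg (Y ⊔ SimpleGraph.edge j l) v = deg Y v + ((if v = j then 1 else 0) +
      if v = l then 1 else 0) := by
  rw [← deg_edge hjl, deg, deg, deg, ← sum_add_distrib]
  refine sum_congr rfl fun u _ => ?_
  have h2 : (SimpleGraph.edge j l).Adj v u → ¬ Y.Adj v u := by
    rw [SimpleGraph.edge_adj]
    rintro ⟨⟨rfl, rfl⟩ | ⟨rfl, rfl⟩, -⟩
    exacts [hY, fun h => hY h.symm]
  simp only [ind, SimpleGraph.sup_adj]
  by_cases e2 : (SimpleGraph.edge j l).Adj v u <;> by_cases e3 : Y.Adj v u <;> simp_all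

lemma ind_sup_edge {j l : Fin n} (hY : ¬ Y.Adj j l) (a b : Fin n) :
    ind (Y ⊔ SimpleGraph.edge j l) a b = ind Y a b + ind (SimpleGraph.edge j l) a b := by
  have h2 : (SimpleGraph.edge j l).Adj a b → ¬ Y.Adj a b := by
    rw [SimpleGraph.edge_adj]
    rintro ⟨⟨rfl, rfl⟩ | ⟨rfl, rfl⟩, -⟩
    exacts [hY, fun h => hY h.symm]
  simp only [ind, SimpleGraph.sup_adj]
  by_cases e2 : (SimpleGraph.edge j l).Adj a b <;> by_cases e3 : Y.Adj a b <;> simp_all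

lemma sum_sub_sum_pair {j l : Fin n} (hjl : j ≠ l) {g g' : Fin n → ℝ}
    (h : ∀ v, v ≠ j → v ≠ l → g' v = g v) :
    ∑ v, g' v - ∑ v, g v = (g' j - g j) + (g' l - g l) := by
  rw [← sum_sub_distrib, ← sum_pair (f := fun v => g' v - g v) hjl]
  refine (sum_subset (subset_univ _) fun v _ hv => ?_).symm
  simp only [Finset.mem_insert, Finset.mem_singleton, not_or] at hv
  rw [h v hv.1 hv.2, sub_self]

lemma sum_pair_indicator_mul (j l : Fin n) (f : Fin n → ℝ) :
    ∑ v, ((if v = j then (1 : ℝ) else 0) + if v = l then 1 else 0) * f v = f j + f l := by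
  simp [add_mul, sum_add_distrib]

/-- The sum over the edges of `Y` of the product of the deviations. -/
def edgeSum (lam : ℝ) (D : Fin n → ℝ) (Y : SimpleGraph (Fin n)) : ℝ :=
  (∑ a, ∑ b, ind Y a b * ((D a - (1 - lam) * deg Y a) * (D b - (1 - lam) * deg Y b))) / 2

lemma edgeSum_sup_edge {j l : Fin n} (hjl : j ≠ l) (hY : ¬ Y.Adj j l) :
    edgeSum lam D (Y ⊔ SimpleGraph.edge j l) = edgeSum lam D Y +
      (D j - (1 - lam) * deg Y j - (1 - lam)) * (D l - (1 - lam) * deg Y l - (1 - lam)) -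
      (1 - lam) * (∑ v, ind Y j v * (D v - (1 - lam) * deg Y v) +
        ∑ v, ind Y l v * (D v - (1 - lam) * deg Y v)) := by
  unfold edgeSum
  obtain ⟨c, hc⟩ : ∃ c, c = 1 - lam := ⟨_, rfl⟩
  simp only [← hc]
  set q : Fin n → ℝ := fun v => D v - c * deg Y v with hq
  set η : Fin n → ℝ := fun v => (if v = j then (1 : ℝ) else 0) + if v = l then 1 else 0 with hη
  have hq' : ∀ v, D v - c * deg (Y ⊔ SimpleGraph.edge j l) v = q v - c * η v := fun v => by
    rw [deg_sup_edge hjl hY, hq, hη]; ring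
  have hs : ∀ f : Fin n → ℝ, ∑ v, η v * f v = f j + f l := sum_pair_indicator_mul j l
  have e1 : ∑ a, ∑ b, ind (SimpleGraph.edge j l) a b * ((q a - c * η a) * (q b - c * η b)) =
      2 * ((q j - c) * (q l - c)) := by
    have h1 : η j = 1 := by simp [hη, hjl]
    have h2 : η l = 1 := by simp [hη, hjl.symm]
    simp only [ind_edge hjl, add_mul, sum_add_distrib, ite_mul, zero_mul, one_mul]
    have : ∀ (a b : Fin n) (f : Fin n → Fin n → ℝ), (∑ x, ∑ y,
        if x = a then if y = b then f x y else 0 else 0) = f a b := fun a b f => by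
      rw [sum_eq_single a (fun x _ hx => by simp [hx]) (by simp)]
      simp
    rw [this j l fun x y => (q x - c * η x) * (q y - c * η y),
      this l j fun x y => (q x - c * η x) * (q y - c * η y), h1, h2]
    ring
  have e2 : ∑ a, ∑ b, ind Y a b * ((q a - c * η a) * (q b - c * η b)) =
      ∑ a, ∑ b, ind Y a b * (q a * q b) - 2 * c * (∑ v, ind Y j v * q v + ∑ v, ind Y l v * q v)
      := by
    have h1 : ∑ a, ∑ b, η a * (ind Y a b * q b) = ∑ v, ind Y j v * q v + ∑ v, ind Y l v * q v := by
      simp only [← mul_sum]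
      exact hs _
    have h2 : ∑ a, ∑ b, η b * (ind Y a b * q a) = ∑ v, ind Y j v * q v + ∑ v, ind Y l v * q v := by
      rw [sum_comm, ← h1]
      simp only [ind_symm]
    have h3 : ∑ a, ∑ b, η a * (η b * ind Y a b) = 0 := by
      simp only [← mul_sum, hs]
      have : ind Y j l = 0 := if_neg hY
      rw [ind_self, ind_self, ind_symm Y l j, this]
      norm_num
    have h4 : ∀ a b, ind Y a b * ((q a - c * η a) * (q b - c * η b)) = ind Y a b * (q a * q b) -
        c * (η a * (ind Y a b * q b)) - c * (η b * (ind Y a b * q a)) +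
        c ^ 2 * (η a * (η b * ind Y a b)) := fun a b => by ring
    have h5 : ∀ (c : ℝ) (f : Fin n → Fin n → ℝ), ∑ a, ∑ b, c * f a b = c * ∑ a, ∑ b, f a b :=
      fun c f => by simp only [mul_sum]
    simp only [h4, sum_add_distrib, sum_sub_distrib]
    rw [h5 c, h5 c, h5 (c ^ 2), h1, h2, h3]
    ring
  simp only [ind_sup_edge hY, add_mul, sum_add_distrib, hq']
  rw [e1, e2]
  ring

/-- The contribution of a vertex to the exponent. -/
def vertexTerm (lam x D y : ℝ) : ℝ :=
  D * y * x / lam - (1 - lam) * y ^ 2 * x / (2 * lam) +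
    (-(1 - lam ^ 2) * y ^ 3 / 6 + D * y ^ 2 / 2 - D ^ 2 * y / 2) * x ^ 2 / lam ^ 2

/-- The exponent approximating the logarithm of the normalised probability of containing `Y`. -/
def exponent (lam x : ℝ) (D : Fin n → ℝ) (Y : SimpleGraph (Fin n)) : ℝ :=
  (1 - lam) / lam * ((∑ v, deg Y v) / 2 * x + ((∑ v, deg Y v) / 2) ^ 2 * x ^ 2) +
    ∑ v, vertexTerm lam x (D v) (deg Y v) - edgeSum lam D Y * (1 / (lam * (1 - lam))) * x ^ 2

lemma exponent_sup_edge {j l : Fin n} (hjl : j ≠ l) (hY : ¬ Y.Adj j l) (x : ℝ) :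
    exponent lam x D (Y ⊔ SimpleGraph.edge j l) - exponent lam x D Y =
      (1 - lam) / lam * (x + (∑ v, deg Y v + 1) * x ^ 2) +
      (vertexTerm lam x (D j) (deg Y j + 1) - vertexTerm lam x (D j) (deg Y j)) +
      (vertexTerm lam x (D l) (deg Y l + 1) - vertexTerm lam x (D l) (deg Y l)) -
      ((D j - (1 - lam) * deg Y j - (1 - lam)) * (D l - (1 - lam) * deg Y l - (1 - lam)) -
      (1 - lam) * (∑ v, ind Y j v * (D v - (1 - lam) * deg Y v) +
        ∑ v, ind Y l v * (D v - (1 - lam) * deg Y v))) * (1 / (lam * (1 - lam))) * x ^ 2 := by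
  have h1 : ∑ v, deg (Y ⊔ SimpleGraph.edge j l) v = ∑ v, deg Y v + 2 := by
    simp only [deg_sup_edge hjl hY, sum_add_distrib, sum_ite_eq', mem_univ, if_true]
    norm_num
  have h2 := sum_sub_sum_pair hjl (g := fun v => vertexTerm lam x (D v) (deg Y v))
    (g' := fun v => vertexTerm lam x (D v) (deg (Y ⊔ SimpleGraph.edge j l) v)) fun v hj hl => by
      simp only [deg_sup_edge hjl hY, hj, hl, if_false, add_zero]
  have h3 : deg (Y ⊔ SimpleGraph.edge j l) j = deg Y j + 1 := by
    rw [deg_sup_edge hjl hY]; simp [hjl]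
  have h4 : deg (Y ⊔ SimpleGraph.edge j l) l = deg Y l + 1 := by
    rw [deg_sup_edge hjl hY]; simp [hjl.symm]
  simp only [h3, h4] at h2
  unfold exponent
  rw [h1, edgeSum_sup_edge hjl hY]
  linear_combination h2

end DegreeSeq

namespace DegreeSeq

variable {n : ℕ} {t r lam : ℝ} {d : Fin n → ℝ} {W H₀ Y : SimpleGraph (Fin n)} {s : ℕ}

lemma abs_log_one_add_sub_le {z : ℝ} (hz : |z| ≤ 1 / 2) :
    |Real.log (1 + z) - (z - z ^ 2 / 2)| ≤ |2 * (z * z * z)| := by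
  have h := Real.abs_log_sub_add_sum_range_le (x := -z) (by rw [abs_neg]; linarith) 2
  rw [abs_neg] at h
  have e : (∑ i ∈ range 2, (-z) ^ (i + 1) / ((i : ℝ) + 1)) + Real.log (1 - -z) =
      Real.log (1 + z) - (z - z ^ 2 / 2) := by
    simp [sum_range_succ]
    ring
  rw [e] at h
  refine h.trans ?_
  rw [div_le_iff₀ (by linarith)]
  have e2 : |2 * (z * z * z)| = 2 * |z| ^ 3 := by
    rw [abs_mul, abs_mul, abs_mul, abs_two]
    ring
  rw [e2]
  have : 0 ≤ |z| ^ 3 := pow_nonneg (abs_nonneg z) 3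
  norm_num
  nlinarith

lemma Bd.log_one_add {z : ℝ} {K : ℕ} (h : Scale n t r) (hz : Bd t r 1 K z) (hK : K < 1000) :
    0 < 1 + z ∧ Bd t r 3 (K + K + K + 1) (Real.log (1 + z) - (z - z ^ 2 / 2)) := by
  have h1 : |z| ≤ 1 / 2 := by
    refine hz.trans ?_
    have hr := h.r_pos
    have ht := h.ht
    have h3 := h.pow_le_r (K := K + 1) (by omega)
    rw [zpow_neg, zpow_one, ← div_eq_mul_inv, div_le_div_iff₀ hr (by norm_num), one_mul]
    rw [pow_succ] at h3
    have : 0 < t ^ K := pow_pos h.t_pos _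
    nlinarith
  refine ⟨by linarith [(abs_le.1 h1).1], ?_⟩
  exact (Bd.cmul h 2 (by norm_num) ((hz.mul h hz).mul h hz)).of_le (abs_log_one_add_sub_le h1)

lemma log_expansion_identity {lam x qj ql yj yl Sj Sl T Dj Dl e z : ℝ} (h0 : lam ≠ 0)
    (h1 : 1 - lam ≠ 0) (hj : Dj = qj + (1 - lam) * yj) (hl : Dl = ql + (1 - lam) * yl)
    (hz : z = ((qj + ql) * x + (1 - 2 * lam) * (1 / (lam * (1 - lam))) * qj * ql * x ^ 2 +
      (qj * yj + Sj + (ql * yl + Sl) - -((1 - lam) * T)) * x ^ 2 + e) * (1 / lam)) :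
    z - z ^ 2 / 2 - ((1 - lam) / lam * (x + (T + 1) * x ^ 2) +
      (vertexTerm lam x Dj (yj + 1) - vertexTerm lam x Dj yj) +
      (vertexTerm lam x Dl (yl + 1) - vertexTerm lam x Dl yl) -
      ((qj - (1 - lam)) * (ql - (1 - lam)) - (1 - lam) * (Sj + Sl)) *
        (1 / (lam * (1 - lam))) * x ^ 2) =
    e * (1 / lam) -
      (z - (qj + ql) * x * (1 / lam)) * (z + (qj + ql) * x * (1 / lam)) * (1 / 2) -
      ((1 - lam) * lam + (Dj + Dl) * (1 / 2) -
        (1 - lam) * (1 + lam) * (3 * (yj + yl) + 2) * (1 / 6) +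
        lam * ((qj + ql) - (1 - lam))) * x ^ 2 * (1 / lam) * (1 / lam) := by
  have h2 : z ^ 2 = (z - (qj + ql) * x * (1 / lam)) * (z + (qj + ql) * x * (1 / lam)) +
      ((qj + ql) * x * (1 / lam)) ^ 2 := by ring
  rw [h2]
  generalize (z - (qj + ql) * x * (1 / lam)) * (z + (qj + ql) * x * (1 / lam)) = w
  rw [hz, hj, hl]
  unfold vertexTerm
  field_simp
  ring

theorem Model.log_pr_sub (h : Model n t r lam d 16 Y H₀) (hY : Y ≤ H₀) {j l : Fin n}
    (hjl : j ≠ l) (hW : ¬ Y.Adj j l) :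
    0 < pr d Y H₀ j l ∧ Bd t r 3 220 (Real.log (pr d Y H₀ j l) - Real.log lam -
      (exponent lam (1 / n) (fun v => d v - lam * (n - 1)) (Y ⊔ SimpleGraph.edge j l) -
        exponent lam (1 / n) (fun v => d v - lam * (n - 1)) Y)) := by
  have hs := h.toScale
  have hlam := h.lam_pos
  have hinf : H₀ ⊓ Y = Y := inf_eq_right.2 hY
  have hqe : ∀ v, qv lam d Y H₀ v = d v - lam * (n - 1) - (1 - lam) * deg Y v := fun v => by
    unfold qv; rw [hinf]; ring
  have hSe : ∀ v, ∑ u, ind Y v u * qv lam d Y H₀ u = Sv lam d Y H₀ v := fun v => rfl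
  have hQe : Qv lam d Y H₀ = -((1 - lam) * ∑ v, deg Y v) := by
    rw [h.Qv_eq, hinf]; ring
  rw [exponent_sup_edge hjl hW]
  simp only [← hqe, hSe]
  have hI := h.inv_lam_bd
  have hx1 : Bd t r 2 0 (1 / (n : ℝ)) := Bd.inv_n hs
  have hx2 : Bd t r 4 0 ((1 / (n : ℝ)) ^ 2) := by rw [pow_two]; exact hx1.mul hs hx1
  have hq := h.qv_bd
  have hy := h.deg_bd
  have hU := h.Uv_bd
  have hcq := h.cq_bd
  have hQ := h.Qv_bd
  have he := h.pr_sub_second (s := 0) hjl hW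
  set e := pr d Y H₀ j l - second lam d Y H₀ j l with he_def
  set z := (pr d Y H₀ j l - lam) * (1 / lam) with hz_def
  have hz1 : pr d Y H₀ j l = lam * (1 + z) := by
    rw [hz_def]; field_simp; ring
  have hD : ∀ v, d v - lam * (n - 1) = qv lam d Y H₀ v + (1 - lam) * deg Y v := fun v => by
    rw [hqe]; ring
  have hz2 : z = ((qv lam d Y H₀ j + qv lam d Y H₀ l) * (1 / n) +
      (1 - 2 * lam) * (1 / (lam * (1 - lam))) * qv lam d Y H₀ j * qv lam d Y H₀ l *
        (1 / n) ^ 2 +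
      (qv lam d Y H₀ j * deg Y j + Sv lam d Y H₀ j + (qv lam d Y H₀ l * deg Y l +
        Sv lam d Y H₀ l) - -((1 - lam) * ∑ v, deg Y v)) * (1 / n) ^ 2 + e) * (1 / lam) := by
    rw [← hQe, hz_def, he_def]
    unfold second Uv cq
    ring
  have hid := log_expansion_identity hlam.ne' h.lam_lt.ne' (hD j) (hD l) hz2
  have hσ : Bd t r (-1) 4 (qv lam d Y H₀ j + qv lam d Y H₀ l) := (hq j).add' hs (hq l)
  have hα : Bd t r 1 5 ((qv lam d Y H₀ j + qv lam d Y H₀ l) * (1 / n) * (1 / lam)) :=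
    (hσ.mul hs hx1).mul' hs hI
  have hρ : Bd t r 2 69 (z - (qv lam d Y H₀ j + qv lam d Y H₀ l) * (1 / n) * (1 / lam)) := by
    have e1 : z - (qv lam d Y H₀ j + qv lam d Y H₀ l) * (1 / n) * (1 / lam) =
        (cq lam * qv lam d Y H₀ j * qv lam d Y H₀ l * (1 / n) ^ 2 +
        (Uv lam d Y H₀ j + Uv lam d Y H₀ l - Qv lam d Y H₀) * (1 / n) ^ 2 + e) * (1 / lam) := by
      rw [hz_def, he_def]
      unfold second
      ring
    rw [e1]
    have s1 := ((hcq.mul hs (hq j)).mul hs (hq l)).mul hs hx2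
    have s2 := (((hU j).add' (i'' := -2) (K'' := 7) hs (hU l)).sub' (i'' := -2) (K'' := 8) hs
      hQ).mul hs hx2
    exact ((s1.add' (i'' := 2) (K'' := 9) hs s2).add' (i'' := 2) (K'' := 67) hs he).mul' hs hI
  have hz : Bd t r 1 70 z := by
    have := hρ.add' (i'' := 1) (K'' := 70) hs hα
    rwa [sub_add_cancel] at this
  obtain ⟨hpos, hlog⟩ := hz.log_one_add hs (by norm_num)
  refine ⟨by rw [hz1]; exact mul_pos hlam hpos, ?_⟩
  have hlogP : Real.log (pr d Y H₀ j l) = Real.log lam + Real.log (1 + z) := by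
    rw [hz1, Real.log_mul hlam.ne' hpos.ne']
  have hc : Bd t r 0 0 (1 - lam) := Bd.one (by
    rw [abs_of_pos h.lam_lt]; linarith)
  have hl := h.lam_bd
  have hone : Bd t r 0 1 (1 : ℝ) := Bd.const hs (by norm_num)
  have r1 := he.mul hs hI
  have r2 := (hρ.mul hs (hz.add' (i'' := 1) (K'' := 71) hs hα)).mul hs
    (Bd.const hs (by norm_num : |(1 / 2 : ℝ)| ≤ 1000))
  have r3 : Bd t r 3 30 (((1 - lam) * lam + (d j - lam * (n - 1) + (d l - lam * (n - 1))) *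
      (1 / 2) - (1 - lam) * (1 + lam) * (3 * (deg Y j + deg Y l) + 2) * (1 / 6) +
        lam * ((qv lam d Y H₀ j + qv lam d Y H₀ l) - (1 - lam))) * (1 / n) ^ 2 * (1 / lam) *
        (1 / lam)) := by
    have hDb : ∀ v, Bd t r (-1) 4 (d v - lam * (n - 1)) := fun v => by
      rw [hD]; exact (hq v).add' hs (hc.mul hs (hy v))
    have b1 := hc.mul hs hl
    have b2 := ((hDb j).add' (i'' := -1) (K'' := 5) hs (hDb l)).mul hs
      (Bd.const hs (by norm_num : |(1 / 2 : ℝ)| ≤ 1000))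
    have b3 := ((hc.mul hs (hone.add' (i'' := 0) (K'' := 2) hs hl)).mul hs
      ((((hy j).add' (i'' := -1) (K'' := 3) hs (hy l)).cmul hs 3 (by norm_num)).add'
        (i'' := -1) (K'' := 5) hs (Bd.const hs (by norm_num : |(2 : ℝ)| ≤ 1000)))).mul hs
      (Bd.const hs (by norm_num : |(1 / 6 : ℝ)| ≤ 1000))
    have b4 := hl.mul hs (hσ.sub' (i'' := -1) (K'' := 5) hs hc)
    exact (((((b1.add' (i'' := -1) (K'' := 7) hs b2).sub' (i'' := -1) (K'' := 9) hs b3).add'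
      (i'' := -1) (K'' := 10) hs b4).mul hs hx2).mul hs hI).mul' hs hI
  have tot := hlog.add' (i'' := 3) (K'' := 220) hs
    ((r1.sub' (i'' := 3) (K'' := 180) hs r2).sub' (i'' := 3) (K'' := 181) hs r3)
  convert tot using 1
  rw [← hid, hlogP]
  ring

end DegreeSeq

namespace DegreeSeq

variable {n : ℕ} {t r lam : ℝ} {d : Fin n → ℝ} {X Y H₀ : SimpleGraph (Fin n)} {s : ℕ}

/-- The graphs with degree sequence `d` that contain `Y`. -/
def above (d : Fin n → ℝ) (Y : SimpleGraph (Fin n)) : Finset (SimpleGraph (Fin n)) :=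
  univ.filter fun H => (∀ v, deg H v = d v) ∧ Y ≤ H

lemma mem_above {H : SimpleGraph (Fin n)} :
    H ∈ above d Y ↔ (∀ v, deg H v = d v) ∧ Y ≤ H := by simp [above]

lemma cls_eq_above (h : H₀ ∈ above d Y) : cls d Y H₀ = above d Y := by
  ext H
  rw [mem_cls, mem_above, inf_eq_right.2 (mem_above.1 h).2, inf_eq_right]

lemma card_above_sup_edge (h : H₀ ∈ above d Y) {j l : Fin n} (hjl : j ≠ l) :
    (#(above d (Y ⊔ SimpleGraph.edge j l)) : ℝ) = pr d Y H₀ j l * #(above d Y) := by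
  have h0 : (#(above d Y) : ℝ) ≠ 0 := by exact_mod_cast (card_pos.2 ⟨_, h⟩).ne'
  have h1 : above d (Y ⊔ SimpleGraph.edge j l) = (above d Y).filter fun H => H.Adj j l := by
    ext H
    simp only [mem_above, mem_filter, sup_le_iff, SimpleGraph.edge_le_iff, hjl, false_or,
      and_assoc]
  rw [pr, cls_eq_above h, ev, div_mul_cancel₀ _ h0, h1]
  simp [ind]

lemma exponent_bot (lam x : ℝ) (D : Fin n → ℝ) :
    exponent lam x D (⊥ : SimpleGraph (Fin n)) = 0 := by
  simp [exponent, vertexTerm, edgeSum, deg, ind]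

lemma exists_eq_sup_edge {e : ℕ} (h : #Y.edgeFinset = e + 1) :
    ∃ (Y' : SimpleGraph (Fin n)) (j l : Fin n), j ≠ l ∧ ¬ Y'.Adj j l ∧
      Y = Y' ⊔ SimpleGraph.edge j l ∧ #Y'.edgeFinset = e := by
  obtain ⟨p, hp⟩ := card_pos.1 (by omega : 0 < #Y.edgeFinset)
  induction p using Sym2.ind with | _ j l => ?_
  rw [SimpleGraph.mem_edgeFinset, SimpleGraph.mem_edgeSet] at hp
  obtain ⟨Y', hY'⟩ : ∃ Y', Y' = Y \ SimpleGraph.edge j l := ⟨_, rfl⟩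
  have h1 : ¬ Y'.Adj j l := by
    simp [hY', SimpleGraph.edge_adj, hp.ne]
  have h2 : Y = Y' ⊔ SimpleGraph.edge j l := by
    rw [hY']
    exact (sdiff_sup_cancel ((SimpleGraph.edge_le_iff _).2 (Or.inr hp))).symm
  refine ⟨Y', j, l, hp.ne, h1, h2, ?_⟩
  have h3 : ∑ v, deg Y v = ∑ v, deg Y' v + 2 := by
    conv_lhs => rw [h2]
    simp only [deg_sup_edge hp.ne h1, sum_add_distrib, sum_ite_eq', mem_univ, if_true]
    norm_num
  rw [sum_deg_eq, sum_deg_eq, h] at h3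
  have h4 : ((e + 1 : ℕ) : ℝ) = #Y'.edgeFinset + 1 := by linarith
  have h5 : e + 1 = #Y'.edgeFinset + 1 := by exact_mod_cast h4
  omega

lemma Sparse.of_le (h : Sparse t r s X) (hY : Y ≤ X) : Sparse t r s Y where
  deg_le v := (add_le_add_left (deg_mono hY v) _).trans (h.deg_le v)
  sum_le := (add_le_add_left (sum_le_sum fun v _ => deg_mono hY v) _).trans h.sum_le

theorem Near.abs_log_card_above_sub (h : Near n t r lam d) (hX : Sparse t r 16 X)
    (h0 : (above d (⊥ : SimpleGraph (Fin n))).Nonempty) {e : ℕ} (hY : Y ≤ X)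
    (he : #Y.edgeFinset = e) :
    0 < #(above d Y) ∧ |Real.log (#(above d Y) / #(above d (⊥ : SimpleGraph (Fin n)))) -
      e * Real.log lam - exponent lam (1 / n) (fun v => d v - lam * (n - 1)) Y| ≤
      e * (t ^ 220 * r ^ (-3 : ℤ)) := by
  have hb0 : (0 : ℝ) < #(above d (⊥ : SimpleGraph (Fin n))) := by exact_mod_cast h0.card_pos
  induction e generalizing Y with
  | zero =>
    rw [card_eq_zero, SimpleGraph.edgeFinset_eq_empty] at he
    subst he
    refine ⟨h0.card_pos, ?_⟩
    rw [div_self hb0.ne', exponent_bot]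
    simp
  | succ e ih =>
    obtain ⟨Y', j, l, hjl, hadj, rfl, he'⟩ := exists_eq_sup_edge he
    have hY' : Y' ≤ X := le_sup_left.trans hY
    obtain ⟨hpos, hlog⟩ := ih hY' he'
    obtain ⟨H₀, hH₀⟩ := card_pos.1 hpos
    have hM : Model n t r lam d 16 Y' H₀ :=
      { h with sparse := hX.of_le hY', deg_eq := (mem_above.1 hH₀).1 }
    obtain ⟨hp, hbd⟩ := hM.log_pr_sub (mem_above.1 hH₀).2 hjl hadj
    have hc := card_above_sup_edge hH₀ hjl
    have hpos' : (0 : ℝ) < #(above d Y') := by exact_mod_cast hpos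
    constructor
    · have : (0 : ℝ) < #(above d (Y' ⊔ SimpleGraph.edge j l)) := by
        rw [hc]; exact mul_pos hp hpos'
      exact_mod_cast this
    · rw [hc, mul_div_assoc, Real.log_mul hp.ne' (div_pos hpos' hb0).ne']
      have := (abs_add_le _ _).trans (add_le_add hbd hlog)
      push_cast
      rw [add_mul _ _ (t ^ 220 * r ^ (-3 : ℤ)), one_mul, add_comm _ (t ^ 220 * r ^ (-3 : ℤ))]
      refine le_trans (le_of_eq ?_) this
      congr 1
      ring

end DegreeSeq

namespace DegreeSeq

variable {n : ℕ} {t r lam : ℝ} {d : Fin n → ℕ} {X : SimpleGraph (Fin n)}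

lemma xDeg_eq_deg (H : SimpleGraph (Fin n)) (v : Fin n) : (xDeg H v : ℝ) = deg H v := by
  rw [xDeg, deg_eq_card, Nat.card_eq_fintype_card, SimpleGraph.card_neighborSet_eq_degree,
    ← SimpleGraph.card_neighborFinset_eq_degree]
  congr 2
  ext u
  simp

lemma xEdges_eq (H : SimpleGraph (Fin n)) : xEdges H = #H.edgeFinset := by
  rw [xEdges, Nat.card_eq_fintype_card, SimpleGraph.edgeFinset_card]

lemma deg_sup_of_disjoint {H : SimpleGraph (Fin n)} (h : Disjoint H X) (v : Fin n) :
    deg (H ⊔ X) v = deg H v + deg X v := by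
  rw [deg, deg, deg, ← sum_add_distrib]
  refine sum_congr rfl fun u _ => ?_
  have h1 : H.Adj v u → ¬ X.Adj v u := fun h2 h3 => by
    have : (H ⊓ X).Adj v u := ⟨h2, h3⟩
    rw [h.eq_bot] at this
    exact this
  simp only [ind, SimpleGraph.sup_adj]
  by_cases e2 : H.Adj v u <;> by_cases e3 : X.Adj v u <;> simp_all

lemma gCount_eq_card_above (hx : ∀ v, xDeg X v ≤ d v) :
    gCount (fun v => d v - xDeg X v) X = #(above (fun v => (d v : ℝ)) X) := by
  rw [gCount, Nat.card_eq_fintype_card, Fintype.card_subtype]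
  have key : ∀ H : SimpleGraph (Fin n), Disjoint H X →
      ((∀ v, Nat.card (H.neighborSet v) = d v - xDeg X v) ↔
        ∀ v, deg (H ⊔ X) v = d v) := fun H hH => by
    refine forall_congr' fun v => ?_
    rw [deg_sup_of_disjoint hH, ← xDeg_eq_deg, ← xDeg_eq_deg, ← Nat.cast_add, Nat.cast_inj]
    have := hx v
    change xDeg H v = _ ↔ _
    omega
  refine card_nbij' (fun H => H ⊔ X) (fun H => H \ X) ?_ ?_ ?_ ?_
  · intro H hH
    simp only [coe_filter, mem_univ, true_and, Set.mem_ofPred_eq,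
      SimpleGraph.disjoint_edgeSet] at hH
    rw [mem_coe, mem_above]
    exact ⟨(key H hH.2).1 hH.1, le_sup_right⟩
  · intro H hH
    rw [mem_coe, mem_above] at hH
    simp only [coe_filter, mem_univ, true_and, Set.mem_ofPred_eq, SimpleGraph.disjoint_edgeSet]
    refine ⟨(key _ disjoint_sdiff_self_left).2 ?_, disjoint_sdiff_self_left⟩
    rw [sdiff_sup_cancel hH.2]
    exact hH.1
  · intro H hH
    simp only [coe_filter, mem_univ, true_and, Set.mem_ofPred_eq,
      SimpleGraph.disjoint_edgeSet] at hH
    change (H ⊔ X) \ X = H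
    rw [sup_sdiff_right_self, hH.2.sdiff_eq_left]
  · intro H hH
    rw [mem_coe, mem_above] at hH
    exact sdiff_sup_cancel hH.2

lemma gCount_bot (d : Fin n → ℕ) :
    gCount d ⊥ = #(above (fun v => (d v : ℝ)) (⊥ : SimpleGraph (Fin n))) := by
  have h : ∀ v, xDeg (⊥ : SimpleGraph (Fin n)) v = 0 := fun v => by
    have := xDeg_eq_deg (⊥ : SimpleGraph (Fin n)) v
    rw [show deg (⊥ : SimpleGraph (Fin n)) v = 0 by simp [deg, ind]] at this
    exact_mod_cast this
  rw [← gCount_eq_card_above fun v => by rw [h]; exact Nat.zero_le _]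
  simp only [h, Nat.sub_zero]

lemma exponent_eq (hn : 2 ≤ n) (hl : lamb d ≠ 0) (hl1 : 1 - lamb d ≠ 0) :
    exponent (lamb d) (1 / n) (fun v => d v - lamb d * (n - 1)) X =
      (1 - lamb d) * (xEdges X : ℝ) / (lamb d * (n : ℝ))
            - (1 + lamb d) * xPow X 2 / (2 * lamb d * (n : ℝ))
            - (1 + lamb d) * (1 + 2 * lamb d) * xPow X 3
                / (6 * lamb d ^ 2 * (n : ℝ) ^ 2)
            + (1 - lamb d) * (xEdges X : ℝ) ^ 2 / (lamb d * (n : ℝ) ^ 2)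
            - pairSum X (fun j => deltaPar d X j - (xDeg X j : ℝ))
                / (lamb d * (1 - lamb d) * (n : ℝ) ^ 2)
            + cPar d X 1 1 / (lamb d * (n : ℝ))
            + (1 + 2 * lamb d) * cPar d X 1 2 / (2 * lamb d ^ 2 * (n : ℝ) ^ 2)
            - cPar d X 2 1 / (2 * lamb d ^ 2 * (n : ℝ) ^ 2) := by
  have hn1 : (n : ℝ) - 1 ≠ 0 := by
    have : (2 : ℝ) ≤ n := by exact_mod_cast hn
    linarith
  have hn0 : (n : ℝ) ≠ 0 := by positivity
  have hlam : lamb d * (n - 1) = dBar d := by rw [lamb]; field_simp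
  have hδ : ∀ v, deltaPar d X v = (d v - lamb d * (n - 1)) + lamb d * deg X v := fun v => by
    rw [deltaPar, hlam, xDeg_eq_deg]
  have he : (∑ v, deg X v) / 2 = xEdges X := by
    rw [sum_deg_eq, xEdges_eq]; ring
  have hp : pairSum X (fun j => deltaPar d X j - (xDeg X j : ℝ)) =
      edgeSum (lamb d) (fun v => d v - lamb d * (n - 1)) X := by
    unfold pairSum edgeSum
    congr 1
    refine sum_congr rfl fun a _ => sum_congr rfl fun b _ => ?_
    simp only [ind, ite_mul, one_mul, zero_mul, hδ, xDeg_eq_deg]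
    congr 1
    ring
  have hv : ∑ v, vertexTerm (lamb d) (1 / n) (d v - lamb d * (n - 1)) (deg X v) =
      -((1 + lamb d) * xPow X 2 / (2 * lamb d * (n : ℝ)))
            - (1 + lamb d) * (1 + 2 * lamb d) * xPow X 3
                / (6 * lamb d ^ 2 * (n : ℝ) ^ 2)
            + cPar d X 1 1 / (lamb d * (n : ℝ))
            + (1 + 2 * lamb d) * cPar d X 1 2 / (2 * lamb d ^ 2 * (n : ℝ) ^ 2)
            - cPar d X 2 1 / (2 * lamb d ^ 2 * (n : ℝ) ^ 2) := by
    simp only [xPow, cPar, xDeg_eq_deg, hδ, mul_sum, sum_div]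
    rw [← sum_neg_distrib, ← sum_sub_distrib, ← sum_add_distrib, ← sum_add_distrib,
      ← sum_sub_distrib]
    refine sum_congr rfl fun v _ => ?_
    unfold vertexTerm
    field_simp
    ring
  rw [exponent, hv, hp, he]
  field_simp
  ring

theorem Near.hitPar_eq (h : Near n t r (lamb d) fun v => (d v : ℝ)) (hX : Sparse t r 16 X)
    (hE : Even (∑ v, d v)) (hx : ∀ v, xDeg X v ≤ d v) :
    ∃ err : ℝ, |err| ≤ xEdges X * (t ^ 220 * r ^ (-3 : ℤ)) ∧
      hitPar d X = Real.exp
        (exponent (lamb d) (1 / n) (fun v => d v - lamb d * (n - 1)) X + err) := by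
  obtain ⟨H, hH⟩ := h.exists_graph (fun v => rfl) hE
  have h0 : (above (fun v => (d v : ℝ)) (⊥ : SimpleGraph (Fin n))).Nonempty :=
    ⟨H, mem_above.2 ⟨hH, bot_le⟩⟩
  obtain ⟨hpos, hlog⟩ := h.abs_log_card_above_sub hX h0 le_rfl (xEdges_eq X).symm
  refine ⟨_, hlog, ?_⟩
  have h1 : (0 : ℝ) < #(above (fun v => (d v : ℝ)) X) := by exact_mod_cast hpos
  have h2 : (0 : ℝ) < #(above (fun v => (d v : ℝ)) (⊥ : SimpleGraph (Fin n))) := by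
    exact_mod_cast h0.card_pos
  rw [add_sub_cancel, Real.exp_sub, Real.exp_log (div_pos h1 h2), Real.exp_nat_mul,
    Real.exp_log h.lam_pos, hitPar, gCount_eq_card_above hx, gCount_bot, mul_comm, div_div]

end DegreeSeq

namespace DegreeSeq

variable {n : ℕ} {t r : ℝ} {d : Fin n → ℕ} {X : SimpleGraph (Fin n)}

lemma near_lamb (h : Scale n t r) (hmin : (n : ℝ) / t ≤ min (dBar d) (n - dBar d - 1))
    (hd : ∀ v, |(d v : ℝ) - dBar d| ≤ r * t ^ 2) :
    Near n t r (lamb d) fun v => (d v : ℝ) := by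
  have hn1 : (0 : ℝ) < n - 1 := by
    have h1 := h.n_le (K := 1) (by norm_num)
    have h2 := h.one_le_r
    have h3 := h.ht
    nlinarith
  have ht := h.t_pos
  have hn := h.n_pos
  have e1 : lamb d * (n - 1) = dBar d := by rw [lamb]; field_simp
  have e2 : (1 - lamb d) * (n - 1) = n - dBar d - 1 := by rw [sub_mul, e1]; ring
  have e3 : 1 / t * (n - 1) ≤ n / t := by
    rw [one_div_mul_eq_div]
    gcongr
    linarith
  refine { h with lam_ge := ?_, lam_le := ?_, d_near := ?_, d_sum := ?_ }
  · refine le_of_mul_le_mul_right ?_ hn1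
    rw [e1]
    exact e3.trans (hmin.trans (min_le_left _ _))
  · refine le_of_mul_le_mul_right ?_ hn1
    rw [e2]
    exact e3.trans (hmin.trans (min_le_right _ _))
  · rwa [e1]
  · rw [mul_assoc, e1, dBar]
    field_simp

lemma sparse_of_bounds (h : Scale n t r) {C₁ C₂ : ℝ} (hC₁ : C₁ + 1 ≤ t) (hC₂ : 2 * C₂ + 1 ≤ t)
    (h1 : ∀ v, (xDeg X v : ℝ) ≤ C₁ * (r * t)) (h2 : (xEdges X : ℝ) ≤ C₂ * (r ^ 2 * t ^ 2)) :
    Sparse t r 16 X := by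
  have hr := h.one_le_r
  have ht := h.ht
  have ht1 := h.one_le_t
  have a1 : (16 : ℝ) ≤ r * t := by nlinarith
  have a2 : (16 : ℝ) ≤ r ^ 2 * t ^ 2 := by nlinarith
  constructor
  · intro v
    have := h1 v
    rw [xDeg_eq_deg] at this
    have e : r * t ^ 2 = t * (r * t) := by ring
    push_cast
    rw [e]
    nlinarith
  · rw [sum_deg_eq, ← xEdges_eq]
    have e : r ^ 2 * t ^ 3 = t * (r ^ 2 * t ^ 2) := by ring
    push_cast
    rw [e]
    nlinarith

lemma Near.xDeg_le (h : Near n t r (lamb d) fun v => (d v : ℝ)) (hX : Sparse t r 16 X)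
    (v : Fin n) : xDeg X v ≤ d v := by
  have h1 := hX.deg_le' v
  rw [← xDeg_eq_deg] at h1
  have h2 := (abs_le.1 (h.d_near v)).1
  have h3 := h.n_le (K := 4) (by norm_num)
  have h4 := h.one_le_r
  have h5 := h.ht
  have h6 := h.one_le_t
  have h7 : 2 * (r * t ^ 2) ≤ lamb d * (n - 1) := by
    have e1 : 2 * (r * t ^ 2) = 1 / t * (2 * (r * t ^ 3)) := by
      have := h.t_pos
      field_simp
    have e2 : 1 ≤ r * t ^ 3 := one_le_mul_of_one_le_of_one_le h4 (one_le_pow₀ h6)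
    have e3 : r * t ^ 4 = r * t ^ 3 * t := by ring
    have e4 : 2 * (r * t ^ 3) ≤ n - 1 := by nlinarith
    rw [e1]
    exact mul_le_mul h.lam_ge e4 (by linarith) h.lam_pos.le
  have h8 : (xDeg X v : ℝ) ≤ d v := by linarith
  exact_mod_cast h8

lemma rpow_eventually_ge (C : ℝ) {ε : ℝ} (hε : 0 < ε) :
    ∀ᶠ n : ℕ in atTop, C ≤ (n : ℝ) ^ ε :=
  ((tendsto_rpow_atTop hε).comp tendsto_natCast_atTop_atTop).eventually_ge_atTop C

lemma mul_log_eventually_le {a ε : ℝ} (ha : 0 < a) (hε : 0 < ε) :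
    ∀ᶠ n : ℕ in atTop, a * Real.log n ≤ (n : ℝ) ^ ε := by
  have h := (isLittleO_log_rpow_atTop hε).bound (inv_pos.2 ha)
  filter_upwards [tendsto_natCast_atTop_atTop.eventually h] with n hn
  have h1 := (le_abs_self _).trans hn
  rw [Real.norm_of_nonneg (Real.rpow_nonneg (Nat.cast_nonneg n) ε)] at h1
  calc a * Real.log n ≤ a * (a⁻¹ * (n : ℝ) ^ ε) := by gcongr
    _ = _ := by field_simp

lemma scale_rpow {m : ℕ} (hm : 1000 ≤ m) (h1 : (1000 : ℝ) ≤ (n : ℝ) ^ (1 / (2 * m : ℝ)))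
    (h2 : 2 * (m : ℝ) ≤ (n : ℝ) ^ (1 / 2 : ℝ)) :
    Scale n ((n : ℝ) ^ (1 / (2 * m : ℝ))) ((n : ℝ) ^ (1 / 2 : ℝ)) := by
  have h0 : (0 : ℝ) ≤ n := Nat.cast_nonneg n
  have e : ((n : ℝ) ^ (1 / (2 * m : ℝ))) ^ m = (n : ℝ) ^ (1 / 2 : ℝ) := by
    rw [← Real.rpow_natCast, ← Real.rpow_mul h0]
    congr 1
    have : (m : ℝ) ≠ 0 := by positivity
    field_simp
  refine ⟨h1, ?_, ?_, m, e.ge, h2⟩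
  · rw [← e]
    exact pow_le_pow_right₀ (by linarith) hm
  · rw [← Real.rpow_natCast, ← Real.rpow_mul h0]
    norm_num

end DegreeSeq

/-- Theorem 2.1, second part: asymptotics of `hit(d,X)` under the conditions of the
main theorem.  Here `L = Σ_{jk∈X} (δ_j-x_j)(δ_k-x_k)`. -/
theorem stmt4 (a b : ℝ) (ha : 0 < a) (hb : 0 < b) (hab : a + b < 1/2) :
    ∃ ε : ℝ, 0 < ε ∧
      ∀ (d : (n : ℕ) → Fin n → ℕ) (X : (n : ℕ) → SimpleGraph (Fin n)),
        (∀ n, Even (∑ j, d n j)) →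
        (∃ C : ℝ, ∀ (n : ℕ) (j : Fin n),
            |(d n j : ℝ) - dBar (d n)| ≤ C * (n : ℝ) ^ ((1:ℝ)/2 + ε)) →
        (∃ C : ℝ, ∀ (n : ℕ) (j : Fin n),
            (xDeg (X n) j : ℝ) ≤ C * (n : ℝ) ^ ((1:ℝ)/2 + ε)) →
        (∃ C : ℝ, ∀ n : ℕ, (xEdges (X n) : ℝ) ≤ C * (n : ℝ) ^ ((1:ℝ) + 2*ε)) →
        (∀ᶠ n : ℕ in atTop,
            (n : ℝ) / (3 * a * Real.log n) ≤ min (dBar (d n)) ((n : ℝ) - dBar (d n) - 1)) →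
        ∃ C : ℝ, ∀ᶠ n : ℕ in atTop, ∃ err : ℝ, |err| ≤ C * (n : ℝ) ^ (-b) ∧
          hitPar (d n) (X n) = Real.exp (
              (1 - lamb (d n)) * (xEdges (X n) : ℝ) / (lamb (d n) * (n : ℝ))
            - (1 + lamb (d n)) * xPow (X n) 2 / (2 * lamb (d n) * (n : ℝ))
            - (1 + lamb (d n)) * (1 + 2 * lamb (d n)) * xPow (X n) 3
                / (6 * lamb (d n)^2 * (n : ℝ)^2)
            + (1 - lamb (d n)) * (xEdges (X n) : ℝ)^2 / (lamb (d n) * (n : ℝ)^2)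
            - pairSum (X n) (fun j => deltaPar (d n) (X n) j - (xDeg (X n) j : ℝ))
                / (lamb (d n) * (1 - lamb (d n)) * (n : ℝ)^2)
            + cPar (d n) (X n) 1 1 / (lamb (d n) * (n : ℝ))
            + (1 + 2 * lamb (d n)) * cPar (d n) (X n) 1 2
                / (2 * lamb (d n)^2 * (n : ℝ)^2)
            - cPar (d n) (X n) 2 1 / (2 * lamb (d n)^2 * (n : ℝ)^2)
            + err) := by
  obtain ⟨m, hm, hmb⟩ : ∃ m : ℕ, 1000 ≤ m ∧ 223 / (2 * m : ℝ) ≤ 1 / 2 - b := by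
    obtain ⟨m, hm⟩ := exists_nat_ge (223 / (1 / 2 - b))
    refine ⟨max 1000 m, le_max_left _ _, ?_⟩
    have h1 : (0 : ℝ) < 1 / 2 - b := by linarith
    have h2 : (m : ℝ) ≤ (max 1000 m : ℕ) := by exact_mod_cast le_max_right _ _
    have h3 : (0 : ℝ) < (max 1000 m : ℕ) := by
      exact_mod_cast lt_of_lt_of_le (by norm_num) (le_max_left 1000 m)
    rw [div_le_iff₀ h1] at hm
    rw [div_le_iff₀ (by linarith)]
    nlinarith
  have hm0 : (0 : ℝ) < m := by
    exact_mod_cast lt_of_lt_of_le (by norm_num) hm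
  set ε : ℝ := 1 / (2 * m : ℝ) with hε_def
  have hε : 0 < ε := by positivity
  refine ⟨ε, hε, fun d X hE ⟨C₀, hC₀⟩ ⟨C₁, hC₁⟩ ⟨C₂, hC₂⟩ hmin => ⟨1, ?_⟩⟩
  filter_upwards [hmin, DegreeSeq.rpow_eventually_ge 1000 hε, DegreeSeq.rpow_eventually_ge C₀ hε,
    DegreeSeq.rpow_eventually_ge (C₁ + 1) hε, DegreeSeq.rpow_eventually_ge (2 * C₂ + 1) hε,
    DegreeSeq.rpow_eventually_ge (2 * m) (one_half_pos (α := ℝ)),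
    DegreeSeq.mul_log_eventually_le (mul_pos three_pos ha) hε, eventually_ge_atTop 2]
    with n hmin h1000 h0 h1 h2 hr hlog hn
  have hs := DegreeSeq.scale_rpow hm h1000 hr
  rw [← hε_def] at hs
  have hn0 : (0 : ℝ) < n := hs.n_pos
  have e1 : (n : ℝ) ^ (1 / 2 + ε) = (n : ℝ) ^ (1 / 2 : ℝ) * (n : ℝ) ^ ε := Real.rpow_add hn0 _ _
  have e2 : (n : ℝ) ^ (1 + 2 * ε) = ((n : ℝ) ^ (1 / 2 : ℝ)) ^ 2 * ((n : ℝ) ^ ε) ^ 2 := by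
    rw [← Real.rpow_natCast, ← Real.rpow_natCast, ← Real.rpow_mul hn0.le, ← Real.rpow_mul hn0.le,
      ← Real.rpow_add hn0]
    congr 1
    push_cast
    ring
  have e3 : ((n : ℝ) ^ ε) ^ 223 / (n : ℝ) ^ (1 / 2 : ℝ) = (n : ℝ) ^ (223 * ε - 1 / 2) := by
    rw [← Real.rpow_natCast, ← Real.rpow_mul hn0.le, ← Real.rpow_sub hn0]
    congr 1
    push_cast
    ring
  have e4 : (n : ℝ) ^ (223 * ε - 1 / 2) ≤ (n : ℝ) ^ (-b) := by
    refine Real.rpow_le_rpow_of_exponent_le (by exact_mod_cast hs.n_pos) ?_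
    have : 223 * ε = 223 / (2 * m : ℝ) := by rw [hε_def]; ring
    linarith
  rw [← e3] at e4
  have hC₀' := hC₀ n
  have hC₁' := hC₁ n
  have hC₂' := hC₂ n
  rw [e1] at hC₀' hC₁'
  rw [e2] at hC₂'
  set t := (n : ℝ) ^ ε
  set r := (n : ℝ) ^ (1 / 2 : ℝ)
  have ht := hs.t_pos
  have hr0 := hs.r_pos
  have hX := DegreeSeq.sparse_of_bounds hs h1 h2 hC₁' hC₂'
  have hlog0 : 0 < Real.log n := Real.log_pos (by exact_mod_cast hn)
  have hN : DegreeSeq.Near n t r (lamb (d n)) fun v => (d n v : ℝ) := by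
    refine DegreeSeq.near_lamb hs (le_trans ?_ hmin) fun v => (hC₀' v).trans ?_
    · exact div_le_div_of_nonneg_left hn0.le (by positivity) hlog
    · calc C₀ * (r * t) ≤ t * (r * t) := by gcongr
        _ = r * t ^ 2 := by ring
  obtain ⟨err, herr, heq⟩ := hN.hitPar_eq hX (hE n) (hN.xDeg_le hX)
  refine ⟨err, ?_, ?_⟩
  · have h3 := hX.sum_le
    rw [DegreeSeq.sum_deg_eq, ← DegreeSeq.xEdges_eq] at h3
    push_cast at h3
    have h4 : (xEdges (X n) : ℝ) ≤ r ^ 2 * t ^ 3 := by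
      have : (0 : ℝ) ≤ xEdges (X n) := Nat.cast_nonneg _
      linarith
    rw [one_mul]
    calc |err| ≤ r ^ 2 * t ^ 3 * (t ^ 220 * r ^ (-3 : ℤ)) := herr.trans (by gcongr)
      _ = t ^ 223 / r := by
        rw [show r ^ (-3 : ℤ) = 1 / r ^ 3 by rw [zpow_neg, one_div]; norm_cast]
        field_simp
      _ ≤ _ := e4
  · rw [heq, DegreeSeq.exponent_eq hn hN.lam_pos.ne' hN.lam_lt.ne']
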